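/- Let C be an irreducible plane quartic over ℂ with a cusp (respectively a tacnode) at p, and set t = 8 (respectively t = 12). Let f: 𝒞 → B be a smoothing of C to plane quartics with 𝒞 smooth. Then there is a finite base change B′ → B totally ramified over 0 ∈ B such that for the pulled-back family f′: 𝒞×_B B′ → B′ the cycle of the limit Weierstrass scheme is [W_{f′,0}] = Σ_{i=1}^{24−t} qᵢ + t·p, where p ∉ {q₁,…,q_{24−t}}. -/

import Mathlib

/-!
STATEMENT 9 (Pacini–Testa, Lemma `custac`): let `C` be an irreducible plane quartic
over ℂ with a cusp (resp. a tacnode) at `p`, and set `t = 8` (resp. `t = 12`).  Let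
`f : 𝒞 → B` be a smoothing of `C` to plane quartics with smooth total space `𝒞`.  Then
there is a finite base change `B′ → B`, totally ramified over `0 ∈ B` (here `t ↦ sᵉ`),
such that the cycle of the limit Weierstrass scheme of the pulled-back family
`f′ : 𝒞 ×_B B′ → B′` is `[W_{f′,0}] = Σ_{i=1}^{24−t} qᵢ + t·p` with
`p ∉ {q₁, …, q_{24−t}}`, i.e. a scale-invariant cycle `c` of total degree 24 with
`c(p) = t` exactly.

The Weierstrass points of the smooth quartic fibers are their inflection points,
weighted by (contact order of the tangent line − 2); the cycle `[W_{f′,0}]` is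
characterized as the limit of these weighted cycles as `t → 0` (the fiber at `0` of the
closure `W_{f′}` of the Weierstrass loci of the nearby fibers).  A cusp (resp. tacnode)
is a singular point with complete local ring `ℂ[[x,y]]/(y²−x³)` (resp.
`ℂ[[x,y]]/(y²−x⁴)`), expressed via the rank of the Hessian quadratic form and the
relevant higher-order coefficients.
-/

open MvPolynomial Polynomial Filter

noncomputable section

namespace Infl

def dotv (w p : Fin 3 → ℂ) : ℂ := ∑ i, w i * p i

def lineRestrict (F : MvPolynomial (Fin 3) ℂ) (a b : Fin 3 → ℂ) : Polynomial ℂ :=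
  MvPolynomial.aeval (fun i => Polynomial.C (a i) + Polynomial.C (b i) * Polynomial.X) F

def contactAt (F : MvPolynomial (Fin 3) ℂ) (a b : Fin 3 → ℂ) : ℕ :=
  (lineRestrict F a b).rootMultiplicity 0

def IsSmoothCurve (F : MvPolynomial (Fin 3) ℂ) (d : ℕ) : Prop :=
  F.IsHomogeneous d ∧ F ≠ 0 ∧
    ∀ p : Fin 3 → ℂ, p ≠ 0 → eval p F = 0 → ∃ i, eval p (pderiv i F) ≠ 0

def SingAt (F : MvPolynomial (Fin 3) ℂ) (p : Fin 3 → ℂ) : Prop :=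
  eval p F = 0 ∧ ∀ i, eval p (pderiv i F) = 0

def gradVec (F : MvPolynomial (Fin 3) ℂ) (p : Fin 3 → ℂ) : Fin 3 → ℂ :=
  fun i => eval p (pderiv i F)

def padm (n : ℕ) : ℕ := n - 2

/-- The inflectionary (Weierstrass) weight of the point `p` on a smooth plane quartic
`{F = 0}`: the contact order of its tangent line minus 2. -/
def flexWeightAt (F : MvPolynomial (Fin 3) ℂ) (p : Fin 3 → ℂ) : ℕ :=
  ⨆ v, ⨆ _ : LinearIndependent ℂ ![p, v] ∧ dotv (gradVec F p) v = 0,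
    padm (contactAt F p v)

def projNear (ε : ℝ) (w w₀ : Fin 3 → ℂ) : Prop := ∃ c : ℂ, ‖c • w - w₀‖ < ε

open Classical in
/-- The total inflectionary weight of `{F = 0}` at points `ε`-close to `p₀`. -/
def flexNear (F : MvPolynomial (Fin 3) ℂ) (p₀ : Fin 3 → ℂ) (ε : ℝ) : ℕ :=
  ∑ᶠ x : Projectivization ℂ (Fin 3 → ℂ),
    if projNear ε x.rep p₀ then flexWeightAt F x.rep else 0

/-- An algebraic family of plane quartics over `B`: a polynomial in `x₀,x₁,x₂` and in
the parameter `t = X 3` of the base; `fiberAt Q t` is the quartic over `t ∈ B`. -/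
def fiberAt (Q : MvPolynomial (Fin 4) ℂ) (t : ℂ) : MvPolynomial (Fin 3) ℂ :=
  MvPolynomial.aeval
    (fun i : Fin 4 => if h : (i : ℕ) < 3 then X ⟨i, h⟩ else MvPolynomial.C t) Q

/-- `Q` is a smoothing of the plane quartic `F₀` to plane quartics. -/
def IsQuarticSmoothing (Q : MvPolynomial (Fin 4) ℂ) (F₀ : MvPolynomial (Fin 3) ℂ) : Prop :=
  fiberAt Q 0 = F₀ ∧ (∀ t, (fiberAt Q t).IsHomogeneous 4) ∧
    ∀ᶠ t in nhdsWithin (0 : ℂ) {0}ᶜ, IsSmoothCurve (fiberAt Q t) 4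

/-- `c` is the cycle `[W_{f,0}]` of the limit Weierstrass (= inflection) scheme of the
family `Q`: `c` is scale invariant, and near every point `p₀` of the central fiber,
for every small `ε` and every small `t ≠ 0` the total inflectionary weight of the
fiber at `t` near `p₀` is `c p₀`. -/
def IsLimitWeierstrassCycle (Q : MvPolynomial (Fin 4) ℂ) (c : (Fin 3 → ℂ) → ℕ) : Prop :=
  (∀ u : ℂ, u ≠ 0 → ∀ p, c (u • p) = c p) ∧
    ∀ p₀ : Fin 3 → ℂ, p₀ ≠ 0 →
      ∀ᶠ ε in nhdsWithin (0 : ℝ) (Set.Ioi 0),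
        ∀ᶠ t in nhdsWithin (0 : ℂ) {0}ᶜ, flexNear (fiberAt Q t) p₀ ε = c p₀

/-- The total degree of a scale-invariant cycle of points. -/
def cycleDeg (c : (Fin 3 → ℂ) → ℕ) : ℕ :=
  ∑ᶠ x : Projectivization ℂ (Fin 3 → ℂ), c x.rep

/-- Evaluation of the family `Q` at the point `(p, t₀)` of `ℙ² × B`. -/
def evalFam (Q : MvPolynomial (Fin 4) ℂ) (p : Fin 3 → ℂ) (t₀ : ℂ) : ℂ :=
  MvPolynomial.eval (fun i : Fin 4 => if h : (i : ℕ) < 3 then p ⟨i, h⟩ else t₀) Q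

/-- The total space `𝒞 = {Q = 0} ⊆ ℙ² × B` is smooth at the point `(p, 0)`. -/
def TotalSpaceSmoothAt (Q : MvPolynomial (Fin 4) ℂ) (p : Fin 3 → ℂ) : Prop :=
  ¬ (evalFam Q p 0 = 0 ∧ ∀ i : Fin 4, evalFam (pderiv i Q) p 0 = 0)

/-- The total space `𝒞 = {Q = 0} ⊆ ℙ² × B` is smooth (along the central fiber). -/
def TotalSpaceSmooth (Q : MvPolynomial (Fin 4) ℂ) : Prop :=
  ∀ p : Fin 3 → ℂ, p ≠ 0 → TotalSpaceSmoothAt Q p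

end Infl

namespace Infl

def hessMat (F : MvPolynomial (Fin 3) ℂ) (p : Fin 3 → ℂ) : Matrix (Fin 3) (Fin 3) ℂ :=
  Matrix.of fun i j => eval p (pderiv i (pderiv j F))

def cubicForm (F : MvPolynomial (Fin 3) ℂ) (p v : Fin 3 → ℂ) : ℂ :=
  ∑ i, ∑ j, ∑ l, eval p (pderiv i (pderiv j (pderiv l F))) * v i * v j * v l

def IsCuspAt (F : MvPolynomial (Fin 3) ℂ) (p : Fin 3 → ℂ) : Prop :=
  SingAt F p ∧ (hessMat F p).rank = 1 ∧
    ∀ v, (hessMat F p).mulVec v = 0 → LinearIndependent ℂ ![p, v] → cubicForm F p v ≠ 0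

def planeSubst (F : MvPolynomial (Fin 3) ℂ) (p v u : Fin 3 → ℂ) : MvPolynomial (Fin 2) ℂ :=
  MvPolynomial.aeval
    (fun i => MvPolynomial.C (p i) + MvPolynomial.C (v i) * X 0 + MvPolynomial.C (u i) * X 1) F

def coeffST (g : MvPolynomial (Fin 2) ℂ) (i j : ℕ) : ℂ :=
  MvPolynomial.coeff (Finsupp.single 0 i + Finsupp.single 1 j) g

def IsTacnodeAt (F : MvPolynomial (Fin 3) ℂ) (p : Fin 3 → ℂ) : Prop :=
  SingAt F p ∧ ∃ v u : Fin 3 → ℂ, LinearIndependent ℂ ![p, v, u] ∧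
    coeffST (planeSubst F p v u) 2 0 = 0 ∧ coeffST (planeSubst F p v u) 1 1 = 0 ∧
    coeffST (planeSubst F p v u) 0 2 ≠ 0 ∧ coeffST (planeSubst F p v u) 3 0 = 0 ∧
    4 * coeffST (planeSubst F p v u) 0 2 * coeffST (planeSubst F p v u) 4 0 -
      (coeffST (planeSubst F p v u) 2 1) ^ 2 ≠ 0

/-- Base change `t ↦ sᵉ` of the family `Q`, totally ramified over `0 ∈ B`. -/
def baseChange (Q : MvPolynomial (Fin 4) ℂ) (e : ℕ) : MvPolynomial (Fin 4) ℂ :=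
  MvPolynomial.aeval (fun i : Fin 4 => if (i : ℕ) < 3 then X i else (X i) ^ e) Q

section

/-! ### Part A: general facts on polynomials and limits -/

/-- The topology of coefficientwise convergence on polynomials. -/
instance polyTop {R : Type*} [Semiring R] [TopologicalSpace R] : TopologicalSpace (Polynomial R) :=
  TopologicalSpace.induced (fun P n => P.coeff n) inferInstance

theorem tendsto_poly_iff {R : Type*} [Semiring R] [TopologicalSpace R] {T : Type*} {l : Filter T}
    {f : T → Polynomial R} {f0 : Polynomial R} :
    Tendsto f l (nhds f0) ↔ ∀ n, Tendsto (fun τ => (f τ).coeff n) l (nhds (f0.coeff n)) := by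
  have h : Topology.IsInducing (fun (P : Polynomial R) n => P.coeff n) := ⟨rfl⟩
  rw [h.tendsto_nhds_iff, tendsto_pi_nhds]
  rfl

theorem continuous_poly_iff {R : Type*} [Semiring R] [TopologicalSpace R] {T : Type*}
    [TopologicalSpace T] {f : T → Polynomial R} :
    Continuous f ↔ ∀ n, Continuous (fun τ => (f τ).coeff n) := by
  simp only [continuous_iff_continuousAt, ContinuousAt, tendsto_poly_iff]
  tauto

theorem continuous_coeff {R : Type*} [Semiring R] [TopologicalSpace R] (n : ℕ) :
    Continuous (fun P : Polynomial R => P.coeff n) :=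
  continuous_poly_iff.1 continuous_id n

instance polyTopRing {R : Type*} [CommRing R] [TopologicalSpace R] [IsTopologicalRing R] :
    IsTopologicalRing (Polynomial R) where
  continuous_add := by
    rw [continuous_poly_iff]; intro n
    simp only [Polynomial.coeff_add]
    exact ((continuous_coeff n).comp continuous_fst).add ((continuous_coeff n).comp continuous_snd)
  continuous_mul := by
    rw [continuous_poly_iff]; intro n
    simp only [Polynomial.coeff_mul]
    exact continuous_finsetSum _ fun i _ =>
      ((continuous_coeff _).comp continuous_fst).mul ((continuous_coeff _).comp continuous_snd)
  continuous_neg := by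
    rw [continuous_poly_iff]; intro n
    simp only [Polynomial.coeff_neg]
    exact (continuous_coeff n).neg

theorem continuous_polyC {R : Type*} [Semiring R] [TopologicalSpace R] :
    Continuous (fun a : R => Polynomial.C a) := by
  rw [continuous_poly_iff]; intro n
  simp only [Polynomial.coeff_C]
  split_ifs
  · exact continuous_id
  · exact continuous_const

theorem continuous_resultant {R : Type*} [CommRing R] [TopologicalSpace R] [IsTopologicalRing R]
    {T : Type*} [TopologicalSpace T] {f g : T → Polynomial R} (hf : Continuous f)
    (hg : Continuous g) (m n : ℕ) :
    Continuous fun τ => Polynomial.resultant (f τ) (g τ) m n := by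
  unfold Polynomial.resultant
  apply Continuous.matrix_det
  apply continuous_matrix
  intro i j
  simp only [Polynomial.sylvester, Matrix.of_apply]
  induction j using Fin.addCases with
  | left j =>
    simp only [Fin.addCases_left]
    split_ifs
    · exact (continuous_coeff _).comp hg
    · exact continuous_const
  | right j =>
    simp only [Fin.addCases_right]
    split_ifs
    · exact (continuous_coeff _).comp hf
    · exact continuous_const

theorem continuous_mvaeval {σ : Type*} {R : Type*} [CommRing R] [Algebra ℂ R] [TopologicalSpace R]
    [IsTopologicalRing R] {T : Type*} [TopologicalSpace T] {s : T → σ → R}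
    (hs : ∀ i, Continuous fun τ => s τ i) (A : MvPolynomial σ ℂ) :
    Continuous fun τ => MvPolynomial.aeval (s τ) A := by
  induction A using MvPolynomial.induction_on with
  | C a => simpa using continuous_const
  | add p q hp hq => simp only [map_add]; exact hp.add hq
  | mul_X p i hp => simp only [map_mul, MvPolynomial.aeval_X]; exact hp.mul (hs i)

/-- Order of vanishing from asymptotics. -/
theorem rootMult_of_tendsto (P : Polynomial ℂ) (x0 κ : ℂ) (N : ℕ) (l : Filter ℂ) [l.NeBot]
    (hl : l ≤ nhdsWithin 0 {0}ᶜ) (hκ : κ ≠ 0)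
    (h : Tendsto (fun s => P.eval (x0 + s) / s ^ N) l (nhds κ)) :
    P.rootMultiplicity x0 = N := by
  have h0 : Tendsto (fun s : ℂ => s) l (nhds 0) := (tendsto_id.mono_left hl).mono_right
    nhdsWithin_le_nhds
  have hne : ∀ᶠ s in l, s ≠ 0 := hl self_mem_nhdsWithin
  have hP : P ≠ 0 := by
    rintro rfl
    simp only [Polynomial.eval_zero, zero_div] at h
    exact hκ (tendsto_nhds_unique h tendsto_const_nhds)
  obtain ⟨Q, hQ, hQ0⟩ := Polynomial.exists_eq_pow_rootMultiplicity_mul_and_not_dvd P hP x0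
  set m := P.rootMultiplicity x0
  have hQx : Q.eval x0 ≠ 0 := fun h => hQ0 (Polynomial.dvd_iff_isRoot.2 h)
  have hQt : Tendsto (fun s => Q.eval (x0 + s)) l (nhds (Q.eval x0)) := by
    have : Tendsto (fun s => Q.eval (x0 + s)) l (nhds (Q.eval (x0 + 0))) :=
      (Q.continuous.tendsto _).comp (tendsto_const_nhds.add h0)
    simpa using this
  have hev : ∀ s, P.eval (x0 + s) = s ^ m * Q.eval (x0 + s) := by
    intro s; conv_lhs => rw [hQ]
    simp
  rcases lt_trichotomy m N with hlt | heq | hgt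
  · exfalso
    have h1 : Tendsto (fun s => s ^ (N - m) * (P.eval (x0 + s) / s ^ N)) l
        (nhds (0 ^ (N - m) * κ)) := (h0.pow _).mul h
    rw [zero_pow (by omega), zero_mul] at h1
    have h2 : (fun s => s ^ (N - m) * (P.eval (x0 + s) / s ^ N)) =ᶠ[l] fun s => Q.eval (x0 + s) := by
      filter_upwards [hne] with s hs
      rw [hev]
      have : s ^ N = s ^ (N - m) * s ^ m := by rw [← pow_add]; congr 1; omega
      rw [this]; field_simp
    exact hQx (tendsto_nhds_unique hQt (h1.congr' h2))
  · exact heq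
  · exfalso
    have h1 : Tendsto (fun s => s ^ (m - N) * Q.eval (x0 + s)) l
        (nhds (0 ^ (m - N) * Q.eval x0)) := (h0.pow _).mul hQt
    rw [zero_pow (by omega), zero_mul] at h1
    have h2 : (fun s => s ^ (m - N) * Q.eval (x0 + s)) =ᶠ[l] fun s => P.eval (x0 + s) / s ^ N := by
      filter_upwards [hne] with s hs
      rw [hev]
      have : s ^ m = s ^ (m - N) * s ^ N := by rw [← pow_add]; congr 1; omega
      rw [this]; field_simp
    exact hκ (tendsto_nhds_unique h (h1.congr' h2))

/-- A root of a convergent family of polynomials of bounded degree converges along an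
ultrafilter, if the leading coefficient does not tend to zero. -/
theorem root_converges {T : Type*} (U : Ultrafilter T) (P : T → Polynomial ℂ) (P0 : Polynomial ℂ)
    (n : ℕ) (hP : Tendsto P U (nhds P0)) (hdeg : ∀ᶠ τ in U, (P τ).natDegree ≤ n)
    (hn : P0.coeff n ≠ 0) (r : T → ℂ) (hr : ∀ᶠ τ in U, (P τ).eval (r τ) = 0) :
    ∃ ρ, Tendsto r U (nhds ρ) := by
  rw [tendsto_poly_iff] at hP
  have hlead : ∀ᶠ τ in U, ‖P0.coeff n‖ / 2 < ‖(P τ).coeff n‖ :=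
    (hP n).norm.eventually_const_lt (half_lt_self (norm_pos_iff.2 hn))
  have hco : ∀ᶠ τ in U, ∀ i ∈ Finset.range n, ‖(P τ).coeff i‖ < ‖P0.coeff i‖ + 1 := by
    rw [Filter.eventually_all_finset]
    intro i _
    exact (hP i).norm.eventually_lt_const (by linarith)
  have hpos : 0 < ‖P0.coeff n‖ := norm_pos_iff.2 hn
  set K : ℝ := (∑ i ∈ Finset.range n, (‖P0.coeff i‖ + 1)) / (‖P0.coeff n‖ / 2) + 1
  have hb : ∀ᶠ τ in U, r τ ∈ Metric.closedBall (0 : ℂ) K := by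
    filter_upwards [hlead, hco, hdeg, hr] with τ h1 h2 h3 h4
    have hlc : (P τ).coeff n ≠ 0 := by
      intro h; rw [h, norm_zero] at h1; linarith
    have hnd : (P τ).natDegree = n := le_antisymm h3 (Polynomial.le_natDegree_of_ne_zero hlc)
    have hP0 : P τ ≠ 0 := by rintro h; simp [h] at hlc
    have h5 : ‖r τ‖ < (Polynomial.cauchyBound (P τ) : ℝ) := by
      exact_mod_cast Polynomial.IsRoot.norm_lt_cauchyBound hP0 h4
    rw [mem_closedBall_zero_iff]
    refine h5.le.trans ?_
    unfold Polynomial.cauchyBound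
    rw [Polynomial.leadingCoeff, hnd]
    push_cast
    refine add_le_add ?_ le_rfl
    refine div_le_div₀ (Finset.sum_nonneg fun i _ => by positivity) ?_ (by positivity) h1.le
    have : ((Finset.range n).sup fun x => ‖(P τ).coeff x‖₊) ≤
        ∑ i ∈ Finset.range n, (‖P0.coeff i‖₊ + 1) := by
      apply Finset.sup_le
      intro i hi
      refine le_trans ?_ (Finset.single_le_sum
        (f := fun i => (‖P0.coeff i‖₊ + 1)) (fun _ _ => zero_le) hi)
      exact_mod_cast (h2 i hi).le
    have h6 := NNReal.coe_le_coe.2 this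
    simpa only [NNReal.coe_sum, NNReal.coe_add, coe_nnnorm, NNReal.coe_one] using h6
  obtain ⟨ρ, _, hρ⟩ := (isCompact_closedBall (0 : ℂ) K).ultrafilter_le_nhds (U.map r)
    (Filter.le_principal_iff.2 hb)
  exact ⟨ρ, hρ⟩

theorem tendsto_poly_eval {T : Type*} {l : Filter T} {P : T → Polynomial ℂ} {P0 : Polynomial ℂ}
    (n : ℕ) (hP : Tendsto P l (nhds P0)) (hdeg : ∀ᶠ τ in l, (P τ).natDegree ≤ n)
    (hdeg0 : P0.natDegree ≤ n) (x : ℂ) :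
    Tendsto (fun τ => (P τ).eval x) l (nhds (P0.eval x)) := by
  rw [tendsto_poly_iff] at hP
  rw [Polynomial.eval_eq_sum_range' (Nat.lt_succ_of_le hdeg0)]
  have : Tendsto (fun τ => ∑ i ∈ Finset.range (n+1), (P τ).coeff i * x ^ i) l
      (nhds (∑ i ∈ Finset.range (n+1), P0.coeff i * x ^ i)) :=
    tendsto_finsetSum _ fun i _ => (hP i).mul_const _
  refine this.congr' ?_
  filter_upwards [hdeg] with τ h
  rw [Polynomial.eval_eq_sum_range' (Nat.lt_succ_of_le h)]

theorem natDegree_le_of_tendsto {T : Type*} {l : Filter T} [l.NeBot] {P : T → Polynomial ℂ}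
    {P0 : Polynomial ℂ}
    (n : ℕ) (hP : Tendsto P l (nhds P0)) (hdeg : ∀ᶠ τ in l, (P τ).natDegree ≤ n) :
    P0.natDegree ≤ n := by
  rw [tendsto_poly_iff] at hP
  rw [Polynomial.natDegree_le_iff_coeff_eq_zero]
  intro N hN
  refine tendsto_nhds_unique (hP N) (tendsto_const_nhds.congr' ?_)
  filter_upwards [hdeg] with τ h
  exact (Polynomial.coeff_eq_zero_of_natDegree_lt (lt_of_le_of_lt h hN)).symm

theorem natDegree_prod_form {n : ℕ} (c : ℂ) (r : Fin n → ℂ) :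
    (Polynomial.C c * ∏ i, (Polynomial.X - Polynomial.C (r i))).natDegree ≤ n := by
  refine (Polynomial.natDegree_C_mul_le _ _).trans ?_
  rw [Polynomial.natDegree_prod_of_monic _ _ fun i _ => Polynomial.monic_X_sub_C _]
  simp

/-- Continuity of roots along ultrafilters. -/
theorem roots_converge {T : Type*} (U : Ultrafilter T) (P : T → Polynomial ℂ) (P0 : Polynomial ℂ)
    (n : ℕ) (hP : Tendsto P U (nhds P0)) (hn : P0.coeff n ≠ 0) (c : T → ℂ) (c0 : ℂ)
    (hc : Tendsto c U (nhds c0)) (r : T → Fin n → ℂ)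
    (hr : ∀ᶠ τ in U, P τ = Polynomial.C (c τ) *
      ∏ i, (Polynomial.X - Polynomial.C (r τ i))) :
    ∃ ρ : Fin n → ℂ, (∀ i, Tendsto (fun τ => r τ i) U (nhds (ρ i))) ∧
      P0 = Polynomial.C c0 * ∏ i, (Polynomial.X - Polynomial.C (ρ i)) := by
  have hdeg : ∀ᶠ τ in U, (P τ).natDegree ≤ n := by
    filter_upwards [hr] with τ h
    rw [h]; exact natDegree_prod_form _ _
  have hroot : ∀ i, ∃ ρ, Tendsto (fun τ => r τ i) U (nhds ρ) := by
    intro i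
    refine root_converges U P P0 n hP hdeg hn _ ?_
    filter_upwards [hr] with τ h
    rw [h, Polynomial.eval_mul, Polynomial.eval_prod]
    rw [Finset.prod_eq_zero (Finset.mem_univ i) (by simp), mul_zero]
  choose ρ hρ using hroot
  refine ⟨ρ, hρ, ?_⟩
  apply Polynomial.funext
  intro x
  refine tendsto_nhds_unique
    (tendsto_poly_eval n hP hdeg (natDegree_le_of_tendsto n hP hdeg) x) ?_
  have : Tendsto (fun τ => c τ * ∏ i, (x - r τ i)) U (nhds (c0 * ∏ i, (x - ρ i))) :=
    hc.mul (tendsto_finsetProd _ fun i _ => tendsto_const_nhds.sub (hρ i))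
  simp only [Polynomial.eval_mul, Polynomial.eval_C, Polynomial.eval_prod, Polynomial.eval_sub,
    Polynomial.eval_X]
  refine this.congr' ?_
  filter_upwards [hr] with τ h
  rw [h]
  simp [Polynomial.eval_prod]

theorem exists_roots_form (P : Polynomial ℂ) (n : ℕ) (h : P.natDegree = n) :
    ∃ r : Fin n → ℂ, P = Polynomial.C P.leadingCoeff *
      ∏ i, (Polynomial.X - Polynomial.C (r i)) := by
  have hs := IsAlgClosed.splits P
  have hcard := hs.natDegree_eq_card_roots
  have hl : P.roots.toList.length = n := by simp [← hcard, h]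
  subst hl
  refine ⟨fun i => P.roots.toList.get i, ?_⟩
  conv_lhs => rw [hs.eq_prod_roots]
  congr 1
  conv_lhs => rw [← Multiset.coe_toList P.roots]
  rw [Multiset.map_coe, Multiset.prod_coe, ← List.prod_ofFn]
  congr 1
  conv_lhs => rw [← List.ofFn_get P.roots.toList, List.map_ofFn]
  rfl

theorem rootMult_form {n : ℕ} (c : ℂ) (hc : c ≠ 0) (r : Fin n → ℂ) (x : ℂ) :
    (Polynomial.C c * ∏ i, (Polynomial.X - Polynomial.C (r i))).rootMultiplicity x =
      (Finset.univ.filter fun i => r i = x).card := by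
  classical
  rw [← Polynomial.count_roots, Polynomial.roots_C_mul _ hc]
  have : (∏ i, (Polynomial.X - Polynomial.C (r i))) =
      ((Finset.univ.val.map r).map fun a => Polynomial.X - Polynomial.C a).prod := by
    rw [Multiset.map_map]; rfl
  rw [this, Polynomial.roots_multiset_prod_X_sub_C, Multiset.count_map]
  simp only [Finset.card, Finset.filter_val, eq_comm]

theorem degree_of_reflect (P P' : Polynomial ℂ) (N : ℕ)
    (h : ∀ x : ℂ, x ≠ 0 → P.eval x = x ^ N * P'.eval x⁻¹) (h0 : P'.eval 0 ≠ 0) :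
    P.natDegree = N ∧ P.leadingCoeff = P'.eval 0 := by
  set d := P.natDegree
  have hP0 : P ≠ 0 := by
    rintro rfl
    have : P' = 0 := by
      apply Polynomial.eq_zero_of_infinite_isRoot
      apply Set.Infinite.mono (s := {0}ᶜ) _ (Set.Finite.infinite_compl (Set.finite_singleton _))
      intro y hy
      have := h y⁻¹ (inv_ne_zero hy)
      simp only [Polynomial.eval_zero, inv_inv] at this
      have h2 := mul_eq_zero.1 this.symm
      rcases h2 with h2 | h2
      · exact absurd (pow_eq_zero_iff'.1 h2).1 (inv_ne_zero hy)
      · exact h2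
    simp [this] at h0
  have hrev : ∀ y : ℂ, y ≠ 0 → P.reverse.eval y * y ^ N = P'.eval y * y ^ d := by
    intro y hy
    have h1 := h y⁻¹ (inv_ne_zero hy)
    let _ : Invertible (y⁻¹) := invertibleOfNonzero (inv_ne_zero hy)
    have h2 := Polynomial.eval₂_reverse_mul_pow (RingHom.id ℂ) (y⁻¹) P
    rw [invOf_eq_inv, inv_inv, Polynomial.eval₂_id, Polynomial.eval₂_id, h1, inv_inv] at h2
    have : (y⁻¹) ^ P.natDegree = (y ^ d)⁻¹ := inv_pow _ _
    rw [this, inv_pow] at h2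
    field_simp at h2
    linear_combination h2
  have hpoly : P.reverse * Polynomial.X ^ N = P' * Polynomial.X ^ d := by
    rw [← sub_eq_zero]
    apply Polynomial.eq_zero_of_infinite_isRoot
    apply Set.Infinite.mono (s := {0}ᶜ) _ (Set.Finite.infinite_compl (Set.finite_singleton _))
    intro y hy
    have := hrev y hy
    simp [Polynomial.IsRoot, this]
  have hr0 : P.reverse.coeff 0 ≠ 0 := by simpa using hP0
  have hp0 : P'.coeff 0 ≠ 0 := by rwa [Polynomial.coeff_zero_eq_eval_zero]
  have hNd : d = N := by
    rcases lt_trichotomy d N with hlt | heq | hgt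
    · have := congrArg (fun q => Polynomial.coeff q d) hpoly
      simp only [Polynomial.coeff_mul_X_pow', le_refl, if_true, Nat.sub_self] at this
      rw [if_neg (by omega)] at this
      exact absurd this.symm hp0
    · exact heq
    · have := congrArg (fun q => Polynomial.coeff q N) hpoly
      simp only [Polynomial.coeff_mul_X_pow', le_refl, if_true, Nat.sub_self] at this
      rw [if_neg (by omega)] at this
      exact absurd this hr0
  refine ⟨hNd, ?_⟩
  have := congrArg (fun q => Polynomial.coeff q d) hpoly
  simp only [hNd, Polynomial.coeff_mul_X_pow', le_refl, if_true, Nat.sub_self] at this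
  rw [← Polynomial.coeff_zero_eq_eval_zero, ← this, Polynomial.coeff_zero_reverse]

theorem exists_generic {V : Type*} [NormedAddCommGroup V] [NormedSpace ℂ V] [FiniteDimensional ℂ V]
    (W : Set V) (hW : IsOpen W) (hne : W.Nonempty)
    {ι : Type*} (S : Set ι) (hS : S.Finite) (f : ι → (V →ₗ[ℂ] ℂ)) (hf : ∀ i ∈ S, f i ≠ 0) :
    ∃ x ∈ W, ∀ i ∈ S, f i x ≠ 0 := by
  have : CompleteSpace V := FiniteDimensional.complete ℂ V
  have hcont : ∀ i, Continuous (f i) := fun i => (f i).continuous_of_finiteDimensional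
  have hd : Dense (⋂ i ∈ S, {x : V | f i x ≠ 0}) := by
    apply dense_biInter_of_isOpen
    · intro i _
      exact isOpen_ne.preimage (hcont i)
    · exact hS.countable
    · intro i hi
      have : {x : V | f i x ≠ 0} = ((LinearMap.ker (f i) : Submodule ℂ V) : Set V)ᶜ := by
        ext x; simp
      rw [this, ← interior_eq_empty_iff_dense_compl]
      by_contra hcon
      have := Submodule.eq_top_of_nonempty_interior' (R := ℂ) (LinearMap.ker (f i))
        (Set.nonempty_iff_ne_empty.2 hcon)
      exact hf i hi (LinearMap.ker_eq_top.1 this)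
  obtain ⟨x, hx, hxW⟩ := hd.exists_mem_open hW hne
  exact ⟨x, hxW, by simpa using hx⟩

theorem eventually_of_ultra {T : Type*} {l : Filter T} {p : T → Prop}
    (h : ∀ U : Ultrafilter T, (U : Filter T) ≤ l → ∀ᶠ τ in (U : Filter T), p τ) :
    ∀ᶠ τ in l, p τ := Filter.mem_iff_ultrafilter.2 h

end

section

/-! ### Part B: algebra of the Hessian and the resultant -/

theorem eval_hom {F : MvPolynomial (Fin 3) ℂ} {n : ℕ} (h : F.IsHomogeneous n) (s : ℂ)
    (p : Fin 3 → ℂ) : MvPolynomial.eval (s • p) F = s ^ n * MvPolynomial.eval p F := by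
  rw [MvPolynomial.eval_eq, MvPolynomial.eval_eq, Finset.mul_sum]
  refine Finset.sum_congr rfl fun d hd => ?_
  have hd' : ∑ i ∈ d.support, d i = n := by
    have := h (MvPolynomial.mem_support_iff.1 hd)
    rw [← this, Finsupp.weight_apply, Finsupp.sum]; simp
  simp only [Pi.smul_apply, smul_eq_mul, mul_pow, Finset.prod_mul_distrib, Finset.prod_pow_eq_pow_sum,
    hd']
  ring

theorem eval_lineRestrict (F : MvPolynomial (Fin 3) ℂ) (a b : Fin 3 → ℂ) (s : ℂ) :
    (lineRestrict F a b).eval s = MvPolynomial.eval (a + s • b) F := by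
  unfold lineRestrict
  have : (Polynomial.evalRingHom s).comp (MvPolynomial.aeval (R := ℂ)
      (fun i => Polynomial.C (a i) + Polynomial.C (b i) * Polynomial.X)).toRingHom =
      MvPolynomial.eval (a + s • b) := by
    apply MvPolynomial.ringHom_ext
    · intro r; simp
    · intro i; simp; ring
  exact congrArg (fun f => f F) this

theorem lineRestrict_natDegree_le {F : MvPolynomial (Fin 3) ℂ} {n : ℕ} (h : F.IsHomogeneous n)
    (a b : Fin 3 → ℂ) : (lineRestrict F a b).natDegree ≤ n := by
  have := MvPolynomial.aeval_natDegree_le (m := n) (n := 1) F h.totalDegree_le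
    (fun i => Polynomial.C (a i) + Polynomial.C (b i) * Polynomial.X) (fun i => by
      compute_degree)
  simpa [lineRestrict] using this

theorem lineRestrict_lead {F : MvPolynomial (Fin 3) ℂ} {n : ℕ} (h : F.IsHomogeneous n)
    (a O : Fin 3 → ℂ) (hO : MvPolynomial.eval O F ≠ 0) :
    (lineRestrict F a O).natDegree = n ∧
      (lineRestrict F a O).leadingCoeff = MvPolynomial.eval O F := by
  have := degree_of_reflect (lineRestrict F a O) (lineRestrict F O a) n ?_ ?_
  · simpa [eval_lineRestrict] using this
  · intro x hx
    rw [eval_lineRestrict, eval_lineRestrict, ← eval_hom h]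
    congr 2
    rw [smul_add, smul_smul, mul_inv_cancel₀ hx, one_smul, add_comm]
  · simpa [eval_lineRestrict] using hO

/-- The Hessian covariant. -/
def hs (G : MvPolynomial (Fin 3) ℂ) : MvPolynomial (Fin 3) ℂ :=
  Matrix.det (Matrix.of fun i j => MvPolynomial.pderiv i (MvPolynomial.pderiv j G))

theorem eval_hs (G : MvPolynomial (Fin 3) ℂ) (p : Fin 3 → ℂ) :
    MvPolynomial.eval p (hs G) = (hessMat G p).det := by
  unfold hs hessMat
  rw [RingHom.map_det]
  rfl

theorem hs_hom {G : MvPolynomial (Fin 3) ℂ} (h : G.IsHomogeneous 4) : (hs G).IsHomogeneous 6 := by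
  have h2 : ∀ i j, (MvPolynomial.pderiv i (MvPolynomial.pderiv j G)).IsHomogeneous 2 :=
    fun i j => (h.pderiv (i := j)).pderiv (i := i)
  unfold hs
  rw [Matrix.det_fin_three]
  simp only [Matrix.of_apply]
  have h6 : ∀ a b c d e f, (MvPolynomial.pderiv a (MvPolynomial.pderiv b G) *
      MvPolynomial.pderiv c (MvPolynomial.pderiv d G) *
      MvPolynomial.pderiv e (MvPolynomial.pderiv f G)).IsHomogeneous 6 :=
    fun a b c d e f => ((h2 a b).mul (h2 c d)).mul (h2 e f)
  exact ((((h6 _ _ _ _ _ _).sub (h6 _ _ _ _ _ _)).sub (h6 _ _ _ _ _ _)).add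
    (h6 _ _ _ _ _ _)).add (h6 _ _ _ _ _ _) |>.sub (h6 _ _ _ _ _ _)

/-- Resultant of a quartic and its Hessian on the line `a + y O`. -/
def Rs (G : MvPolynomial (Fin 3) ℂ) (O a : Fin 3 → ℂ) : ℂ :=
  Polynomial.resultant (lineRestrict G a O) (lineRestrict (hs G) a O) 4 6

theorem Rs_eq {G : MvPolynomial (Fin 3) ℂ} (h : G.IsHomogeneous 4) (O a : Fin 3 → ℂ)
    (hO : MvPolynomial.eval O G ≠ 0) (w : Fin 4 → ℂ)
    (hw : lineRestrict G a O = Polynomial.C (MvPolynomial.eval O G) *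
      ∏ i, (Polynomial.X - Polynomial.C (w i))) :
    Rs G O a = MvPolynomial.eval O G ^ 6 * ∏ i, MvPolynomial.eval (a + w i • O) (hs G) := by
  obtain ⟨h1, h2⟩ := lineRestrict_lead h a O hO
  have := Polynomial.resultant_eq_prod_eval (lineRestrict G a O) (lineRestrict (hs G) a O) 6
    (lineRestrict_natDegree_le (hs_hom h) a O) (IsAlgClosed.splits _)
  rw [h1, h2] at this
  unfold Rs
  rw [this]
  congr 1
  have hr : (lineRestrict G a O).roots = Finset.univ.val.map w := by
    rw [hw, Polynomial.roots_C_mul _ hO]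
    have : (∏ i, (Polynomial.X - Polynomial.C (w i))) =
      ((Finset.univ.val.map w).map fun a => Polynomial.X - Polynomial.C a).prod := by
      rw [Multiset.map_map]; rfl
    rw [this, Polynomial.roots_multiset_prod_X_sub_C]
  rw [hr, Multiset.map_map]
  simp only [Function.comp_def, eval_lineRestrict]
  rfl

theorem exists_w {G : MvPolynomial (Fin 3) ℂ} (h : G.IsHomogeneous 4) (O a : Fin 3 → ℂ)
    (hO : MvPolynomial.eval O G ≠ 0) : ∃ w : Fin 4 → ℂ,
    lineRestrict G a O = Polynomial.C (MvPolynomial.eval O G) *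
      ∏ i, (Polynomial.X - Polynomial.C (w i)) := by
  obtain ⟨h1, h2⟩ := lineRestrict_lead h a O hO
  rw [← h2]
  exact exists_roots_form _ _ h1

theorem lr_eq_iff (G : MvPolynomial (Fin 3) ℂ) (O a : Fin 3 → ℂ) (c : ℂ) (w : Fin 4 → ℂ) :
    lineRestrict G a O = Polynomial.C c * ∏ i, (Polynomial.X - Polynomial.C (w i)) ↔
      ∀ y, MvPolynomial.eval (a + y • O) G = c * ∏ i, (y - w i) := by
  constructor
  · intro h y
    rw [← eval_lineRestrict, h]
    simp [Polynomial.eval_prod]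
  · intro h
    apply Polynomial.funext
    intro y
    rw [eval_lineRestrict, h]
    simp [Polynomial.eval_prod]

theorem Rs_smul {G : MvPolynomial (Fin 3) ℂ} (h : G.IsHomogeneous 4) (O a : Fin 3 → ℂ)
    (hO : MvPolynomial.eval O G ≠ 0) (s : ℂ) (hs0 : s ≠ 0) :
    Rs G O (s • a) = s ^ 24 * Rs G O a := by
  obtain ⟨w, hw⟩ := exists_w h O a hO
  have hw' := (lr_eq_iff _ _ _ _ _).1 hw
  rw [Rs_eq h O a hO w hw, Rs_eq h O (s • a) hO (fun i => s * w i)]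
  · have : ∀ i, MvPolynomial.eval (s • a + (s * w i) • O) (hs G) =
        s ^ 6 * MvPolynomial.eval (a + w i • O) (hs G) := by
      intro i
      rw [← eval_hom (hs_hom h), smul_add, smul_smul]
    simp only [this, Finset.prod_mul_distrib, Finset.prod_const, Finset.card_univ, Fintype.card_fin]
    ring
  · rw [lr_eq_iff]
    intro y
    have h1 : s • a + y • O = s • (a + (y / s) • O) := by
      rw [smul_add, smul_smul, mul_div_cancel₀ _ hs0]
    rw [h1, eval_hom h, hw']
    have : ∀ i, y - s * w i = s * (y / s - w i) := by intro i; field_simp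
    simp only [this, Finset.prod_mul_distrib, Finset.prod_const, Finset.card_univ, Fintype.card_fin]
    ring

theorem Rs_shift {G : MvPolynomial (Fin 3) ℂ} (h : G.IsHomogeneous 4) (O a : Fin 3 → ℂ)
    (hO : MvPolynomial.eval O G ≠ 0) (s : ℂ) :
    Rs G O (a + s • O) = Rs G O a := by
  obtain ⟨w, hw⟩ := exists_w h O a hO
  have hw' := (lr_eq_iff _ _ _ _ _).1 hw
  rw [Rs_eq h O a hO w hw, Rs_eq h O (a + s • O) hO (fun i => w i - s)]
  · congr 1
    refine Finset.prod_congr rfl fun i _ => ?_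
    congr 2
    rw [add_assoc, ← add_smul]; congr 2; ring
  · rw [lr_eq_iff]
    intro y
    rw [add_assoc, ← add_smul, hw']
    congr 1
    refine Finset.prod_congr rfl fun i _ => ?_
    ring

theorem Rs_eq_zero_iff {G : MvPolynomial (Fin 3) ℂ} (h : G.IsHomogeneous 4) (O a : Fin 3 → ℂ)
    (hO : MvPolynomial.eval O G ≠ 0) :
    Rs G O a = 0 ↔ ∃ y : ℂ, MvPolynomial.eval (a + y • O) G = 0 ∧
      MvPolynomial.eval (a + y • O) (hs G) = 0 := by
  obtain ⟨w, hw⟩ := exists_w h O a hO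
  have hw' := (lr_eq_iff _ _ _ _ _).1 hw
  rw [Rs_eq h O a hO w hw]
  constructor
  · intro h0
    have := (mul_eq_zero.1 h0).resolve_left (pow_ne_zero _ hO)
    obtain ⟨i, _, hi⟩ := Finset.prod_eq_zero_iff.1 this
    refine ⟨w i, ?_, hi⟩
    rw [hw', Finset.prod_eq_zero (Finset.mem_univ i) (sub_self _), mul_zero]
  · rintro ⟨y, h1, h2⟩
    rw [hw'] at h1
    have := (mul_eq_zero.1 h1).resolve_left hO
    obtain ⟨i, _, hi⟩ := Finset.prod_eq_zero_iff.1 this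
    rw [sub_eq_zero] at hi
    rw [hi] at h2
    rw [Finset.prod_eq_zero (Finset.mem_univ i) h2, mul_zero]

/-- The generic point `a + x b + y O` with coordinates in `ℂ[x][y]`. -/
def bi (O a b : Fin 3 → ℂ) (i : Fin 3) : Polynomial (Polynomial ℂ) :=
  Polynomial.C (Polynomial.C (a i) + Polynomial.C (b i) * Polynomial.X) +
    Polynomial.C (Polynomial.C (O i)) * Polynomial.X

def chow (G : MvPolynomial (Fin 3) ℂ) (O a b : Fin 3 → ℂ) : Polynomial ℂ :=
  Polynomial.resultant (MvPolynomial.aeval (bi O a b) G) (MvPolynomial.aeval (bi O a b) (hs G)) 4 6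

theorem map_bi (F : MvPolynomial (Fin 3) ℂ) (O a b : Fin 3 → ℂ) (x : ℂ) :
    (MvPolynomial.aeval (bi O a b) F).map (Polynomial.evalRingHom x) =
      lineRestrict F (a + x • b) O := by
  unfold lineRestrict
  have : (Polynomial.mapRingHom (Polynomial.evalRingHom x)).comp (MvPolynomial.aeval (R := ℂ)
      (bi O a b)).toRingHom =
      (MvPolynomial.aeval (R := ℂ)
        (fun i => Polynomial.C ((a + x • b) i) + Polynomial.C (O i) * Polynomial.X)).toRingHom := by
    apply MvPolynomial.ringHom_ext
    · intro r
      simp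
    · intro i; simp [bi]; ring
  exact congrArg (fun f => f F) this

theorem eval_chow (G : MvPolynomial (Fin 3) ℂ) (O a b : Fin 3 → ℂ) (x : ℂ) :
    (chow G O a b).eval x = Rs G O (a + x • b) := by
  unfold chow Rs
  rw [← map_bi, ← map_bi, Polynomial.resultant_map_map]
  rfl

theorem chow_degree {G : MvPolynomial (Fin 3) ℂ} (h : G.IsHomogeneous 4) (O a b : Fin 3 → ℂ)
    (hO : MvPolynomial.eval O G ≠ 0) (hb : Rs G O b ≠ 0) :
    (chow G O a b).natDegree = 24 ∧ (chow G O a b).leadingCoeff = Rs G O b := by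
  have := degree_of_reflect (chow G O a b) (chow G O b a) 24 ?_ ?_
  · simpa [eval_chow] using this
  · intro x hx
    rw [eval_chow, eval_chow, ← Rs_smul h _ _ hO _ hx]
    congr 1
    rw [smul_add, smul_smul, mul_inv_cancel₀ hx, one_smul, add_comm]
  · simpa [eval_chow] using hb

/-! #### Coprimality -/

def sh (O : Fin 3 → ℂ) : MvPolynomial (Fin 3) ℂ →ₐ[ℂ] Polynomial (MvPolynomial (Fin 3) ℂ) :=
  MvPolynomial.aeval fun i => Polynomial.C (MvPolynomial.X i) +
    Polynomial.C (MvPolynomial.C (O i)) * Polynomial.X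

def tau (O : Fin 3 → ℂ) : Polynomial (MvPolynomial (Fin 3) ℂ) →+*
    Polynomial (MvPolynomial (Fin 3) ℂ) :=
  Polynomial.eval₂RingHom (sh O).toRingHom Polynomial.X

theorem tau_C (O : Fin 3 → ℂ) (F) : tau O (Polynomial.C F) = sh O F := by simp [tau]

theorem sh_C (O : Fin 3 → ℂ) (r : ℂ) : sh O (MvPolynomial.C r) =
    Polynomial.C (MvPolynomial.C r) := by
  have := (sh O).commutes r
  rw [MvPolynomial.algebraMap_eq] at this
  rw [this, Polynomial.algebraMap_apply, MvPolynomial.algebraMap_eq]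

theorem tau_tau (O O' : Fin 3 → ℂ) (h : O + O' = 0) : (tau O').comp (tau O) = RingHom.id _ := by
  apply Polynomial.ringHom_ext'
  · apply MvPolynomial.ringHom_ext
    · intro r
      simp [tau, sh_C]
    · intro i
      have hi : O' i = - O i := by
        have := congrFun h i; simp at this; linear_combination this
      have h1 : sh O (MvPolynomial.X i) = Polynomial.C (MvPolynomial.X i) +
        Polynomial.C (MvPolynomial.C (O i)) * Polynomial.X := by simp [sh]
      have h2 : sh O' (MvPolynomial.X i) = Polynomial.C (MvPolynomial.X i) +
        Polynomial.C (MvPolynomial.C (O' i)) * Polynomial.X := by simp [sh]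
      simp [tau, h1, h2, sh_C, hi]
      ring
  · simp [tau]

def tauEquiv (O : Fin 3 → ℂ) : Polynomial (MvPolynomial (Fin 3) ℂ) ≃+*
    Polynomial (MvPolynomial (Fin 3) ℂ) :=
  RingEquiv.ofRingHom (tau O) (tau (-O)) (tau_tau _ _ (by simp)) (tau_tau _ _ (by simp))

theorem sh_eval (O b : Fin 3 → ℂ) (y : ℂ) (F : MvPolynomial (Fin 3) ℂ) :
    ((sh O F).map (MvPolynomial.eval b)).eval y = MvPolynomial.eval (b + y • O) F := by
  have : ((Polynomial.evalRingHom y).comp (Polynomial.mapRingHom (MvPolynomial.eval b))).comp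
      (sh O).toRingHom = MvPolynomial.eval (b + y • O) := by
    apply MvPolynomial.ringHom_ext
    · intro r
      simp [sh_C]
    · intro i; simp [sh]; ring
  exact congrArg (fun f => f F) this

theorem coprime_line {F : MvPolynomial (Fin 3) ℂ} (hF : F.IsHomogeneous 4) (hirr : Irreducible F)
    (O : Fin 3 → ℂ) (hO : MvPolynomial.eval O F ≠ 0) (H : MvPolynomial (Fin 3) ℂ) (hH : ¬ F ∣ H) :
    ∃ b, ∀ y : ℂ, ¬ (MvPolynomial.eval (b + y • O) F = 0 ∧ MvPolynomial.eval (b + y • O) H = 0) := by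
  classical
  have hFp : Prime (sh O F) := by
    have h1 : Prime (Polynomial.C F) := Polynomial.prime_C_iff.2 hirr.prime
    have h2 := (MulEquiv.prime_iff (tauEquiv O).toMulEquiv).2 h1
    rw [← tau_C]
    exact h2
  have hndvd : ¬ sh O F ∣ sh O H := by
    rintro h
    rw [← tau_C, ← tau_C] at h
    have h1 := map_dvd (tau (-O)) h
    have h2 := fun P => congrArg (fun f => f P) (tau_tau O (-O) (by simp))
    simp only [RingHom.comp_apply, RingHom.id_apply] at h2
    rw [h2, h2, Polynomial.C_dvd_iff_dvd_coeff] at h1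
    have := h1 0
    rw [Polynomial.coeff_C_zero] at this
    exact hH this
  have hnd : (sh O F).natDegree ≠ 0 := by
    intro h0
    rw [Polynomial.natDegree_eq_zero] at h0
    obtain ⟨f, hf⟩ := h0
    have h1 := sh_eval O 0 0 F
    have h2 := sh_eval O 0 1 F
    rw [← hf, Polynomial.map_C, Polynomial.eval_C] at h1 h2
    rw [h1] at h2
    have h3 := eval_hom hF 0 O
    simp only [zero_smul, one_smul, zero_add] at h2 h3
    rw [h2] at h3
    apply hO; rw [h3]; simp
  let _ : NormalizedGCDMonoid (MvPolynomial (Fin 3) ℂ) :=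
    Classical.choice inferInstance
  have hprim : (sh O F).IsPrimitive := hFp.irreducible.isPrimitive hnd
  let K := FractionRing (MvPolynomial (Fin 3) ℂ)
  have hirrK := (hprim.irreducible_iff_irreducible_map_fraction_map (K := K)).1 hFp.irreducible
  have hcop : IsCoprime ((sh O F).map (algebraMap _ K)) ((sh O H).map (algebraMap _ K)) := by
    rcases hirrK.isCoprime_or_dvd ((sh O H).map (algebraMap _ K)) with h | h
    · exact h
    · exact absurd (hprim.dvd_of_fraction_map_dvd_fraction_map h) hndvd
  have hres := Polynomial.resultant_ne_zero _ _ hcop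
  rw [Polynomial.natDegree_map_eq_of_injective (FaithfulSMul.algebraMap_injective _ K),
    Polynomial.natDegree_map_eq_of_injective (FaithfulSMul.algebraMap_injective _ K),
    Polynomial.resultant_map_map] at hres
  have hres' : Polynomial.resultant (sh O F) (sh O H) ≠ 0 := by
    intro h; rw [h, map_zero] at hres; exact hres rfl
  obtain ⟨P, Q, -, -, hPQ⟩ := Polynomial.exists_mul_add_mul_eq_C_resultant (sh O F) (sh O H)
    le_rfl le_rfl (Or.inl hnd)
  obtain ⟨b, hb⟩ : ∃ b, MvPolynomial.eval b (Polynomial.resultant (sh O F) (sh O H)) ≠ 0 := by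
    by_contra hcon
    push Not at hcon
    exact hres' (MvPolynomial.funext (by simpa using hcon))
  refine ⟨b, fun y hy => hb ?_⟩
  have := congrArg (fun P => (P.map (MvPolynomial.eval b)).eval y) hPQ
  simp only [Polynomial.map_add, Polynomial.map_mul, Polynomial.eval_add, Polynomial.eval_mul,
    sh_eval, hy.1, hy.2, Polynomial.map_C, Polynomial.eval_C] at this
  rw [← this]; simp

end

section

/-! ### Part C1: coordinates -/

/-- linear substitution `z p + x v + y u`. -/
def Ls (p v u : Fin 3 → ℂ) : MvPolynomial (Fin 3) ℂ →ₐ[ℂ] MvPolynomial (Fin 3) ℂ :=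
  MvPolynomial.aeval fun i => MvPolynomial.C (p i) * MvPolynomial.X 0 +
    MvPolynomial.C (v i) * MvPolynomial.X 1 + MvPolynomial.C (u i) * MvPolynomial.X 2

theorem eval_Ls (p v u : Fin 3 → ℂ) (F : MvPolynomial (Fin 3) ℂ) (z x y : ℂ) :
    MvPolynomial.eval ![z, x, y] (Ls p v u F) = MvPolynomial.eval (z • p + x • v + y • u) F := by
  have : (MvPolynomial.eval ![z, x, y]).comp (Ls p v u).toRingHom =
      MvPolynomial.eval (z • p + x • v + y • u) := by
    apply MvPolynomial.ringHom_ext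
    · intro r; simp
    · intro i; simp [Ls]; ring
  exact congrArg (fun f => f F) this

theorem Ls_hom {F : MvPolynomial (Fin 3) ℂ} {n : ℕ} (h : F.IsHomogeneous n) (p v u : Fin 3 → ℂ) :
    (Ls p v u F).IsHomogeneous n := by
  have := h.aeval (fun i => MvPolynomial.C (p i) * MvPolynomial.X 0 +
    MvPolynomial.C (v i) * MvPolynomial.X 1 + MvPolynomial.C (u i) * MvPolynomial.X 2 :
      Fin 3 → MvPolynomial (Fin 3) ℂ) (n := 1) ?_
  · simpa [Ls] using this
  · intro i
    have h1 : ∀ (a : ℂ) (j : Fin 3), (MvPolynomial.C a * MvPolynomial.X j :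
        MvPolynomial (Fin 3) ℂ).IsHomogeneous 1 := fun a j => by
      simpa using (MvPolynomial.isHomogeneous_C (Fin 3) a).mul (MvPolynomial.isHomogeneous_X ℂ j)
    exact ((h1 _ _).add (h1 _ _)).add (h1 _ _)

/-- directional derivative -/
def Dv (w : Fin 3 → ℂ) (F : MvPolynomial (Fin 3) ℂ) : MvPolynomial (Fin 3) ℂ :=
  ∑ i, MvPolynomial.C (w i) * MvPolynomial.pderiv i F

theorem eval_Dv (w P : Fin 3 → ℂ) (F : MvPolynomial (Fin 3) ℂ) :
    MvPolynomial.eval P (Dv w F) = dotv (gradVec F P) w := by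
  simp [Dv, dotv, gradVec, mul_comm]

theorem Dv_add (w : Fin 3 → ℂ) (F G : MvPolynomial (Fin 3) ℂ) : Dv w (F + G) = Dv w F + Dv w G := by
  simp [Dv, mul_add, Finset.sum_add_distrib]

theorem Dv_mul (w : Fin 3 → ℂ) (F G : MvPolynomial (Fin 3) ℂ) :
    Dv w (F * G) = Dv w F * G + F * Dv w G := by
  simp only [Dv, MvPolynomial.pderiv_mul, Finset.sum_mul, Finset.mul_sum, ← Finset.sum_add_distrib]
  refine Finset.sum_congr rfl fun i _ => ?_
  ring

theorem Dv_C (w : Fin 3 → ℂ) (r : ℂ) : Dv w (MvPolynomial.C r) = 0 := by simp [Dv]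

theorem Dv_X (w : Fin 3 → ℂ) (i : Fin 3) : Dv w (MvPolynomial.X i) = MvPolynomial.C (w i) := by
  classical
  simp [Dv, MvPolynomial.pderiv_X, Pi.single_apply]

theorem Ls_C (p v u : Fin 3 → ℂ) (r : ℂ) : Ls p v u (MvPolynomial.C r) = MvPolynomial.C r := by
  have := (Ls p v u).commutes r
  rwa [MvPolynomial.algebraMap_eq] at this

theorem pderiv_Ls (p v u : Fin 3 → ℂ) (j : Fin 3) (F : MvPolynomial (Fin 3) ℂ) :
    MvPolynomial.pderiv j (Ls p v u F) = Ls p v u (Dv (![p, v, u] j) F) := by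
  induction F using MvPolynomial.induction_on with
  | C r => rw [Ls_C, Dv_C, map_zero, MvPolynomial.pderiv_C]
  | add F G hF hG => rw [map_add, map_add, hF, hG, Dv_add, map_add]
  | mul_X F i hF =>
    rw [map_mul, MvPolynomial.pderiv_mul, hF, Dv_mul, map_add, map_mul, map_mul, Dv_X, Ls_C]
    congr 2
    fin_cases j <;> simp [Ls, MvPolynomial.pderiv_X, Pi.single_apply]

/-- explicit ternary quartic -/
def quart (c : ℕ → ℕ → ℂ) (z x y : ℂ) : ℂ :=
  c 0 0 * z ^ 4 + c 1 0 * z ^ 3 * x + c 0 1 * z ^ 3 * y +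
  c 2 0 * z ^ 2 * x ^ 2 + c 1 1 * z ^ 2 * x * y + c 0 2 * z ^ 2 * y ^ 2 +
  c 3 0 * z * x ^ 3 + c 2 1 * z * x ^ 2 * y + c 1 2 * z * x * y ^ 2 + c 0 3 * z * y ^ 3 +
  c 4 0 * x ^ 4 + c 3 1 * x ^ 3 * y + c 2 2 * x ^ 2 * y ^ 2 + c 1 3 * x * y ^ 3 + c 0 4 * y ^ 4

def Tm (a : ℂ) (i j k : ℕ) : MvPolynomial (Fin 3) ℂ :=
  MvPolynomial.C a * (MvPolynomial.X 0 ^ i * MvPolynomial.X 1 ^ j * MvPolynomial.X 2 ^ k)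

theorem eval_Tm (a z x y : ℂ) (i j k : ℕ) :
    MvPolynomial.eval ![z, x, y] (Tm a i j k) = a * (z ^ i * x ^ j * y ^ k) := by
  simp [Tm]

theorem Tm_add (a b : ℂ) (i j k : ℕ) : Tm (a + b) i j k = Tm a i j k + Tm b i j k := by
  simp only [Tm, map_add]; ring

theorem Tm_zero (i j k : ℕ) : Tm 0 i j k = 0 := by simp [Tm]

theorem pd0_Tm (a : ℂ) (i j k : ℕ) :
    MvPolynomial.pderiv 0 (Tm a i j k) = Tm (a * i) (i - 1) j k := by
  simp only [Tm, MvPolynomial.pderiv_mul, MvPolynomial.pderiv_pow, MvPolynomial.pderiv_X_self,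
    MvPolynomial.pderiv_C, map_mul, map_natCast, MvPolynomial.pderiv_X_of_ne
      (show (1 : Fin 3) ≠ 0 by decide), MvPolynomial.pderiv_X_of_ne
      (show (2 : Fin 3) ≠ 0 by decide)]
  ring

theorem pd1_Tm (a : ℂ) (i j k : ℕ) :
    MvPolynomial.pderiv 1 (Tm a i j k) = Tm (a * j) i (j - 1) k := by
  simp only [Tm, MvPolynomial.pderiv_mul, MvPolynomial.pderiv_pow, MvPolynomial.pderiv_X_self,
    MvPolynomial.pderiv_C, map_mul, map_natCast, MvPolynomial.pderiv_X_of_ne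
      (show (0 : Fin 3) ≠ 1 by decide), MvPolynomial.pderiv_X_of_ne
      (show (2 : Fin 3) ≠ 1 by decide)]
  ring

theorem pd2_Tm (a : ℂ) (i j k : ℕ) :
    MvPolynomial.pderiv 2 (Tm a i j k) = Tm (a * k) i j (k - 1) := by
  simp only [Tm, MvPolynomial.pderiv_mul, MvPolynomial.pderiv_pow, MvPolynomial.pderiv_X_self,
    MvPolynomial.pderiv_C, map_mul, map_natCast, MvPolynomial.pderiv_X_of_ne
      (show (0 : Fin 3) ≠ 2 by decide), MvPolynomial.pderiv_X_of_ne
      (show (1 : Fin 3) ≠ 2 by decide)]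
  ring

def qpoly (c : ℕ → ℕ → ℂ) : MvPolynomial (Fin 3) ℂ :=
  Tm (c 0 0) 4 0 0 + Tm (c 1 0) 3 1 0 + Tm (c 0 1) 3 0 1 +
  Tm (c 2 0) 2 2 0 + Tm (c 1 1) 2 1 1 + Tm (c 0 2) 2 0 2 +
  Tm (c 3 0) 1 3 0 + Tm (c 2 1) 1 2 1 + Tm (c 1 2) 1 1 2 + Tm (c 0 3) 1 0 3 +
  Tm (c 4 0) 0 4 0 + Tm (c 3 1) 0 3 1 + Tm (c 2 2) 0 2 2 + Tm (c 1 3) 0 1 3 + Tm (c 0 4) 0 0 4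

theorem eval_qpoly (c : ℕ → ℕ → ℂ) (z x y : ℂ) :
    MvPolynomial.eval ![z, x, y] (qpoly c) = quart c z x y := by
  simp only [qpoly, quart, map_add, eval_Tm]; ring

theorem qpoly_add (c d : ℕ → ℕ → ℂ) : qpoly (c + d) = qpoly c + qpoly d := by
  simp only [qpoly, Pi.add_apply, Tm_add]; ring

theorem qpoly_of_monomial (d : Fin 3 →₀ ℕ) (hd : d.degree = 4) (r : ℂ) :
    ∃ c, qpoly c = MvPolynomial.monomial d r := by
  refine ⟨fun i j => if i = d 1 ∧ j = d 2 then r else 0, ?_⟩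
  rw [MvPolynomial.monomial_eq, Finsupp.prod_fintype _ _ (by simp), Fin.prod_univ_three]
  change _ = Tm r (d 0) (d 1) (d 2)
  have h3 : d 0 + d 1 + d 2 = 4 := by
    rw [← hd, Finsupp.degree_eq_sum, Fin.sum_univ_three]
  generalize d 0 = i at *
  generalize d 1 = j at *
  generalize d 2 = k at *
  have hj : j ≤ 4 := by omega
  have hk : k ≤ 4 := by omega
  obtain rfl : i = 4 - j - k := by omega
  unfold qpoly
  interval_cases j <;> interval_cases k <;>
    first
    | (exfalso; omega)
    | simp [Tm_zero]

theorem exists_qpoly {F : MvPolynomial (Fin 3) ℂ} (h : F.IsHomogeneous 4) : ∃ c, F = qpoly c := by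
  rw [F.as_sum]
  have key : ∀ S : Finset (Fin 3 →₀ ℕ), (∀ d ∈ S, d.degree = 4) →
      ∃ c, ∑ d ∈ S, MvPolynomial.monomial d (MvPolynomial.coeff d F) = qpoly c := by
    classical
    intro S
    induction S using Finset.induction_on with
    | empty => intro _; exact ⟨0, by simp [qpoly, Tm_zero]⟩
    | insert d S hd ih =>
      intro hS
      obtain ⟨c, hc⟩ := ih fun e he => hS e (Finset.mem_insert_of_mem he)
      obtain ⟨c', hc'⟩ := qpoly_of_monomial d (hS d (Finset.mem_insert_self _ _))
        (MvPolynomial.coeff d F)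
      exact ⟨c' + c, by rw [Finset.sum_insert hd, hc, qpoly_add, hc']⟩
  refine key _ fun d hd => ?_
  by_contra hne
  exact MvPolynomial.mem_support_iff.1 hd (h.coeff_eq_zero hne)

theorem exists_coords {F : MvPolynomial (Fin 3) ℂ} (h : F.IsHomogeneous 4) (p v u : Fin 3 → ℂ) :
    ∃ c, Ls p v u F = qpoly c := exists_qpoly (Ls_hom h p v u)

theorem eval_coords {F : MvPolynomial (Fin 3) ℂ} {p v u : Fin 3 → ℂ} {c : ℕ → ℕ → ℂ}
    (hc : Ls p v u F = qpoly c) (z x y : ℂ) :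
    MvPolynomial.eval (z • p + x • v + y • u) F = quart c z x y := by
  rw [← eval_Ls, hc, eval_qpoly]

theorem coords_of_eval {F : MvPolynomial (Fin 3) ℂ} {p v u : Fin 3 → ℂ} {c : ℕ → ℕ → ℂ}
    (h : ∀ z x y, MvPolynomial.eval (z • p + x • v + y • u) F = quart c z x y) :
    Ls p v u F = qpoly c := by
  apply MvPolynomial.funext
  intro w
  have hw : w = ![w 0, w 1, w 2] := by ext i; fin_cases i <;> rfl
  rw [hw, eval_Ls, eval_qpoly, h]

/-! partial derivatives -/

def qx (c : ℕ → ℕ → ℂ) (x y : ℂ) : ℂ :=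
  c 1 0 + 2 * c 2 0 * x + c 1 1 * y + 3 * c 3 0 * x ^ 2 + 2 * c 2 1 * x * y + c 1 2 * y ^ 2 +
  4 * c 4 0 * x ^ 3 + 3 * c 3 1 * x ^ 2 * y + 2 * c 2 2 * x * y ^ 2 + c 1 3 * y ^ 3

def qy (c : ℕ → ℕ → ℂ) (x y : ℂ) : ℂ :=
  c 0 1 + c 1 1 * x + 2 * c 0 2 * y + c 2 1 * x ^ 2 + 2 * c 1 2 * x * y + 3 * c 0 3 * y ^ 2 +
  c 3 1 * x ^ 3 + 2 * c 2 2 * x ^ 2 * y + 3 * c 1 3 * x * y ^ 2 + 4 * c 0 4 * y ^ 3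

def qxx (c : ℕ → ℕ → ℂ) (x y : ℂ) : ℂ :=
  2 * c 2 0 + 6 * c 3 0 * x + 2 * c 2 1 * y +
  12 * c 4 0 * x ^ 2 + 6 * c 3 1 * x * y + 2 * c 2 2 * y ^ 2

def qxy (c : ℕ → ℕ → ℂ) (x y : ℂ) : ℂ :=
  c 1 1 + 2 * c 2 1 * x + 2 * c 1 2 * y + 3 * c 3 1 * x ^ 2 + 4 * c 2 2 * x * y + 3 * c 1 3 * y ^ 2

def qyy (c : ℕ → ℕ → ℂ) (x y : ℂ) : ℂ :=
  2 * c 0 2 + 2 * c 1 2 * x + 6 * c 0 3 * y + 2 * c 2 2 * x ^ 2 + 6 * c 1 3 * x * y +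
  12 * c 0 4 * y ^ 2

def hB (c : ℕ → ℕ → ℂ) (x y : ℂ) : ℂ :=
  qx c x y ^ 2 * qyy c x y - 2 * qx c x y * qy c x y * qxy c x y + qy c x y ^ 2 * qxx c x y

theorem qpoly_derivs (c : ℕ → ℕ → ℂ) (x y : ℂ) :
    MvPolynomial.eval ![1, x, y] (MvPolynomial.pderiv 1 (qpoly c)) = qx c x y ∧
    MvPolynomial.eval ![1, x, y] (MvPolynomial.pderiv 2 (qpoly c)) = qy c x y ∧
    MvPolynomial.eval ![1, x, y] (MvPolynomial.pderiv 1 (MvPolynomial.pderiv 1 (qpoly c))) = qxx c x y ∧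
    MvPolynomial.eval ![1, x, y] (MvPolynomial.pderiv 1 (MvPolynomial.pderiv 2 (qpoly c))) = qxy c x y ∧
    MvPolynomial.eval ![1, x, y] (MvPolynomial.pderiv 2 (MvPolynomial.pderiv 1 (qpoly c))) = qxy c x y ∧
    MvPolynomial.eval ![1, x, y] (MvPolynomial.pderiv 2 (MvPolynomial.pderiv 2 (qpoly c))) = qyy c x y := by
  refine ⟨?_, ?_, ?_, ?_, ?_, ?_⟩ <;>
  · simp only [qpoly, map_add, pd1_Tm, pd2_Tm, eval_Tm, qx, qy, qxx, qxy, qyy]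
    norm_num
    try ring

theorem qpoly_derivs0 (c : ℕ → ℕ → ℂ) (x y : ℂ) :
    MvPolynomial.eval ![1, x, y] (MvPolynomial.pderiv 0 (MvPolynomial.pderiv 1 (qpoly c))) =
      3 * qx c x y - x * qxx c x y - y * qxy c x y ∧
    MvPolynomial.eval ![1, x, y] (MvPolynomial.pderiv 1 (MvPolynomial.pderiv 0 (qpoly c))) =
      3 * qx c x y - x * qxx c x y - y * qxy c x y ∧
    MvPolynomial.eval ![1, x, y] (MvPolynomial.pderiv 0 (MvPolynomial.pderiv 2 (qpoly c))) =
      3 * qy c x y - x * qxy c x y - y * qyy c x y ∧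
    MvPolynomial.eval ![1, x, y] (MvPolynomial.pderiv 2 (MvPolynomial.pderiv 0 (qpoly c))) =
      3 * qy c x y - x * qxy c x y - y * qyy c x y ∧
    MvPolynomial.eval ![1, x, y] (MvPolynomial.pderiv 0 (MvPolynomial.pderiv 0 (qpoly c))) =
      3 * (4 * quart c 1 x y - x * qx c x y - y * qy c x y) -
        x * (3 * qx c x y - x * qxx c x y - y * qxy c x y) -
        y * (3 * qy c x y - x * qxy c x y - y * qyy c x y) := by
  refine ⟨?_, ?_, ?_, ?_, ?_⟩ <;>
  · simp only [qpoly, map_add, pd0_Tm, pd1_Tm, pd2_Tm, eval_Tm, qx, qy, qxx, qxy, qyy, quart]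
    norm_num
    try ring

theorem hs_qpoly (c : ℕ → ℕ → ℂ) (x y : ℂ) :
    MvPolynomial.eval ![1, x, y] (hs (qpoly c)) =
      12 * quart c 1 x y * (qxx c x y * qyy c x y - qxy c x y ^ 2) - 9 * hB c x y := by
  obtain ⟨-, -, h3, h4, h5, h6⟩ := qpoly_derivs c x y
  obtain ⟨k1, k2, k3, k4, k5⟩ := qpoly_derivs0 c x y
  rw [eval_hs, Matrix.det_fin_three]
  simp only [hessMat, Matrix.of_apply, h3, h4, h5, h6, k1, k2, k3, k4, k5, hB]
  ring

theorem hessMat_Ls (p v u : Fin 3 → ℂ) (F : MvPolynomial (Fin 3) ℂ) (z x y : ℂ) :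
    hessMat (Ls p v u F) ![z, x, y] = Matrix.of ![p, v, u] *
      hessMat F (z • p + x • v + y • u) * (Matrix.of ![p, v, u]).transpose := by
  ext i j
  rw [hessMat, Matrix.of_apply, pderiv_Ls, pderiv_Ls, eval_Ls]
  generalize z • p + x • v + y • u = P
  simp only [Matrix.mul_apply, Matrix.transpose_apply, Matrix.of_apply, hessMat, Dv, map_sum,
    map_mul, MvPolynomial.pderiv_C_mul, MvPolynomial.eval_C]
  simp only [Finset.mul_sum, Finset.sum_mul]
  rw [Finset.sum_comm]
  refine Finset.sum_congr rfl fun a _ => Finset.sum_congr rfl fun b _ => ?_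
  ring

theorem hs_Ls (p v u : Fin 3 → ℂ) (F : MvPolynomial (Fin 3) ℂ) (z x y : ℂ) :
    MvPolynomial.eval ![z, x, y] (hs (Ls p v u F)) =
      (Matrix.of ![p, v, u]).det ^ 2 * MvPolynomial.eval (z • p + x • v + y • u) (hs F) := by
  rw [eval_hs, eval_hs, hessMat_Ls, Matrix.det_mul, Matrix.det_mul, Matrix.det_transpose]
  ring

/-- the Hessian along the curve. -/
theorem hs_coords {F : MvPolynomial (Fin 3) ℂ} {p v u : Fin 3 → ℂ} {c : ℕ → ℕ → ℂ}
    (hc : Ls p v u F = qpoly c) (x y : ℂ) (h0 : quart c 1 x y = 0) :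
    (Matrix.of ![p, v, u]).det ^ 2 * MvPolynomial.eval (p + x • v + y • u) (hs F) =
      - 9 * hB c x y := by
  have := hs_Ls p v u F 1 x y
  rw [hc, hs_qpoly, h0, one_smul] at this
  rw [← this]; ring

/-- the gradient at the base point -/
theorem grad_coords {F : MvPolynomial (Fin 3) ℂ} {p v u : Fin 3 → ℂ} {c : ℕ → ℕ → ℂ}
    (hc : Ls p v u F = qpoly c) (x y : ℂ) :
    dotv (gradVec F (p + x • v + y • u)) v = qx c x y ∧
    dotv (gradVec F (p + x • v + y • u)) u = qy c x y := by
  obtain ⟨h1, h2, -⟩ := qpoly_derivs c x y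
  rw [← hc, pderiv_Ls, eval_Ls, eval_Dv, one_smul] at h1 h2
  exact ⟨h1, h2⟩

theorem lin_indep_iff (p v u : Fin 3 → ℂ) :
    LinearIndependent ℂ ![p, v, u] ↔ (Matrix.of ![p, v, u]).det ≠ 0 := by
  rw [← isUnit_iff_ne_zero, ← Matrix.isUnit_iff_isUnit_det, ← Matrix.linearIndependent_rows_iff_isUnit]
  rfl

end

section

/-! ### Part C2: local asymptotics -/

theorem quad_conv {T : Type*} (U : Ultrafilter T) (A E D z : T → ℂ) (A0 E0 D0 : ℂ) (hA0 : A0 ≠ 0)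
    (hA : Tendsto A U (nhds A0)) (hE : Tendsto E U (nhds E0)) (hD : Tendsto D U (nhds D0))
    (h : ∀ᶠ τ in (U : Filter T), A τ * z τ ^ 2 + E τ * z τ + D τ = 0) :
    ∃ ζ, Tendsto z U (nhds ζ) ∧ A0 * ζ ^ 2 + E0 * ζ + D0 = 0 := by
  obtain ⟨ζ, hζ⟩ := root_converges U (fun τ => Polynomial.C (A τ) * Polynomial.X ^ 2 +
      Polynomial.C (E τ) * Polynomial.X + Polynomial.C (D τ))
    (Polynomial.C A0 * Polynomial.X ^ 2 + Polynomial.C E0 * Polynomial.X + Polynomial.C D0) 2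
    (by
      have hc := fun {f : T → ℂ} {f0 : ℂ} (h : Tendsto f U (nhds f0)) =>
        (continuous_polyC (R := ℂ)).continuousAt.tendsto.comp h
      exact (((hc hA).mul_const _).add ((hc hE).mul_const _)).add (hc hD))
    (Eventually.of_forall fun τ => by compute_degree)
    (by simpa using hA0) z (h.mono fun τ hτ => by simpa using hτ)
  refine ⟨ζ, hζ, ?_⟩
  have h1 := ((hA.mul (hζ.pow 2)).add (hE.mul hζ)).add hD
  exact tendsto_nhds_unique (h1.congr' (h.mono fun τ hτ => hτ)) tendsto_const_nhds

section
variable {T : Type*} (U : Ultrafilter T) (c : ℕ → ℕ → ℂ) (x y : T → ℂ)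

theorem tend2 {x z : T → ℂ} {x0 z0 : ℂ} (hx : Tendsto x U (nhds x0)) (hz : Tendsto z U (nhds z0))
    (f : ℂ × ℂ → ℂ) (hf : Continuous f) :
    Tendsto (fun τ => f (x τ, z τ)) U (nhds (f (x0, z0))) :=
  hf.continuousAt.tendsto.comp (hx.prodMk_nhds hz)

/-- smooth point: common part -/
theorem smooth_z (k : ℕ) (hx : Tendsto x U (nhds 0)) (hy : Tendsto y U (nhds 0))
    (hx0 : ∀ᶠ τ in (U : Filter T), x τ ≠ 0) (h01 : c 0 1 ≠ 0)
    (N : ℂ → ℂ) (hN : Continuous N)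
    (h0 : ∀ᶠ τ in (U : Filter T), quart c 1 (x τ) (y τ) = 0)
    (hq : ∀ x y, quart c 1 x y = x ^ k * N x + y * (c 0 1 + c 1 1 * x + c 0 2 * y + c 2 1 * x ^ 2 +
      c 1 2 * x * y + c 0 3 * y ^ 2 + c 3 1 * x ^ 3 + c 2 2 * x ^ 2 * y + c 1 3 * x * y ^ 2 +
      c 0 4 * y ^ 3)) :
    ∃ ζ, Tendsto (fun τ => y τ / x τ ^ k) U (nhds ζ) := by
  have hM : Tendsto (fun τ => c 0 1 + c 1 1 * x τ + c 0 2 * y τ + c 2 1 * x τ ^ 2 +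
      c 1 2 * x τ * y τ + c 0 3 * y τ ^ 2 + c 3 1 * x τ ^ 3 + c 2 2 * x τ ^ 2 * y τ +
      c 1 3 * x τ * y τ ^ 2 + c 0 4 * y τ ^ 3) U (nhds (c 0 1)) := by
    have := tend2 U hx hy (fun p => c 0 1 + c 1 1 * p.1 + c 0 2 * p.2 + c 2 1 * p.1 ^ 2 +
      c 1 2 * p.1 * p.2 + c 0 3 * p.2 ^ 2 + c 3 1 * p.1 ^ 3 + c 2 2 * p.1 ^ 2 * p.2 +
      c 1 3 * p.1 * p.2 ^ 2 + c 0 4 * p.2 ^ 3) (by fun_prop)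
    simpa using this
  have hNt : Tendsto (fun τ => N (x τ)) U (nhds (N 0)) := hN.continuousAt.tendsto.comp hx
  refine ⟨-(N 0) / c 0 1, (hNt.neg.div hM h01).congr' ?_⟩
  filter_upwards [hx0, h0, hM.eventually_ne h01] with τ h1 h2 h3
  rw [hq] at h2
  rw [Pi.div_apply, div_eq_div_iff h3 (pow_ne_zero _ h1)]
  linear_combination -h2

theorem hB_smooth2 (hx : Tendsto x U (nhds 0)) (hy : Tendsto y U (nhds 0))
    (h01 : c 0 1 ≠ 0) (h10 : c 1 0 = 0)
    (h2 : c 2 0 ≠ 0) :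
    ∃ κ, κ ≠ 0 ∧ Tendsto (fun τ => hB c (x τ) (y τ) / x τ ^ 0) U (nhds κ) := by
  refine ⟨hB c 0 0, ?_, ?_⟩
  · simp [hB, qx, qy, qxx, qyy, qxy, h10, h01, h2]
  · simp only [pow_zero, div_one]
    exact tend2 U hx hy (fun p => hB c p.1 p.2) (by unfold hB qx qy qxx qxy qyy; fun_prop)

theorem hB_smooth3 (hx : Tendsto x U (nhds 0)) (hy : Tendsto y U (nhds 0))
    (hx0 : ∀ᶠ τ in (U : Filter T), x τ ≠ 0)
    (h0 : ∀ᶠ τ in (U : Filter T), quart c 1 (x τ) (y τ) = 0)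
    (h00 : c 0 0 = 0) (h01 : c 0 1 ≠ 0) (h10 : c 1 0 = 0) (h20 : c 2 0 = 0)
    (h3 : c 3 0 ≠ 0) :
    ∃ κ, κ ≠ 0 ∧ Tendsto (fun τ => hB c (x τ) (y τ) / x τ ^ 1) U (nhds κ) := by
  obtain ⟨ζ, hζ⟩ := smooth_z U c x y 3 hx hy hx0 h01 (fun x => c 3 0 + c 4 0 * x) (by fun_prop) h0
    (by intro x y; simp only [quart, h00, h10, h20]; ring)
  let qx' : ℂ × ℂ → ℂ := fun p => c 1 1 * p.1 * p.2 + 3 * c 3 0 + 2 * c 2 1 * p.1 ^ 2 * p.2 +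
    c 1 2 * p.1 ^ 4 * p.2 ^ 2 + 4 * c 4 0 * p.1 + 3 * c 3 1 * p.1 ^ 3 * p.2 +
    2 * c 2 2 * p.1 ^ 5 * p.2 ^ 2 + c 1 3 * p.1 ^ 7 * p.2 ^ 3
  let qxx' : ℂ × ℂ → ℂ := fun p => 6 * c 3 0 + 2 * c 2 1 * p.1 ^ 2 * p.2 + 12 * c 4 0 * p.1 +
    6 * c 3 1 * p.1 ^ 3 * p.2 + 2 * c 2 2 * p.1 ^ 5 * p.2 ^ 2
  have key : ∀ x z, hB c x (x ^ 3 * z) = x * (x ^ 3 * qx' (x, z) ^ 2 * qyy c x (x ^ 3 * z) -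
      2 * x * qx' (x, z) * qy c x (x ^ 3 * z) * qxy c x (x ^ 3 * z) +
      qy c x (x ^ 3 * z) ^ 2 * qxx' (x, z)) := by
    intro x z
    have e1 : qx c x (x ^ 3 * z) = x ^ 2 * qx' (x, z) := by
      simp only [qx, qx', h10, h20]; ring
    have e2 : qxx c x (x ^ 3 * z) = x * qxx' (x, z) := by
      simp only [qxx, qxx', h20]; ring
    rw [hB, e1, e2]; ring
  have := tend2 U hx hζ (fun p => p.1 ^ 3 * qx' p ^ 2 * qyy c p.1 (p.1 ^ 3 * p.2) -
      2 * p.1 * qx' p * qy c p.1 (p.1 ^ 3 * p.2) * qxy c p.1 (p.1 ^ 3 * p.2) +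
      qy c p.1 (p.1 ^ 3 * p.2) ^ 2 * qxx' p) (by unfold qx' qxx' qy qxy qyy; fun_prop)
  refine ⟨_, ?_, this.congr' ?_⟩
  · simp [qxx', qy, h01, h3]
  · filter_upwards [hx0] with τ h1
    have hz : x τ ^ 3 * (y τ / x τ ^ 3) = y τ := by field_simp
    have := key (x τ) (y τ / x τ ^ 3)
    simp only [hz] at this ⊢
    rw [this, pow_one, mul_div_cancel_left₀ _ h1]

theorem hB_smooth4 (hx : Tendsto x U (nhds 0)) (hy : Tendsto y U (nhds 0))
    (hx0 : ∀ᶠ τ in (U : Filter T), x τ ≠ 0)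
    (h0 : ∀ᶠ τ in (U : Filter T), quart c 1 (x τ) (y τ) = 0)
    (h00 : c 0 0 = 0) (h01 : c 0 1 ≠ 0) (h10 : c 1 0 = 0) (h20 : c 2 0 = 0) (h30 : c 3 0 = 0)
    (h4 : c 4 0 ≠ 0) :
    ∃ κ, κ ≠ 0 ∧ Tendsto (fun τ => hB c (x τ) (y τ) / x τ ^ 2) U (nhds κ) := by
  obtain ⟨ζ, hζ⟩ := smooth_z U c x y 4 hx hy hx0 h01 (fun x => c 4 0) (by fun_prop) h0
    (by intro x y; simp only [quart, h00, h10, h20, h30]; ring)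
  let qx' : ℂ × ℂ → ℂ := fun p => c 1 1 * p.1 * p.2 + 2 * c 2 1 * p.1 ^ 2 * p.2 +
    c 1 2 * p.1 ^ 5 * p.2 ^ 2 + 4 * c 4 0 + 3 * c 3 1 * p.1 ^ 3 * p.2 +
    2 * c 2 2 * p.1 ^ 6 * p.2 ^ 2 + c 1 3 * p.1 ^ 9 * p.2 ^ 3
  let qxx' : ℂ × ℂ → ℂ := fun p => 2 * c 2 1 * p.1 ^ 2 * p.2 + 12 * c 4 0 +
    6 * c 3 1 * p.1 ^ 3 * p.2 + 2 * c 2 2 * p.1 ^ 6 * p.2 ^ 2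
  have key : ∀ x z, hB c x (x ^ 4 * z) = x ^ 2 * (x ^ 4 * qx' (x, z) ^ 2 * qyy c x (x ^ 4 * z) -
      2 * x * qx' (x, z) * qy c x (x ^ 4 * z) * qxy c x (x ^ 4 * z) +
      qy c x (x ^ 4 * z) ^ 2 * qxx' (x, z)) := by
    intro x z
    have e1 : qx c x (x ^ 4 * z) = x ^ 3 * qx' (x, z) := by
      simp only [qx, qx', h10, h20, h30]; ring
    have e2 : qxx c x (x ^ 4 * z) = x ^ 2 * qxx' (x, z) := by
      simp only [qxx, qxx', h20, h30]; ring
    rw [hB, e1, e2]; ring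
  have := tend2 U hx hζ (fun p => p.1 ^ 4 * qx' p ^ 2 * qyy c p.1 (p.1 ^ 4 * p.2) -
      2 * p.1 * qx' p * qy c p.1 (p.1 ^ 4 * p.2) * qxy c p.1 (p.1 ^ 4 * p.2) +
      qy c p.1 (p.1 ^ 4 * p.2) ^ 2 * qxx' p) (by unfold qx' qxx' qy qxy qyy; fun_prop)
  refine ⟨_, ?_, this.congr' ?_⟩
  · simp [qxx', qy, h01, h4]
  · filter_upwards [hx0] with τ h1
    have hz : x τ ^ 4 * (y τ / x τ ^ 4) = y τ := by field_simp
    have := key (x τ) (y τ / x τ ^ 4)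
    simp only [hz] at this ⊢
    rw [this, mul_div_cancel_left₀ _ (pow_ne_zero _ h1)]

theorem tend_A (hx : Tendsto x U (nhds 0)) (hy : Tendsto y U (nhds 0)) :
    Tendsto (fun τ => c 0 2 + c 1 2 * x τ + c 0 3 * y τ + c 2 2 * x τ ^ 2 + c 1 3 * x τ * y τ +
      c 0 4 * y τ ^ 2) U (nhds (c 0 2)) := by
  have := tend2 U hx hy (fun p => c 0 2 + c 1 2 * p.1 + c 0 3 * p.2 + c 2 2 * p.1 ^ 2 +
    c 1 3 * p.1 * p.2 + c 0 4 * p.2 ^ 2) (by fun_prop)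
  simpa using this

theorem hB_cusp (hx : Tendsto x U (nhds 0)) (hy : Tendsto y U (nhds 0))
    (hx0 : ∀ᶠ τ in (U : Filter T), x τ ≠ 0)
    (h0 : ∀ᶠ τ in (U : Filter T), quart c 1 (x τ) (y τ) = 0)
    (h00 : c 0 0 = 0) (h01 : c 0 1 = 0) (h10 : c 1 0 = 0) (h20 : c 2 0 = 0) (h11 : c 1 1 = 0)
    (h02 : c 0 2 ≠ 0) (h3 : c 3 0 ≠ 0) :
    ∃ κ, κ ≠ 0 ∧ Tendsto (fun τ => hB c (x τ) (y τ) / x τ ^ 4) U (nhds κ) := by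
  have hsq : ∀ τ, ∃ s : ℂ, s ^ 2 = x τ := fun τ => IsAlgClosed.exists_pow_nat_eq (x τ) (by norm_num)
  choose s hs using hsq
  have hs0 : Tendsto s U (nhds 0) := by
    have h1 : Tendsto (fun τ => ‖x τ‖) U (nhds 0) := by simpa using hx.norm
    have h2 : Tendsto (fun τ => Real.sqrt ‖x τ‖) U (nhds 0) := by
      simpa [Function.comp_def] using (Real.continuous_sqrt.tendsto 0).comp h1
    rw [tendsto_zero_iff_norm_tendsto_zero]
    refine h2.congr fun τ => ?_
    rw [← hs τ, norm_pow, Real.sqrt_sq (norm_nonneg _)]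
  have hE : Tendsto (fun τ => s τ * (c 2 1 + c 3 1 * x τ)) U (nhds 0) := by
    have := tend2 U hs0 hx (fun p => p.1 * (c 2 1 + c 3 1 * p.2)) (by fun_prop)
    simpa using this
  have hD : Tendsto (fun τ => c 3 0 + c 4 0 * x τ) U (nhds (c 3 0)) := by
    have := (hx.const_mul (c 4 0)).const_add (c 3 0)
    simpa using this
  obtain ⟨ζ, hζ, hζe⟩ := quad_conv U _ _ _ (fun τ => y τ / s τ ^ 3) _ _ _ h02 (tend_A U c x y hx hy)
    hE hD (by
      filter_upwards [h0, hx0] with τ h1 h2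
      have hsn : s τ ≠ 0 := by
        intro h; apply h2; rw [← hs τ, h]; simp
      have hz : y τ = s τ ^ 3 * (y τ / s τ ^ 3) := by field_simp
      generalize y τ / s τ ^ 3 = z at hz
      rw [← hs τ, hz] at h1 ⊢
      simp only [quart, h00, h10, h01, h20, h11] at h1
      have h6 : s τ ^ 6 ≠ 0 := pow_ne_zero _ hsn
      apply mul_left_cancel₀ h6
      linear_combination h1)
  let a : ℂ × ℂ → ℂ := fun p => 3 * c 3 0 + 2 * c 2 1 * p.1 * p.2 + c 1 2 * p.1 ^ 2 * p.2 ^ 2 +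
    4 * c 4 0 * p.1 ^ 2 + 3 * c 3 1 * p.1 ^ 3 * p.2 + 2 * c 2 2 * p.1 ^ 4 * p.2 ^ 2 +
    c 1 3 * p.1 ^ 5 * p.2 ^ 3
  let b : ℂ × ℂ → ℂ := fun p => 2 * c 0 2 * p.2 + c 2 1 * p.1 + 2 * c 1 2 * p.1 ^ 2 * p.2 +
    3 * c 0 3 * p.1 ^ 3 * p.2 ^ 2 + c 3 1 * p.1 ^ 3 + 2 * c 2 2 * p.1 ^ 4 * p.2 +
    3 * c 1 3 * p.1 ^ 5 * p.2 ^ 2 + 4 * c 0 4 * p.1 ^ 6 * p.2 ^ 3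
  let d : ℂ × ℂ → ℂ := fun p => 6 * c 3 0 + 2 * c 2 1 * p.1 * p.2 + 12 * c 4 0 * p.1 ^ 2 +
    6 * c 3 1 * p.1 ^ 3 * p.2 + 2 * c 2 2 * p.1 ^ 4 * p.2 ^ 2
  let e : ℂ × ℂ → ℂ := fun p => 2 * c 2 1 + 2 * c 1 2 * p.1 * p.2 + 3 * c 3 1 * p.1 ^ 2 +
    4 * c 2 2 * p.1 ^ 3 * p.2 + 3 * c 1 3 * p.1 ^ 4 * p.2 ^ 2
  have key : ∀ s z, hB c (s ^ 2) (s ^ 3 * z) = s ^ 8 * (a (s, z) ^ 2 * qyy c (s ^ 2) (s ^ 3 * z) -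
      2 * s * a (s, z) * b (s, z) * e (s, z) + b (s, z) ^ 2 * d (s, z)) := by
    intro s z
    have e1 : qx c (s ^ 2) (s ^ 3 * z) = s ^ 4 * a (s, z) := by
      simp only [qx, a, h10, h20, h11]; ring
    have e2 : qy c (s ^ 2) (s ^ 3 * z) = s ^ 3 * b (s, z) := by
      simp only [qy, b, h01, h11]; ring
    have e3 : qxx c (s ^ 2) (s ^ 3 * z) = s ^ 2 * d (s, z) := by
      simp only [qxx, d, h20]; ring
    have e4 : qxy c (s ^ 2) (s ^ 3 * z) = s ^ 2 * e (s, z) := by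
      simp only [qxy, e, h11]; ring
    rw [hB, e1, e2, e3, e4]; ring
  have := tend2 U hs0 hζ (fun p => a p ^ 2 * qyy c (p.1 ^ 2) (p.1 ^ 3 * p.2) -
      2 * p.1 * a p * b p * e p + b p ^ 2 * d p) (by unfold a b d e qyy; fun_prop)
  refine ⟨_, ?_, this.congr' ?_⟩
  · have : a (0, ζ) ^ 2 * qyy c (((0 : ℂ), ζ).1 ^ 2) (((0 : ℂ), ζ).1 ^ 3 * ((0 : ℂ), ζ).2) -
        2 * ((0 : ℂ), ζ).1 * a (0, ζ) * b (0, ζ) * e (0, ζ) + b (0, ζ) ^ 2 * d (0, ζ) =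
        - 6 * c 3 0 ^ 2 * c 0 2 := by
      simp only [a, b, d, e, qyy]
      linear_combination 24 * c 0 2 * c 3 0 * hζe
    rw [this]
    exact mul_ne_zero (mul_ne_zero (by norm_num) (pow_ne_zero _ h3)) h02
  · filter_upwards [hx0] with τ h2
    have hsn : s τ ≠ 0 := by
      intro h; apply h2; rw [← hs τ, h]; simp
    have hz : s τ ^ 3 * (y τ / s τ ^ 3) = y τ := by field_simp
    have := key (s τ) (y τ / s τ ^ 3)
    simp only [hz] at this ⊢
    rw [← hs τ, this, ← pow_mul, mul_div_cancel_left₀ _ (pow_ne_zero _ hsn)]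

theorem hB_tac (hx : Tendsto x U (nhds 0)) (hy : Tendsto y U (nhds 0))
    (hx0 : ∀ᶠ τ in (U : Filter T), x τ ≠ 0)
    (h0 : ∀ᶠ τ in (U : Filter T), quart c 1 (x τ) (y τ) = 0)
    (h00 : c 0 0 = 0) (h01 : c 0 1 = 0) (h10 : c 1 0 = 0) (h20 : c 2 0 = 0) (h11 : c 1 1 = 0)
    (h30 : c 3 0 = 0) (h02 : c 0 2 ≠ 0) (h4 : c 4 0 ≠ 0)
    (hdisc : 4 * c 0 2 * c 4 0 - c 2 1 ^ 2 ≠ 0) :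
    ∃ κ, κ ≠ 0 ∧ Tendsto (fun τ => hB c (x τ) (y τ) / x τ ^ 6) U (nhds κ) := by
  have hE : Tendsto (fun τ => c 2 1 + c 3 1 * x τ) U (nhds (c 2 1)) := by
    have := (hx.const_mul (c 3 1)).const_add (c 2 1)
    simpa using this
  obtain ⟨ζ, hζ, hζe⟩ := quad_conv U _ _ _ (fun τ => y τ / x τ ^ 2) _ _ _ h02 (tend_A U c x y hx hy)
    hE (tendsto_const_nhds (x := c 4 0)) (by
      filter_upwards [h0, hx0] with τ h1 h2
      have hz : y τ = x τ ^ 2 * (y τ / x τ ^ 2) := by field_simp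
      generalize y τ / x τ ^ 2 = z at hz
      rw [hz] at h1 ⊢
      simp only [quart, h00, h10, h01, h20, h11, h30] at h1
      have h6 : x τ ^ 4 ≠ 0 := pow_ne_zero _ h2
      apply mul_left_cancel₀ h6
      linear_combination h1)
  let a : ℂ × ℂ → ℂ := fun p => 2 * c 2 1 * p.2 + c 1 2 * p.1 * p.2 ^ 2 +
    4 * c 4 0 + 3 * c 3 1 * p.1 * p.2 + 2 * c 2 2 * p.1 ^ 2 * p.2 ^ 2 +
    c 1 3 * p.1 ^ 3 * p.2 ^ 3
  let b : ℂ × ℂ → ℂ := fun p => 2 * c 0 2 * p.2 + c 2 1 + 2 * c 1 2 * p.1 * p.2 +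
    3 * c 0 3 * p.1 ^ 2 * p.2 ^ 2 + c 3 1 * p.1 + 2 * c 2 2 * p.1 ^ 2 * p.2 +
    3 * c 1 3 * p.1 ^ 3 * p.2 ^ 2 + 4 * c 0 4 * p.1 ^ 4 * p.2 ^ 3
  let d : ℂ × ℂ → ℂ := fun p => 2 * c 2 1 * p.2 + 12 * c 4 0 +
    6 * c 3 1 * p.1 * p.2 + 2 * c 2 2 * p.1 ^ 2 * p.2 ^ 2
  let e : ℂ × ℂ → ℂ := fun p => 2 * c 2 1 + 2 * c 1 2 * p.1 * p.2 + 3 * c 3 1 * p.1 +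
    4 * c 2 2 * p.1 ^ 2 * p.2 + 3 * c 1 3 * p.1 ^ 3 * p.2 ^ 2
  have key : ∀ x z, hB c x (x ^ 2 * z) = x ^ 6 * (a (x, z) ^ 2 * qyy c x (x ^ 2 * z) -
      2 * a (x, z) * b (x, z) * e (x, z) + b (x, z) ^ 2 * d (x, z)) := by
    intro x z
    have e1 : qx c x (x ^ 2 * z) = x ^ 3 * a (x, z) := by
      simp only [qx, a, h10, h20, h11, h30]; ring
    have e2 : qy c x (x ^ 2 * z) = x ^ 2 * b (x, z) := by
      simp only [qy, b, h01, h11]; ring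
    have e3 : qxx c x (x ^ 2 * z) = x ^ 2 * d (x, z) := by
      simp only [qxx, d, h20, h30]; ring
    have e4 : qxy c x (x ^ 2 * z) = x * e (x, z) := by
      simp only [qxy, e, h11]; ring
    rw [hB, e1, e2, e3, e4]; ring
  have := tend2 U hx hζ (fun p => a p ^ 2 * qyy c p.1 (p.1 ^ 2 * p.2) -
      2 * a p * b p * e p + b p ^ 2 * d p) (by unfold a b d e qyy; fun_prop)
  refine ⟨_, ?_, this.congr' ?_⟩
  · have : a (0, ζ) ^ 2 * qyy c ((0 : ℂ), ζ).1 (((0 : ℂ), ζ).1 ^ 2 * ((0 : ℂ), ζ).2) -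
        2 * a (0, ζ) * b (0, ζ) * e (0, ζ) + b (0, ζ) ^ 2 * d (0, ζ) =
        - 2 * ζ * (c 2 1 + 2 * c 0 2 * ζ) ^ 3 := by
      simp only [a, b, d, e, qyy]
      have h4' : c 4 0 = - c 0 2 * ζ ^ 2 - c 2 1 * ζ := by linear_combination hζe
      rw [h4']; ring
    rw [this]
    refine mul_ne_zero (mul_ne_zero (by norm_num) ?_) (pow_ne_zero _ ?_)
    · rintro rfl; apply h4; linear_combination hζe
    · intro hK; apply hdisc
      linear_combination 4 * c 0 2 * hζe - (c 2 1 + 2 * c 0 2 * ζ) * hK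
  · filter_upwards [hx0] with τ h2
    have hz : x τ ^ 2 * (y τ / x τ ^ 2) = y τ := by field_simp
    have := key (x τ) (y τ / x τ ^ 2)
    simp only [hz] at this ⊢
    rw [this, mul_div_cancel_left₀ _ (pow_ne_zero _ h2)]

end

end

section

/-! ### Part C3: the multiplicity of the resultant -/

def LocExp (G : MvPolynomial (Fin 3) ℂ) (q b O : Fin 3 → ℂ) (k : ℕ) : Prop :=
  ∀ U : Ultrafilter ℂ, (U : Filter ℂ) ≤ nhdsWithin 0 {0}ᶜ → ∀ y : ℂ → ℂ, Tendsto y U (nhds 0) →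
    (∀ᶠ h in (U : Filter ℂ), MvPolynomial.eval (q + h • b + y h • O) G = 0) →
    ∃ κ, κ ≠ 0 ∧ Tendsto (fun h => MvPolynomial.eval (q + h • b + y h • O) (hs G) / h ^ k) U (nhds κ)

theorem LocExp_of_hB {G : MvPolynomial (Fin 3) ℂ} {q b O : Fin 3 → ℂ} {k : ℕ} {c : ℕ → ℕ → ℂ}
    (hc : Ls q b O G = qpoly c) (hdet : (Matrix.of ![q, b, O]).det ≠ 0)
    (h : ∀ U : Ultrafilter ℂ, (U : Filter ℂ) ≤ nhdsWithin 0 {0}ᶜ → ∀ y : ℂ → ℂ, Tendsto y U (nhds 0) →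
      Tendsto (fun h : ℂ => h) U (nhds 0) → (∀ᶠ h : ℂ in (U : Filter ℂ), h ≠ 0) →
      (∀ᶠ h in (U : Filter ℂ), quart c 1 h (y h) = 0) →
      ∃ κ, κ ≠ 0 ∧ Tendsto (fun h => hB c h (y h) / h ^ k) U (nhds κ)) :
    LocExp G q b O k := by
  intro U hU y hy h0
  have h1 : Tendsto (fun h : ℂ => h) U (nhds 0) := le_trans hU nhdsWithin_le_nhds
  have h2 : ∀ᶠ h : ℂ in (U : Filter ℂ), h ≠ 0 := hU self_mem_nhdsWithin
  have h3 : ∀ᶠ h in (U : Filter ℂ), quart c 1 h (y h) = 0 := by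
    filter_upwards [h0] with h hh
    rw [← eval_coords hc, one_smul, hh]
  obtain ⟨κ, hκ, ht⟩ := h U hU y hy h1 h2 h3
  refine ⟨-9 / (Matrix.of ![q, b, O]).det ^ 2 * κ,
    mul_ne_zero (div_ne_zero (by norm_num) (pow_ne_zero _ hdet)) hκ, ?_⟩
  refine (ht.const_mul _).congr' ?_
  filter_upwards [h3] with h hh
  have := hs_coords hc h (y h) hh
  rw [mul_div_assoc', div_mul_eq_mul_div, ← this, mul_div_cancel_left₀ _ (pow_ne_zero _ hdet)]

theorem continuous_lineRestrict (G : MvPolynomial (Fin 3) ℂ) {T : Type*} [TopologicalSpace T]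
    {f g : T → Fin 3 → ℂ} (hf : Continuous f) (hg : Continuous g) :
    Continuous fun τ => lineRestrict G (f τ) (g τ) := by
  unfold lineRestrict
  apply continuous_mvaeval
  intro i
  exact (continuous_polyC.comp ((continuous_apply i).comp hf)).add
    ((continuous_polyC.comp ((continuous_apply i).comp hg)).mul continuous_const)

theorem continuous_eval (G : MvPolynomial (Fin 3) ℂ) :
    Continuous fun v : Fin 3 → ℂ => MvPolynomial.eval v G := MvPolynomial.continuous_eval G

theorem exists_ultra : ∃ U : Ultrafilter ℂ, (U : Filter ℂ) ≤ nhdsWithin 0 {0}ᶜ :=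
  Ultrafilter.exists_le _

theorem core_mult {G : MvPolynomial (Fin 3) ℂ} (h : G.IsHomogeneous 4) (O q b : Fin 3 → ℂ)
    (hO : MvPolynomial.eval O G ≠ 0) (k : ℕ) (hloc : LocExp G q b O k)
    (hoth : ∀ y : ℂ, y ≠ 0 → MvPolynomial.eval (q + y • O) G = 0 →
      MvPolynomial.eval (q + y • O) (hs G) ≠ 0) :
    (chow G O q b).rootMultiplicity 0 = (lineRestrict G q O).rootMultiplicity 0 * k := by
  classical
  obtain ⟨U, hU⟩ := exists_ultra
  have hU0 : Tendsto (fun h : ℂ => h) U (nhds 0) := le_trans hU nhdsWithin_le_nhds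
  have hne : ∀ᶠ h : ℂ in (U : Filter ℂ), h ≠ 0 := hU self_mem_nhdsWithin
  choose w hw using fun x : ℂ => exists_w h O (q + x • b) hO
  have hP : Tendsto (fun x : ℂ => lineRestrict G (q + x • b) O) U (nhds (lineRestrict G q O)) := by
    have := (continuous_lineRestrict G (f := fun x : ℂ => q + x • b) (g := fun _ => O)
      (by fun_prop) continuous_const).tendsto 0
    simp only [zero_smul, add_zero] at this
    exact this.comp hU0
  obtain ⟨h1, h2⟩ := lineRestrict_lead h q O hO
  obtain ⟨ω, hω, hω0⟩ := roots_converge U _ _ 4 hP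
    (by rw [← h1, Polynomial.coeff_natDegree, h2]; exact hO)
    (fun _ => MvPolynomial.eval O G) (MvPolynomial.eval O G) tendsto_const_nhds w
    (Eventually.of_forall hw)
  have hm : (lineRestrict G q O).rootMultiplicity 0 = (Finset.univ.filter fun i => ω i = 0).card := by
    rw [hω0, rootMult_form _ hO]
  have hroot : ∀ x i, MvPolynomial.eval (q + x • b + w x i • O) G = 0 := by
    intro x i
    rw [(lr_eq_iff _ _ _ _ _).1 (hw x), Finset.prod_eq_zero (Finset.mem_univ i) (sub_self _), mul_zero]
  have hroot0 : ∀ i, MvPolynomial.eval (q + ω i • O) G = 0 := by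
    intro i
    rw [(lr_eq_iff _ _ _ _ _).1 hω0, Finset.prod_eq_zero (Finset.mem_univ i) (sub_self _), mul_zero]
  have hfac : ∀ i, ∃ κ, κ ≠ 0 ∧ Tendsto (fun x : ℂ => MvPolynomial.eval (q + x • b + w x i • O) (hs G) /
      x ^ (if ω i = 0 then k else 0)) U (nhds κ) := by
    intro i
    by_cases hi : ω i = 0
    · simp only [hi, if_true]
      exact hloc U hU (fun x => w x i) (hi ▸ hω i) (Eventually.of_forall fun x => hroot x i)
    · simp only [hi, if_false, pow_zero, div_one]
      refine ⟨_, hoth (ω i) hi (hroot0 i), ?_⟩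
      have h3 : Tendsto (fun x : ℂ => q + x • b + w x i • O) U (nhds (q + (0 : ℂ) • b + ω i • O)) :=
        (tendsto_const_nhds.add (hU0.smul_const b)).add ((hω i).smul_const O)
      rw [zero_smul, add_zero] at h3
      exact ((continuous_eval (hs G)).tendsto _).comp h3
  choose κ hκ hκt using hfac
  refine rootMult_of_tendsto _ 0 (MvPolynomial.eval O G ^ 6 * ∏ i, κ i) _ U hU
    (mul_ne_zero (pow_ne_zero _ hO) (Finset.prod_ne_zero_iff.2 fun i _ => hκ i)) ?_
  have := (tendsto_finsetProd Finset.univ fun i _ => hκt i).const_mul (MvPolynomial.eval O G ^ 6)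
  refine this.congr fun x => ?_
  rw [zero_add, eval_chow, Rs_eq h O _ hO _ (hw x), Finset.prod_div_distrib, mul_div_assoc]
  congr 2
  rw [Finset.prod_pow_eq_pow_sum, hm, Finset.card_filter, Finset.sum_mul]
  congr 1
  refine Finset.sum_congr rfl fun i _ => ?_
  split_ifs <;> simp

theorem transfer {G : MvPolynomial (Fin 3) ℂ} (h : G.IsHomogeneous 4) (O a b q v : Fin 3 → ℂ)
    (hO : MvPolynomial.eval O G ≠ 0) (hb : Rs G O b ≠ 0) (s x1 y1 β l μ : ℂ) (hs0 : s ≠ 0)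
    (hβ : β ≠ 0) (hq : q = s • (a + x1 • b + y1 • O)) (hv : v = β • b + l • O + μ • q) :
    (chow G O q v).rootMultiplicity 0 = (chow G O a b).rootMultiplicity x1 := by
  obtain ⟨P, hPdef⟩ : ∃ P, P = chow G O a b := ⟨_, rfl⟩
  rw [← hPdef]
  have hP0 : P ≠ 0 := by
    intro h0
    have := (chow_degree h O a b hO hb).1
    rw [← hPdef, h0] at this; simp at this
  obtain ⟨N, hNdef⟩ : ∃ N, N = P.rootMultiplicity x1 := ⟨_, rfl⟩
  rw [← hNdef]
  have hsm : ∃ n : ℕ, ∀ a s, s ≠ 0 → Rs G O (s • a) = s ^ n * Rs G O a :=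
    ⟨24, fun a s hs => Rs_smul h O a hO s hs⟩
  obtain ⟨n, hsm⟩ := hsm
  obtain ⟨Q, hQ, hQ0⟩ := Polynomial.exists_eq_pow_rootMultiplicity_mul_and_not_dvd P hP0 x1
  have hQ1 : Q.eval x1 ≠ 0 := fun h0 => hQ0 (Polynomial.dvd_iff_isRoot.2 h0)
  have hN : ∀ x, P.eval x = (x - x1) ^ N * Q.eval x := by
    intro x
    conv_lhs => rw [hQ]
    simp [hNdef]
  obtain ⟨U, hU⟩ := exists_ultra
  have hU0 : Tendsto (fun h : ℂ => h) U (nhds 0) := le_trans hU nhdsWithin_le_nhds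
  have hne : ∀ᶠ h : ℂ in (U : Filter ℂ), h ≠ 0 := hU self_mem_nhdsWithin
  have hd : Tendsto (fun x : ℂ => s * (1 + μ * x)) U (nhds s) := by
    have := ((hU0.const_mul μ).const_add 1).const_mul s
    simpa using this
  have hξ : Tendsto (fun x : ℂ => x1 + x * β / (s * (1 + μ * x))) U (nhds x1) := by
    have := ((hU0.mul_const β).div hd hs0).const_add x1
    simpa using this
  have hQt : Tendsto (fun x : ℂ => Q.eval (x1 + x * β / (s * (1 + μ * x)))) U (nhds (Q.eval x1)) :=
    (Q.continuous.tendsto x1).comp hξ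
  have hβt : Tendsto (fun x : ℂ => β / (s * (1 + μ * x))) U (nhds (β / s)) :=
    tendsto_const_nhds.div hd hs0
  refine rootMult_of_tendsto _ 0 (s ^ n * ((β / s) ^ N * Q.eval x1)) _ U hU
    (mul_ne_zero (pow_ne_zero _ hs0) (mul_ne_zero (pow_ne_zero _ (div_ne_zero hβ hs0)) hQ1)) ?_
  refine ((hd.pow n).mul ((hβt.pow N).mul hQt)).congr' ?_
  filter_upwards [hne, hd.eventually_ne hs0] with x hx hx2
  have e1 : q + x • v = (s * (1 + μ * x)) • (a + (x1 + x * β / (s * (1 + μ * x))) • b) +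
      ((1 + μ * x) * s * y1 + x * l) • O := by
    rw [hv]
    have : q + x • (β • b + l • O + μ • q) = (1 + μ * x) • q + (x * β) • b + (x * l) • O := by
      module
    rw [this, hq]
    have h3 : (s * (1 + μ * x)) * (x1 + x * β / (s * (1 + μ * x))) = s * (1 + μ * x) * x1 + x * β := by
      rw [mul_add, mul_div_cancel₀ _ hx2]
    rw [smul_add (s * (1 + μ * x)), smul_smul (s * (1 + μ * x)), h3]
    module
  rw [zero_add, eval_chow, e1, Rs_shift h _ _ hO, hsm _ _ hx2, ← eval_chow, ← hPdef, hN]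
  have h4 : x1 + x * β / (s * (1 + μ * x)) - x1 = x * (β / (s * (1 + μ * x))) := by ring
  rw [h4, mul_pow, eq_div_iff (pow_ne_zero _ hx)]
  generalize Polynomial.eval _ Q = A
  generalize β / (s * (1 + μ * x)) = B
  generalize s * (1 + μ * x) = D
  ring

end

section

/-! ### Part C4: flex weights of smooth quartics -/

theorem flexWeight_const (F : MvPolynomial (Fin 3) ℂ) (q : Fin 3 → ℂ) (n : ℕ)
    (h : ∀ v, LinearIndependent ℂ ![q, v] → dotv (gradVec F q) v = 0 → padm (contactAt F q v) = n)
    (hex : n = 0 ∨ ∃ v, LinearIndependent ℂ ![q, v] ∧ dotv (gradVec F q) v = 0) :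
    flexWeightAt F q = n := by
  classical
  unfold flexWeightAt
  have h1 : ∀ v, (⨆ _ : LinearIndependent ℂ ![q, v] ∧ dotv (gradVec F q) v = 0,
      padm (contactAt F q v)) =
      if LinearIndependent ℂ ![q, v] ∧ dotv (gradVec F q) v = 0 then n else 0 := by
    intro v
    split_ifs with hv
    · rw [ciSup_pos hv, h v hv.1 hv.2]
    · have : IsEmpty (LinearIndependent ℂ ![q, v] ∧ dotv (gradVec F q) v = 0) := ⟨hv⟩
      rw [iSup_of_empty']; simp
  simp only [h1]
  apply le_antisymm
  · refine ciSup_le fun v => ?_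
    split_ifs <;> omega
  · rcases hex with rfl | ⟨v, hv⟩
    · exact Nat.zero_le _
    · refine le_ciSup_of_le ⟨n, ?_⟩ v ?_
      · rintro _ ⟨v, rfl⟩
        dsimp only
        split_ifs <;> omega
      · rw [if_pos hv]

theorem quart_mult (P : Polynomial ℂ) (a0 a1 a2 a3 a4 : ℂ)
    (h : ∀ s, P.eval s = a0 + a1 * s + a2 * s ^ 2 + a3 * s ^ 3 + a4 * s ^ 4) :
    (a0 ≠ 0 → P.rootMultiplicity 0 = 0) ∧ (a0 = 0 → a1 ≠ 0 → P.rootMultiplicity 0 = 1) ∧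
    (a0 = 0 → a1 = 0 → a2 ≠ 0 → P.rootMultiplicity 0 = 2) ∧
    (a0 = 0 → a1 = 0 → a2 = 0 → a3 ≠ 0 → P.rootMultiplicity 0 = 3) ∧
    (a0 = 0 → a1 = 0 → a2 = 0 → a3 = 0 → a4 ≠ 0 → P.rootMultiplicity 0 = 4) := by
  have key : ∀ (k : ℕ) (Q : ℂ → ℂ), Continuous Q → Q 0 ≠ 0 → (∀ s, P.eval s = s ^ k * Q s) →
      P.rootMultiplicity 0 = k := by
    intro k Q hQ hQ0 he
    refine rootMult_of_tendsto P 0 (Q 0) k (nhdsWithin 0 {0}ᶜ) le_rfl hQ0 ?_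
    have h1 : Tendsto Q (nhdsWithin 0 {0}ᶜ) (nhds (Q 0)) := (hQ.tendsto 0).mono_left nhdsWithin_le_nhds
    refine h1.congr' ?_
    filter_upwards [self_mem_nhdsWithin] with s hs
    rw [zero_add, he, mul_div_cancel_left₀ _ (pow_ne_zero _ hs)]
  refine ⟨fun h0 => ?_, fun h0 h1 => ?_, fun h0 h1 h2 => ?_, fun h0 h1 h2 h3 => ?_,
    fun h0 h1 h2 h3 h4 => ?_⟩
  · refine key 0 (fun s => a0 + a1 * s + a2 * s ^ 2 + a3 * s ^ 3 + a4 * s ^ 4) (by fun_prop)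
      (by simpa using h0) (fun s => by rw [h]; ring)
  · refine key 1 (fun s => a1 + a2 * s + a3 * s ^ 2 + a4 * s ^ 3) (by fun_prop)
      (by simpa using h1) (fun s => by rw [h, h0]; ring)
  · refine key 2 (fun s => a2 + a3 * s + a4 * s ^ 2) (by fun_prop)
      (by simpa using h2) (fun s => by rw [h, h0, h1]; ring)
  · refine key 3 (fun s => a3 + a4 * s) (by fun_prop)
      (by simpa using h3) (fun s => by rw [h, h0, h1, h2]; ring)
  · refine key 4 (fun s => a4) (by fun_prop)
      (by simpa using h4) (fun s => by rw [h, h0, h1, h2, h3]; ring)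

theorem contact_coords {F : MvPolynomial (Fin 3) ℂ} {p v u : Fin 3 → ℂ} {c : ℕ → ℕ → ℂ}
    (hc : Ls p v u F = qpoly c) (s : ℂ) :
    (lineRestrict F p v).eval s = c 0 0 + c 1 0 * s + c 2 0 * s ^ 2 + c 3 0 * s ^ 3 + c 4 0 * s ^ 4 := by
  rw [eval_lineRestrict]
  have := eval_coords hc 1 s 0
  rw [one_smul, zero_smul, add_zero] at this
  rw [this, quart]; ring

theorem contact_coords' {F : MvPolynomial (Fin 3) ℂ} {p v u : Fin 3 → ℂ} {c : ℕ → ℕ → ℂ}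
    (hc : Ls p v u F = qpoly c) (s : ℂ) :
    (lineRestrict F p u).eval s = c 0 0 + c 0 1 * s + c 0 2 * s ^ 2 + c 0 3 * s ^ 3 + c 0 4 * s ^ 4 := by
  rw [eval_lineRestrict]
  have := eval_coords hc 1 0 s
  rw [one_smul, zero_smul, add_zero] at this
  rw [this, quart]; ring

theorem dotv_add (w a b : Fin 3 → ℂ) : dotv w (a + b) = dotv w a + dotv w b := by
  simp [dotv, mul_add, Finset.sum_add_distrib]

theorem dotv_smul (w a : Fin 3 → ℂ) (s : ℂ) : dotv w (s • a) = s * dotv w a := by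
  simp only [dotv, Pi.smul_apply, smul_eq_mul, Finset.mul_sum]
  exact Finset.sum_congr rfl fun i _ => by ring

theorem euler {F : MvPolynomial (Fin 3) ℂ} {n : ℕ} (hF : F.IsHomogeneous n) (q : Fin 3 → ℂ) :
    dotv (gradVec F q) q = n * MvPolynomial.eval q F := by
  have := congrArg (MvPolynomial.eval q) hF.sum_X_mul_pderiv
  simp only [map_sum, map_mul, MvPolynomial.eval_X, map_nsmul, nsmul_eq_mul, map_natCast] at this
  rw [← this, dotv]
  exact Finset.sum_congr rfl fun i _ => by rw [gradVec, mul_comm]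

theorem exists_coeffs {q b O : Fin 3 → ℂ} (hdet : (Matrix.of ![q, b, O]).det ≠ 0) (v : Fin 3 → ℂ) :
    ∃ μ β l : ℂ, v = μ • q + β • b + l • O := by
  have hu : IsUnit (Matrix.of ![q, b, O]).det := isUnit_iff_ne_zero.2 hdet
  let w := Matrix.vecMul v (Matrix.of ![q, b, O])⁻¹
  refine ⟨w 0, w 1, w 2, ?_⟩
  have : Matrix.vecMul w (Matrix.of ![q, b, O]) = v := by
    rw [Matrix.vecMul_vecMul, Matrix.nonsing_inv_mul _ hu, Matrix.vecMul_one]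
  conv_lhs => rw [← this]
  ext i
  simp [Matrix.vecMul, dotProduct, Fin.sum_univ_three]

theorem det_of_grad {w q v O : Fin 3 → ℂ} (hq : dotv w q = 0) (hv : dotv w v = 0)
    (hO : dotv w O ≠ 0) (hli : LinearIndependent ℂ ![q, v]) : (Matrix.of ![q, v, O]).det ≠ 0 := by
  rw [← lin_indep_iff, LinearIndependent.pair_iff] at *
  rw [Fintype.linearIndependent_iff]
  intro g hg
  rw [Fin.sum_univ_three] at hg
  change g 0 • q + g 1 • v + g 2 • O = 0 at hg
  have h1 := congrArg (dotv w) hg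
  have h0 : dotv w 0 = 0 := by simp [dotv]
  rw [dotv_add, dotv_add, dotv_smul, dotv_smul, dotv_smul, hq, hv, h0] at h1
  have h2 : g 2 = 0 := by
    have : g 2 * dotv w O = 0 := by linear_combination h1
    exact (mul_eq_zero.1 this).resolve_right hO
  rw [h2, zero_smul, add_zero] at hg
  have h3 := hli _ _ hg
  intro i
  fin_cases i
  · exact h3.1
  · exact h3.2
  · exact h2

theorem li_of_det {q v O : Fin 3 → ℂ} (h : (Matrix.of ![q, v, O]).det ≠ 0) :
    LinearIndependent ℂ ![q, v] := by
  rw [← lin_indep_iff] at h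
  have := h.comp ![0, 1] (by decide)
  convert this using 1
  ext i j; fin_cases i <;> rfl

/-- a smooth quartic contains no line -/
theorem no_line {F : MvPolynomial (Fin 3) ℂ} (hF : IsSmoothCurve F 4) {q v O : Fin 3 → ℂ}
    {c : ℕ → ℕ → ℂ} (hc : Ls q v O F = qpoly c) (hdet : (Matrix.of ![q, v, O]).det ≠ 0)
    (h01 : c 0 1 ≠ 0) (h00 : c 0 0 = 0) (h10 : c 1 0 = 0) (h20 : c 2 0 = 0) (h30 : c 3 0 = 0)
    (h40 : c 4 0 = 0) : False := by
  obtain ⟨z, hz⟩ : ∃ z : ℂ, c 0 1 * z ^ 3 + c 1 1 * z ^ 2 + c 2 1 * z + c 3 1 = 0 := by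
    have := IsAlgClosed.exists_root (Polynomial.C (c 0 1) * Polynomial.X ^ 3 +
      Polynomial.C (c 1 1) * Polynomial.X ^ 2 + Polynomial.C (c 2 1) * Polynomial.X +
      Polynomial.C (c 3 1)) (by
        rw [Polynomial.degree_cubic h01]; decide)
    obtain ⟨z, hz⟩ := this
    exact ⟨z, by simpa [Polynomial.IsRoot] using hz⟩
  set P := z • q + (1 : ℂ) • v + (0 : ℂ) • O with hP
  have e : ∀ j, dotv (gradVec F P) (![q, v, O] j) =
      MvPolynomial.eval ![z, 1, 0] (MvPolynomial.pderiv j (qpoly c)) := by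
    intro j
    rw [← hc, pderiv_Ls, eval_Ls, eval_Dv]
  have e0 : dotv (gradVec F P) q = 0 := by
    refine (e 0).trans ?_
    simp only [qpoly, map_add, pd0_Tm, eval_Tm, h00, h10, h20, h30, h40]
    norm_num
  have e1 : dotv (gradVec F P) v = 0 := by
    refine (e 1).trans ?_
    simp only [qpoly, map_add, pd1_Tm, eval_Tm, h00, h10, h20, h30, h40]
    norm_num
  have e2 : dotv (gradVec F P) O = 0 := by
    refine (e 2).trans ?_
    simp only [qpoly, map_add, pd2_Tm, eval_Tm, h00, h10, h20, h30, h40]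
    norm_num
    linear_combination hz
  have hP0 : P ≠ 0 := by
    intro h0
    have h1 := (LinearIndependent.pair_iff.1 (li_of_det hdet)) z 1 (by
      rw [hP, zero_smul, add_zero] at h0; exact h0)
    exact one_ne_zero h1.2
  have hF0 : MvPolynomial.eval P F = 0 := by
    rw [hP, eval_coords hc, quart, h00, h10, h20, h30, h40]; ring
  obtain ⟨i, hi⟩ := hF.2.2 P hP0 hF0
  apply hi
  obtain ⟨m, β, l, hm⟩ := exists_coeffs hdet (Pi.single i 1)
  have : dotv (gradVec F P) (Pi.single i 1) = MvPolynomial.eval P (MvPolynomial.pderiv i F) := by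
    simp [dotv, gradVec, Pi.single_apply]
  rw [← this, hm, dotv_add, dotv_add, dotv_smul, dotv_smul, dotv_smul, e0, e1, e2]
  ring

theorem base_coords {F : MvPolynomial (Fin 3) ℂ} {q v O : Fin 3 → ℂ}
    {c : ℕ → ℕ → ℂ} (hc : Ls q v O F = qpoly c) :
    c 0 0 = MvPolynomial.eval q F ∧ c 1 0 = dotv (gradVec F q) v ∧ c 0 1 = dotv (gradVec F q) O := by
  have h1 := eval_coords hc 1 0 0
  have h2 := grad_coords hc 0 0
  simp only [one_smul, zero_smul, add_zero] at h1 h2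
  rw [h1, h2.1, h2.2]
  simp [quart, qx, qy]

theorem smooth_local {F : MvPolynomial (Fin 3) ℂ} (hF : IsSmoothCurve F 4) {q O v : Fin 3 → ℂ}
    (hq : MvPolynomial.eval q F = 0) (hO : dotv (gradVec F q) O ≠ 0)
    (hli : LinearIndependent ℂ ![q, v]) (hv : dotv (gradVec F q) v = 0) :
    (Matrix.of ![q, v, O]).det ≠ 0 ∧ ∃ k, contactAt F q v = k + 2 ∧ LocExp F q v O k ∧
      (MvPolynomial.eval q (hs F) ≠ 0 → k = 0) := by
  have hdet : (Matrix.of ![q, v, O]).det ≠ 0 :=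
    det_of_grad (by rw [euler hF.1, hq, mul_zero]) hv hO hli
  refine ⟨hdet, ?_⟩
  obtain ⟨c, hc⟩ := exists_coords hF.1 q v O
  obtain ⟨h00, h10, h01⟩ := base_coords hc
  rw [hq] at h00; rw [hv] at h10; rw [← h01] at hO
  obtain ⟨-, -, m2, m3, m4⟩ := quart_mult (lineRestrict F q v) _ _ _ _ _ (contact_coords hc)
  by_cases h20 : c 2 0 = 0
  · have hhs : MvPolynomial.eval q (hs F) = 0 := by
      have := hs_coords hc 0 0 (by simp [quart, h00])
      simp only [zero_smul, add_zero] at this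
      have h2 : hB c 0 0 = 0 := by simp [hB, qx, qxx, h10, h20]
      rw [h2, mul_zero] at this
      exact (mul_eq_zero.1 this).resolve_left (pow_ne_zero _ hdet)
    by_cases h30 : c 3 0 = 0
    · have h40 : c 4 0 ≠ 0 := fun h40 => no_line hF hc hdet hO h00 h10 h20 h30 h40
      refine ⟨2, m4 h00 h10 h20 h30 h40, LocExp_of_hB hc hdet ?_, fun h => absurd hhs h⟩
      intro U hU y hy hx hx0 h0
      exact hB_smooth4 U c (fun h => h) y hx hy hx0 h0 h00 hO h10 h20 h30 h40
    · refine ⟨1, m3 h00 h10 h20 h30, LocExp_of_hB hc hdet ?_, fun h => absurd hhs h⟩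
      intro U hU y hy hx hx0 h0
      exact hB_smooth3 U c (fun h => h) y hx hy hx0 h0 h00 hO h10 h20 h30
  · refine ⟨0, m2 h00 h10 h20, LocExp_of_hB hc hdet ?_, fun h => rfl⟩
    intro U hU y hy hx hx0 h0
    exact hB_smooth2 U c (fun h => h) y hx hy hO h10 h20

def Z (G : MvPolynomial (Fin 3) ℂ) (q : Fin 3 → ℂ) : Prop :=
  q ≠ 0 ∧ MvPolynomial.eval q G = 0 ∧ MvPolynomial.eval q (hs G) = 0

theorem flex_not_Z {F : MvPolynomial (Fin 3) ℂ} (hF : IsSmoothCurve F 4) {q : Fin 3 → ℂ}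
    (hq0 : q ≠ 0) (hq : ¬ Z F q) : flexWeightAt F q = 0 := by
  apply flexWeight_const _ _ _ _ (Or.inl rfl)
  intro v hli hv
  by_cases h0 : MvPolynomial.eval q F = 0
  · have hhs : MvPolynomial.eval q (hs F) ≠ 0 := fun h => hq ⟨hq0, h0, h⟩
    obtain ⟨i, hi⟩ := hF.2.2 q hq0 h0
    have : dotv (gradVec F q) (Pi.single i 1) = MvPolynomial.eval q (MvPolynomial.pderiv i F) := by
      simp [dotv, gradVec, Pi.single_apply]
    obtain ⟨-, k, hk, -, hk0⟩ := smooth_local hF h0 (O := Pi.single i 1) (by rwa [this]) hli hv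
    rw [hk, hk0 hhs, padm]
  · have : contactAt F q v = 0 := by
      unfold contactAt
      rw [Polynomial.rootMultiplicity_eq_zero]
      rw [Polynomial.IsRoot, eval_lineRestrict, zero_smul, add_zero]; exact h0
    rw [this, padm]

theorem flex_eq_mult {F : MvPolynomial (Fin 3) ℂ} (hF : IsSmoothCurve F 4) {O a b q : Fin 3 → ℂ}
    (hO : MvPolynomial.eval O F ≠ 0) (hb : Rs F O b ≠ 0) (hdet : (Matrix.of ![a, b, O]).det ≠ 0)
    (hq : MvPolynomial.eval q F = 0) (hgO : dotv (gradVec F q) O ≠ 0)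
    (s x1 y1 : ℂ) (hs0 : s ≠ 0) (hqe : q = s • (a + x1 • b + y1 • O))
    (hoth : ∀ y : ℂ, y ≠ 0 → MvPolynomial.eval (q + y • O) F = 0 →
      MvPolynomial.eval (q + y • O) (hs F) ≠ 0) :
    flexWeightAt F q = (chow F O a b).rootMultiplicity x1 := by
  have hdq : (Matrix.of ![q, b, O]).det ≠ 0 := by
    have : (Matrix.of ![q, b, O]).det = s * (Matrix.of ![a, b, O]).det := by
      rw [Matrix.det_fin_three, Matrix.det_fin_three, hqe]
      simp
      ring
    rw [this]; exact mul_ne_zero hs0 hdet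
  apply flexWeight_const
  · intro v hli hv
    obtain ⟨hd, k, hk, hloc, -⟩ := smooth_local hF hq hgO hli hv
    obtain ⟨μ, β, l, hve⟩ := exists_coeffs hdq v
    have hβ : β ≠ 0 := by
      rintro rfl
      apply hd
      rw [Matrix.det_fin_three, hve]
      simp
      ring
    rw [← transfer hF.1 O a b q v hO hb s x1 y1 β l μ hs0 hβ hqe (by rw [hve]; abel),
      core_mult hF.1 O q v hO k hloc hoth, hk]
    obtain ⟨c, hc⟩ := exists_coords hF.1 q v O
    obtain ⟨h00, h10, h01⟩ := base_coords hc
    obtain ⟨-, m1, -⟩ := quart_mult (lineRestrict F q O) _ _ _ _ _ (contact_coords' hc)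
    rw [m1 (h00.trans hq) (by rw [h01]; exact hgO)]
    simp [padm]
  · right
    refine ⟨b + (-(dotv (gradVec F q) b / dotv (gradVec F q) O)) • O, ?_, ?_⟩
    · apply li_of_det (O := O)
      have : (Matrix.of ![q, b + (-(dotv (gradVec F q) b / dotv (gradVec F q) O)) • O, O]).det =
          (Matrix.of ![q, b, O]).det := by
        generalize -(dotv (gradVec F q) b / dotv (gradVec F q) O) = e
        rw [Matrix.det_fin_three, Matrix.det_fin_three]
        simp
        ring
      rw [this]; exact hdq
    · rw [dotv_add, dotv_smul]; field_simp; ring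

end

section

def BF (F : MvPolynomial (Fin 3) ℂ) (p x y : Fin 3 → ℂ) : ℂ :=
  dotProduct x ((hessMat F p).mulVec y)

theorem hess_coords {F : MvPolynomial (Fin 3) ℂ} {p v O : Fin 3 → ℂ} {c : ℕ → ℕ → ℂ}
    (hc : Ls p v O F = qpoly c) :
    BF F p v v = 2 * c 2 0 ∧ BF F p O v = c 1 1 ∧ BF F p O O = 2 * c 0 2 := by
  obtain ⟨-, -, h3, h4, h5, h6⟩ := qpoly_derivs c 0 0
  have h := hessMat_Ls p v O F 1 0 0
  rw [hc, one_smul, zero_smul, zero_smul, add_zero, add_zero] at h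
  have e11 := congrFun (congrFun h 1) 1
  have e21 := congrFun (congrFun h 2) 1
  have e22 := congrFun (congrFun h 2) 2
  have hB1 : ∀ i j, (Matrix.of ![p, v, O] * hessMat F p * (Matrix.of ![p, v, O]).transpose) i j =
      BF F p (![p, v, O] i) (![p, v, O] j) := by
    intro i j
    simp only [BF, Matrix.mul_apply, Fin.sum_univ_three, Matrix.transpose_apply, Matrix.of_apply,
      dotProduct, Matrix.mulVec]
    ring
  rw [hB1, hessMat, Matrix.of_apply] at e11 e21 e22
  rw [h3] at e11
  rw [h5] at e21
  rw [h6] at e22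
  refine ⟨?_, ?_, ?_⟩
  · change qxx c 0 0 = BF F p v v at e11
    rw [← e11, qxx]; ring
  · change qxy c 0 0 = BF F p O v at e21
    rw [← e21, qxy]; ring
  · change qyy c 0 0 = BF F p O O at e22
    rw [← e22, qyy]; ring

theorem cubic_Dv (F : MvPolynomial (Fin 3) ℂ) (p v : Fin 3 → ℂ) :
    MvPolynomial.eval p (Dv v (Dv v (Dv v F))) = cubicForm F p v := by
  simp only [Dv, cubicForm, map_sum, MvPolynomial.pderiv_mul, MvPolynomial.pderiv_C, zero_mul, zero_add,
    map_mul, MvPolynomial.eval_C, Fin.sum_univ_three, map_add, MvPolynomial.pderiv_C]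
  ring

theorem cubic_coords {F : MvPolynomial (Fin 3) ℂ} {p v O : Fin 3 → ℂ} {c : ℕ → ℕ → ℂ}
    (hc : Ls p v O F = qpoly c) : cubicForm F p v = 6 * c 3 0 := by
  have h1 : MvPolynomial.pderiv 1 (MvPolynomial.pderiv 1 (MvPolynomial.pderiv 1 (Ls p v O F))) =
      Ls p v O (Dv v (Dv v (Dv v F))) := by
    rw [pderiv_Ls, pderiv_Ls, pderiv_Ls]; rfl
  have h2 := congrArg (MvPolynomial.eval ![1, 0, 0]) h1
  rw [eval_Ls, one_smul, zero_smul, zero_smul, add_zero, add_zero, cubic_Dv, hc] at h2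
  rw [← h2]
  simp only [qpoly, map_add, pd1_Tm, eval_Tm]
  norm_num
  ring

def SingLocal (F : MvPolynomial (Fin 3) ℂ) (p : Fin 3 → ℂ) (k : ℕ) : Prop :=
  ∀ O b : Fin 3 → ℂ, BF F p O O ≠ 0 → (Matrix.of ![p, b, O]).det ≠ 0 →
    ∃ β l μ : ℂ, ∃ v, β ≠ 0 ∧ v = β • b + l • O + μ • p ∧ LocExp F p v O k ∧
      (lineRestrict F p O).rootMultiplicity 0 = 2

theorem sing_coords {F : MvPolynomial (Fin 3) ℂ} {p v O : Fin 3 → ℂ} (hs : SingAt F p)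
    {c : ℕ → ℕ → ℂ} (hc : Ls p v O F = qpoly c) : c 0 0 = 0 ∧ c 1 0 = 0 ∧ c 0 1 = 0 := by
  obtain ⟨h1, h2, h3⟩ := base_coords hc
  have h0 : gradVec F p = 0 := by ext i; exact hs.2 i
  rw [h1, h2, h3, h0]
  exact ⟨hs.1, by simp [dotv], by simp [dotv]⟩

theorem mult2 {F : MvPolynomial (Fin 3) ℂ} {p v O : Fin 3 → ℂ} (hs : SingAt F p)
    {c : ℕ → ℕ → ℂ} (hc : Ls p v O F = qpoly c) (h : c 0 2 ≠ 0) :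
    (lineRestrict F p O).rootMultiplicity 0 = 2 := by
  obtain ⟨h1, h2, h3⟩ := sing_coords hs hc
  exact (quart_mult (lineRestrict F p O) _ _ _ _ _ (contact_coords' hc)).2.2.1 h1 h3 h

theorem cusp_local {F : MvPolynomial (Fin 3) ℂ} (hF : F.IsHomogeneous 4) {p : Fin 3 → ℂ}
    (h : IsCuspAt F p) : SingLocal F p 4 := by
  obtain ⟨hsing, hrank, hcub⟩ := h
  intro O b hO hdet
  let e : ℂ := -(BF F p O b / BF F p O O)
  let v := b + e • O
  have hOv : BF F p O v = 0 := by
    have : BF F p O v = BF F p O b + e * BF F p O O := by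
      simp only [BF, v, Matrix.mulVec_add, Matrix.mulVec_smul, dotProduct_add, dotProduct_smul, smul_eq_mul]
    rw [this]; simp only [e]; field_simp; ring
  have hAO : (hessMat F p).mulVec O ≠ 0 := by
    intro h0; apply hO; rw [BF, h0, dotProduct_zero]
  have hAv : (hessMat F p).mulVec v = 0 := by
    rw [Matrix.rank] at hrank
    have hx : (⟨(hessMat F p).mulVec O, ⟨O, rfl⟩⟩ : LinearMap.range (hessMat F p).mulVecLin) ≠ 0 := by
      intro h0; exact hAO (congrArg Subtype.val h0)
    obtain ⟨t, ht⟩ := (finrank_eq_one_iff_of_nonzero' _ hx).1 hrank ⟨(hessMat F p).mulVec v, ⟨v, rfl⟩⟩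
    have ht' : t • (hessMat F p).mulVec O = (hessMat F p).mulVec v := congrArg Subtype.val ht
    have : t * BF F p O O = 0 := by
      rw [← hOv, BF, BF, ← ht', dotProduct_smul, smul_eq_mul]
    rw [← ht', (mul_eq_zero.1 this).resolve_right hO, zero_smul]
  have hd : (Matrix.of ![p, v, O]).det ≠ 0 := by
    have : (Matrix.of ![p, v, O]).det = (Matrix.of ![p, b, O]).det := by
      simp only [v]
      generalize e = e
      rw [Matrix.det_fin_three, Matrix.det_fin_three]
      simp
      ring
    rwa [this]
  obtain ⟨c, hc⟩ := exists_coords hF p v O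
  obtain ⟨k1, k2, k3⟩ := hess_coords hc
  obtain ⟨h00, h10, h01⟩ := sing_coords hsing hc
  have h20 : c 2 0 = 0 := by
    rw [BF, hAv, dotProduct_zero] at k1
    simpa using k1.symm
  have h11 : c 1 1 = 0 := by rw [← k2, hOv]
  have h02 : c 0 2 ≠ 0 := by
    intro h; apply hO; rw [k3, h, mul_zero]
  have h30 : c 3 0 ≠ 0 := by
    intro h; apply hcub v hAv (li_of_det hd); rw [cubic_coords hc, h, mul_zero]
  refine ⟨1, e, 0, v, one_ne_zero, by simp [v], ?_, mult2 hsing hc h02⟩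
  apply LocExp_of_hB hc hd
  intro U hU y hy hx hx0 h0
  exact hB_cusp U c (fun h => h) y hx hy hx0 h0 h00 h01 h10 h20 h11 h02 h30

theorem pd_comm (i j : Fin 3) (F : MvPolynomial (Fin 3) ℂ) :
    MvPolynomial.pderiv i (MvPolynomial.pderiv j F) = MvPolynomial.pderiv j (MvPolynomial.pderiv i F) := by
  classical
  let D1 : Derivation ℂ (MvPolynomial (Fin 3) ℂ) (MvPolynomial (Fin 3) ℂ) := MvPolynomial.pderiv i
  let D2 : Derivation ℂ (MvPolynomial (Fin 3) ℂ) (MvPolynomial (Fin 3) ℂ) := MvPolynomial.pderiv j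
  have h0 : ⁅D1, D2⁆ = 0 := by
    apply MvPolynomial.derivation_ext
    intro k
    rw [Derivation.commutator_apply]
    simp only [D1, D2, MvPolynomial.pderiv_X, Pi.single_apply, Derivation.coe_zero, Pi.zero_apply]
    split_ifs <;> simp
  have h := congrArg (fun D : Derivation ℂ (MvPolynomial (Fin 3) ℂ) (MvPolynomial (Fin 3) ℂ) => D F) h0
  simp only [Derivation.commutator_apply, Derivation.coe_zero, Pi.zero_apply] at h
  exact sub_eq_zero.1 h

theorem hess_symm (F : MvPolynomial (Fin 3) ℂ) (p : Fin 3 → ℂ) (i j : Fin 3) :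
    hessMat F p i j = hessMat F p j i := by
  simp only [hessMat, Matrix.of_apply]
  rw [pd_comm]

theorem symm_zero (A : Matrix (Fin 3) (Fin 3) ℂ) (hA : ∀ i j, A i j = A j i)
    (hall : ∀ x, dotProduct x (A.mulVec x) = 0) : A = 0 := by
  ext i j
  have h1 := hall (Pi.single i 1 + Pi.single j 1)
  have h2 := hall (Pi.single i 1)
  have h3 := hall (Pi.single j 1)
  simp only [Matrix.mulVec_add, dotProduct_add, add_dotProduct, Matrix.mulVec_single_one,
      single_one_dotProduct, Matrix.col_apply] at h1 h2 h3
  have h4 := hA i j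
  rw [h2, h3, h4] at h1
  have h5 : 2 * A j i = 0 := by linear_combination h1
  rw [h4, Matrix.zero_apply]
  simpa using h5

theorem cusp_BF {F : MvPolynomial (Fin 3) ℂ} {p : Fin 3 → ℂ}
    (h : IsCuspAt F p) : ∃ O, BF F p O O ≠ 0 := by
  by_contra! hall
  have hA : hessMat F p = 0 := symm_zero _ (hess_symm F p) hall
  have h1 := h.2.1
  rw [hA, Matrix.rank_zero] at h1
  exact zero_ne_one h1

end

section

theorem planeSubst_Ls (F : MvPolynomial (Fin 3) ℂ) (p v u : Fin 3 → ℂ) :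
    planeSubst F p v u = MvPolynomial.aeval
      ![(1 : MvPolynomial (Fin 2) ℂ), MvPolynomial.X 0, MvPolynomial.X 1] (Ls p v u F) := by
  unfold planeSubst
  have : MvPolynomial.aeval (R := ℂ) (fun i => MvPolynomial.C (p i) + MvPolynomial.C (v i) * MvPolynomial.X 0 +
      MvPolynomial.C (u i) * MvPolynomial.X 1) = (MvPolynomial.aeval (R := ℂ)
      ![(1 : MvPolynomial (Fin 2) ℂ), MvPolynomial.X 0, MvPolynomial.X 1]).comp (Ls p v u) := by
    apply MvPolynomial.algHom_ext
    intro i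
    simp [Ls, MvPolynomial.algebraMap_eq]
  rw [this]; rfl

theorem sub_Tm (a : ℂ) (i j k : ℕ) : MvPolynomial.aeval
      ![(1 : MvPolynomial (Fin 2) ℂ), MvPolynomial.X 0, MvPolynomial.X 1] (Tm a i j k) =
    MvPolynomial.monomial (Finsupp.single 0 j + Finsupp.single 1 k) a := by
  rw [MvPolynomial.monomial_eq, Finsupp.prod_fintype _ _ (by simp)]
  simp [Tm, MvPolynomial.algebraMap_eq]

theorem coeffST_coords {F : MvPolynomial (Fin 3) ℂ} {p v u : Fin 3 → ℂ}
    {c : ℕ → ℕ → ℂ} (hc : Ls p v u F = qpoly c) (i j : ℕ) (hij : i + j ≤ 4) :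
    coeffST (planeSubst F p v u) i j = c i j := by
  have key : ∀ (a b i j : ℕ), (Finsupp.single (0 : Fin 2) a + Finsupp.single 1 b =
      Finsupp.single 0 i + Finsupp.single 1 j) ↔ (a = i ∧ b = j) := by
    intro a b i j
    constructor
    · intro h
      have h0 := DFunLike.congr_fun h 0
      have h1 := DFunLike.congr_fun h 1
      simp at h0 h1
      exact ⟨h0, h1⟩
    · rintro ⟨rfl, rfl⟩; rfl
  rw [planeSubst_Ls, hc, coeffST]
  simp only [qpoly, map_add, sub_Tm, MvPolynomial.coeff_add, MvPolynomial.coeff_monomial, key]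
  have hi : i ≤ 4 := by omega
  have hj : j ≤ 4 := by omega
  interval_cases i <;> interval_cases j <;> first | omega | simp

def tacc (c : ℕ → ℕ → ℂ) (α β γ : ℂ) : ℕ → ℕ → ℂ := fun i j => match i, j with
  | 0, 2 => c 0 2 * γ ^ 2
  | 0, 3 => 2 * c 0 2 * α * γ ^ 2 + c 2 1 * β ^ 2 * γ + c 1 2 * β * γ ^ 2 + c 0 3 * γ ^ 3
  | 0, 4 => c 0 2 * α ^ 2 * γ ^ 2 + c 2 1 * α * β ^ 2 * γ + c 1 2 * α * β * γ ^ 2 + c 0 3 * α * γ ^ 3 + c 4 0 * β ^ 4 + c 3 1 * β ^ 3 * γ + c 2 2 * β ^ 2 * γ ^ 2 + c 1 3 * β * γ ^ 3 + c 0 4 * γ ^ 4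
  | 1, 2 => 2 * c 2 1 * β * γ + c 1 2 * γ ^ 2
  | 1, 3 => 2 * c 2 1 * α * β * γ + c 1 2 * α * γ ^ 2 + 4 * c 4 0 * β ^ 3 + 3 * c 3 1 * β ^ 2 * γ + 2 * c 2 2 * β * γ ^ 2 + c 1 3 * γ ^ 3
  | 2, 1 => c 2 1 * γ
  | 2, 2 => c 2 1 * α * γ + 6 * c 4 0 * β ^ 2 + 3 * c 3 1 * β * γ + c 2 2 * γ ^ 2
  | 3, 1 => 4 * c 4 0 * β + c 3 1 * γ
  | 4, 0 => c 4 0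
  | _, _ => 0

theorem tacc_eq (c : ℕ → ℕ → ℂ) (α β γ : ℂ) (h00 : c 0 0 = 0) (h10 : c 1 0 = 0) (h01 : c 0 1 = 0)
    (h20 : c 2 0 = 0) (h11 : c 1 1 = 0) (h30 : c 3 0 = 0) (z x y : ℂ) :
    quart c (z + α * y) (x + β * y) (γ * y) = quart (tacc c α β γ) z x y := by
  simp only [quart, tacc, h00, h10, h01, h20, h11, h30]
  ring

theorem tac_setup {F : MvPolynomial (Fin 3) ℂ} (hF : F.IsHomogeneous 4) {p : Fin 3 → ℂ}
    (h : IsTacnodeAt F p) : ∃ v u c, Ls p v u F = qpoly c ∧ (Matrix.of ![p, v, u]).det ≠ 0 ∧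
      c 0 0 = 0 ∧ c 1 0 = 0 ∧ c 0 1 = 0 ∧ c 2 0 = 0 ∧ c 1 1 = 0 ∧ c 3 0 = 0 ∧ c 0 2 ≠ 0 ∧
      4 * c 0 2 * c 4 0 - c 2 1 ^ 2 ≠ 0 := by
  obtain ⟨hsing, v, u, hli, h1, h2, h3, h4, h5⟩ := h
  obtain ⟨c, hc⟩ := exists_coords hF p v u
  rw [lin_indep_iff] at hli
  rw [coeffST_coords hc _ _ (by norm_num)] at h1 h2 h3 h4
  rw [coeffST_coords hc _ _ (by norm_num), coeffST_coords hc _ _ (by norm_num),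
    coeffST_coords hc _ _ (by norm_num)] at h5
  obtain ⟨h00, h10, h01⟩ := sing_coords hsing hc
  exact ⟨v, u, c, hc, hli, h00, h10, h01, h1, h2, h4, h3, h5⟩

theorem tac_BF {F : MvPolynomial (Fin 3) ℂ} (hF : F.IsHomogeneous 4) {p : Fin 3 → ℂ}
    (h : IsTacnodeAt F p) : ∃ O, BF F p O O ≠ 0 := by
  obtain ⟨v, u, c, hc, -, -, -, -, -, -, -, h02, -⟩ := tac_setup hF h
  refine ⟨u, ?_⟩
  rw [(hess_coords hc).2.2]
  exact mul_ne_zero two_ne_zero h02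

theorem exists_eval_ne {F : MvPolynomial (Fin 3) ℂ} (h : F ≠ 0) : ∃ O, MvPolynomial.eval O F ≠ 0 := by
  by_contra! h0
  exact h (MvPolynomial.funext fun x => by rw [h0 x, map_zero])

/-- an irreducible quartic contains no line -/
theorem irr_no_line {F : MvPolynomial (Fin 3) ℂ} (hF : F.IsHomogeneous 4) (hirr : Irreducible F)
    {p v u : Fin 3 → ℂ} (hdet : (Matrix.of ![p, v, u]).det ≠ 0)
    (hl : ∀ z x : ℂ, MvPolynomial.eval (z • p + x • v) F = 0) : False := by
  obtain ⟨O, hO⟩ := exists_eval_ne hirr.ne_zero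
  let n : Fin 3 → ℂ := ![p 1 * v 2 - p 2 * v 1, p 2 * v 0 - p 0 * v 2, p 0 * v 1 - p 1 * v 0]
  let H : MvPolynomial (Fin 3) ℂ := ∑ i, MvPolynomial.C (n i) * MvPolynomial.X i
  have hHe : ∀ w, MvPolynomial.eval w H = (Matrix.of ![p, v, w]).det := by
    intro w
    rw [Matrix.det_fin_three]
    simp [H, n, Fin.sum_univ_three]
    ring
  have hH1 : H.IsHomogeneous 1 := by
    apply MvPolynomial.IsHomogeneous.sum
    intro i _
    have := (MvPolynomial.isHomogeneous_C (Fin 3) (n i)).mul (MvPolynomial.isHomogeneous_X ℂ i)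
    simpa using this
  have hdv : ¬ F ∣ H := by
    rintro ⟨K, hK⟩
    have hH0 : H ≠ 0 := by
      intro h0; apply hdet; rw [← hHe, h0, map_zero]
    have hK0 : K ≠ 0 := by rintro rfl; exact hH0 (by rw [hK, mul_zero])
    have h1 := hH1.totalDegree hH0
    rw [hK, MvPolynomial.totalDegree_mul_of_isDomain hirr.ne_zero hK0, hF.totalDegree hirr.ne_zero] at h1
    omega
  obtain ⟨b, hb⟩ := coprime_line hF hirr O hO H hdv
  obtain ⟨μ, β, l, hOe⟩ := exists_coeffs hdet O
  obtain ⟨μ', β', l', hbe⟩ := exists_coeffs hdet b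
  have hl0 : l ≠ 0 := by
    rintro rfl
    apply hO
    rw [hOe, zero_smul, add_zero]
    exact hl _ _
  have he : b + (-(l' / l)) • O = (μ' - l' / l * μ) • p + (β' - l' / l * β) • v := by
    rw [hbe, hOe]
    ext i
    simp only [Pi.add_apply, Pi.smul_apply, smul_eq_mul]
    field_simp
    ring
  refine hb (-(l' / l)) ⟨?_, ?_⟩
  · rw [he]; exact hl _ _
  · rw [he, hHe, Matrix.det_fin_three]
    simp
    ring

theorem tac_local {F : MvPolynomial (Fin 3) ℂ} (hF : F.IsHomogeneous 4) (hirr : Irreducible F)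
    {p : Fin 3 → ℂ} (h : IsTacnodeAt F p) : SingLocal F p 6 := by
  obtain ⟨v, u, c, hc, hd0, h00, h10, h01, h20, h11, h30, h02, hdisc⟩ := tac_setup hF h
  intro O b hO hdet
  obtain ⟨α, β, γ, hOe⟩ := exists_coeffs hd0 O
  have hc' : Ls p v O F = qpoly (tacc c α β γ) := by
    apply coords_of_eval
    intro z x y
    rw [← tacc_eq c α β γ h00 h10 h01 h20 h11 h30, ← eval_coords hc]
    congr 1
    rw [hOe]
    congr 1
    ext i
    simp only [Pi.add_apply, Pi.smul_apply, smul_eq_mul]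
    ring
  have k3 := (hess_coords hc').2.2
  have e02 : tacc c α β γ 0 2 = c 0 2 * γ ^ 2 := by simp [tacc]
  have e21 : tacc c α β γ 2 1 = c 2 1 * γ + 0 := by simp [tacc]
  have e40 : tacc c α β γ 4 0 = c 4 0 := by simp [tacc]
  have hγ : γ ≠ 0 := by
    rintro rfl
    apply hO; rw [k3, e02]; ring
  have hd : (Matrix.of ![p, v, O]).det ≠ 0 := by
    have : (Matrix.of ![p, v, O]).det = γ * (Matrix.of ![p, v, u]).det := by
      rw [Matrix.det_fin_three, Matrix.det_fin_three, hOe]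
      simp
      ring
    rw [this]; exact mul_ne_zero hγ hd0
  have h40 : c 4 0 ≠ 0 := by
    intro h40
    apply irr_no_line hF hirr hd0
    intro z x
    have := eval_coords hc z x 0
    rw [zero_smul, add_zero] at this
    rw [this, quart, h00, h10, h20, h30, h40]
    ring
  have h02' : tacc c α β γ 0 2 ≠ 0 := by rw [e02]; exact mul_ne_zero h02 (pow_ne_zero _ hγ)
  obtain ⟨μ, β', l, hve⟩ := exists_coeffs hdet v
  refine ⟨β', l, μ, v, ?_, by rw [hve]; abel, ?_, mult2 h.1 hc' h02'⟩
  · rintro rfl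
    apply hd
    rw [Matrix.det_fin_three, hve]
    simp
    ring
  · apply LocExp_of_hB hc' hd
    intro U hU y hy hx hx0 h0
    refine hB_tac U _ (fun h => h) y hx hy hx0 h0 rfl rfl rfl rfl rfl rfl h02' (by rwa [e40]) ?_
    rw [e02, e21, e40]
    intro h
    have : γ ^ 2 * (4 * c 0 2 * c 4 0 - c 2 1 ^ 2) = 0 := by linear_combination h
    exact mul_ne_zero (pow_ne_zero _ hγ) hdisc this

end

section

def dl (a b : Fin 3 → ℂ) : (Fin 3 → ℂ) →ₗ[ℂ] ℂ where
  toFun x := (Matrix.of ![a, b, x]).det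
  map_add' x y := by
    rw [Matrix.det_fin_three, Matrix.det_fin_three, Matrix.det_fin_three]; simp; ring
  map_smul' s x := by
    rw [Matrix.det_fin_three, Matrix.det_fin_three]; simp; ring

theorem dl_apply (a b x : Fin 3 → ℂ) : dl a b x = (Matrix.of ![a, b, x]).det := rfl

theorem dl_ne_zero {a b : Fin 3 → ℂ} (h : LinearIndependent ℂ ![a, b]) : dl a b ≠ 0 := by
  intro h0
  rw [← crossProduct_ne_zero_iff_linearIndependent] at h
  apply h
  have h1 := LinearMap.congr_fun h0 (Pi.single 0 1)
  have h2 := LinearMap.congr_fun h0 (Pi.single 1 1)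
  have h3 := LinearMap.congr_fun h0 (Pi.single 2 1)
  rw [dl_apply, Matrix.det_fin_three, LinearMap.zero_apply] at h1 h2 h3
  simp at h1 h2 h3
  rw [cross_apply]
  ext i
  fin_cases i
  · simp; linear_combination h1
  · simp; linear_combination h2
  · simp; linear_combination h3

theorem li_iff {a b : Fin 3 → ℂ} (ha : a ≠ 0) : LinearIndependent ℂ ![a, b] ↔ ∀ s : ℂ, b ≠ s • a := by
  rw [LinearIndependent.pair_iff' ha]
  exact forall_congr' fun s => ⟨fun h h' => h h'.symm, fun h h' => h h'.symm⟩

theorem li_of_eval {G : MvPolynomial (Fin 3) ℂ} (h : G.IsHomogeneous 4) {q O : Fin 3 → ℂ} (hq0 : q ≠ 0)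
    (hq : MvPolynomial.eval q G = 0) (hO : MvPolynomial.eval O G ≠ 0) : LinearIndependent ℂ ![q, O] := by
  rw [li_iff hq0]
  rintro s rfl
  apply hO
  rw [eval_hom h, hq, mul_zero]

theorem exists_det {a b : Fin 3 → ℂ} (h : LinearIndependent ℂ ![a, b]) :
    ∃ x, (Matrix.of ![a, b, x]).det ≠ 0 := by
  by_contra! h0
  exact dl_ne_zero h (LinearMap.ext fun x => h0 x)

theorem det_rot (a b c : Fin 3 → ℂ) : (Matrix.of ![a, b, c]).det = (Matrix.of ![c, a, b]).det := by
  rw [Matrix.det_fin_three, Matrix.det_fin_three]; simp; ring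

theorem det_swap (a b c : Fin 3 → ℂ) : (Matrix.of ![a, b, c]).det = -(Matrix.of ![a, c, b]).det := by
  rw [Matrix.det_fin_three, Matrix.det_fin_three]; simp; ring

theorem sing_mult {F : MvPolynomial (Fin 3) ℂ} (hF : F.IsHomogeneous 4) {p O b : Fin 3 → ℂ} {k : ℕ}
    (hloc : SingLocal F p k) (hO : MvPolynomial.eval O F ≠ 0) (hB : BF F p O O ≠ 0)
    (hdet : (Matrix.of ![p, b, O]).det ≠ 0) (hb : Rs F O b ≠ 0)
    (hoth : ∀ y : ℂ, y ≠ 0 → MvPolynomial.eval (p + y • O) F = 0 →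
      MvPolynomial.eval (p + y • O) (hs F) ≠ 0) :
    (chow F O p b).rootMultiplicity 0 = 2 * k := by
  obtain ⟨β, l, μ, v, hβ, hv, h1, h2⟩ := hloc O b hB hdet
  rw [← transfer hF O p b p v hO hb 1 0 0 β l μ one_ne_zero hβ (by simp) hv,
    core_mult hF O p v hO k h1 hoth, h2]

theorem exists_W {F : MvPolynomial (Fin 3) ℂ} (hF0 : F ≠ 0) {p : Fin 3 → ℂ}
    (hB : ∃ O, BF F p O O ≠ 0) : ∃ O, MvPolynomial.eval O F ≠ 0 ∧ BF F p O O ≠ 0 := by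
  let B : MvPolynomial (Fin 3) ℂ := ∑ i, MvPolynomial.X i *
    ∑ j, MvPolynomial.C (hessMat F p i j) * MvPolynomial.X j
  have hBe : ∀ O, MvPolynomial.eval O B = BF F p O O := by
    intro O
    simp [B, BF, dotProduct, Matrix.mulVec]
  have hB0 : B ≠ 0 := by
    obtain ⟨O, hO⟩ := hB
    intro h0; apply hO; rw [← hBe, h0, map_zero]
  obtain ⟨O, hO⟩ := exists_eval_ne (mul_ne_zero hF0 hB0)
  rw [map_mul, hBe] at hO
  exact ⟨O, left_ne_zero_of_mul hO, right_ne_zero_of_mul hO⟩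

theorem not_dvd_hs {F : MvPolynomial (Fin 3) ℂ} (hF : F.IsHomogeneous 4) {p : Fin 3 → ℂ} (hp : p ≠ 0)
    (hpF : MvPolynomial.eval p F = 0) {k : ℕ}
    (hF0 : F ≠ 0) (hB : ∃ O, BF F p O O ≠ 0) (hloc : SingLocal F p k) : ¬ F ∣ hs F := by
  intro hdvd
  obtain ⟨O, hO, hBO⟩ := exists_W hF0 hB
  obtain ⟨b, hb⟩ := exists_det (li_of_eval hF hp hpF hO)
  have hdet : (Matrix.of ![p, b, O]).det ≠ 0 := by
    rw [det_swap]; exact neg_ne_zero.2 hb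
  obtain ⟨β, l, μ, v, hβ, hv, hl, -⟩ := hloc O b hBO hdet
  obtain ⟨U, hU⟩ := exists_ultra
  have hU0 : Tendsto (fun h : ℂ => h) U (nhds 0) := le_trans hU nhdsWithin_le_nhds
  choose w hw using fun x : ℂ => exists_w hF O (p + x • v) hO
  have hP : Tendsto (fun x : ℂ => lineRestrict F (p + x • v) O) U (nhds (lineRestrict F p O)) := by
    have := (continuous_lineRestrict F (f := fun x : ℂ => p + x • v) (g := fun _ => O)
      (by fun_prop) continuous_const).tendsto 0
    simp only [zero_smul, add_zero] at this
    exact this.comp hU0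
  obtain ⟨h1, h2⟩ := lineRestrict_lead hF p O hO
  obtain ⟨ω, hω, hω0⟩ := roots_converge U _ _ 4 hP
    (by rw [← h1, Polynomial.coeff_natDegree, h2]; exact hO)
    (fun _ => MvPolynomial.eval O F) (MvPolynomial.eval O F) tendsto_const_nhds w
    (Eventually.of_forall hw)
  have hroot : ∀ x i, MvPolynomial.eval (p + x • v + w x i • O) F = 0 := by
    intro x i
    rw [(lr_eq_iff _ _ _ _ _).1 (hw x), Finset.prod_eq_zero (Finset.mem_univ i) (sub_self _), mul_zero]
  have h3 := (lr_eq_iff _ _ _ _ _).1 hω0 0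
  rw [zero_smul, add_zero, hpF] at h3
  obtain ⟨i, -, hi⟩ := Finset.prod_eq_zero_iff.1 ((mul_eq_zero.1 h3.symm).resolve_left hO)
  have hi0 : ω i = 0 := by simpa using hi
  obtain ⟨κ, hκ, hκt⟩ := hl U hU (fun x => w x i) (hi0 ▸ hω i) (Eventually.of_forall fun x => hroot x i)
  apply hκ
  refine tendsto_nhds_unique hκt (tendsto_const_nhds.congr fun x => ?_)
  obtain ⟨K, hK⟩ := hdvd
  rw [hK, map_mul, hroot x i, zero_mul, zero_div]

end

section

theorem Z_smul {G : MvPolynomial (Fin 3) ℂ} (h : G.IsHomogeneous 4) {q : Fin 3 → ℂ} (hq : Z G q) {s : ℂ}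
    (hs0 : s ≠ 0) : Z G (s • q) := by
  refine ⟨smul_ne_zero hs0 hq.1, ?_, ?_⟩
  · rw [eval_hom h, hq.2.1, mul_zero]
  · rw [eval_hom (hs_hom h), hq.2.2, mul_zero]

structure PF (G : MvPolynomial (Fin 3) ℂ) (O a b : Fin 3 → ℂ) : Prop where
  hom : G.IsHomogeneous 4
  hO : MvPolynomial.eval O G ≠ 0
  det : (Matrix.of ![a, b, O]).det ≠ 0
  hb : Rs G O b ≠ 0

structure Fr (G : MvPolynomial (Fin 3) ℂ) (O a b : Fin 3 → ℂ) : Prop extends PF G O a b where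
  inj : ∀ q q', Z G q → Z G q' → (Matrix.of ![q, q', O]).det = 0 → ∃ s : ℂ, s ≠ 0 ∧ q' = s • q

variable {G : MvPolynomial (Fin 3) ℂ} {O a b : Fin 3 → ℂ}

theorem coord_unique (hdet : (Matrix.of ![a, b, O]).det ≠ 0) {x y z x' y' z' : ℂ}
    (h : z • a + x • b + y • O = z' • a + x' • b + y' • O) : z = z' ∧ x = x' ∧ y = y' := by
  rw [← lin_indep_iff, Fintype.linearIndependent_iff] at hdet
  have h1 := hdet ![z - z', x - x', y - y'] (by
    rw [Fin.sum_univ_three]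
    change (z - z') • a + (x - x') • b + (y - y') • O = 0
    rw [← sub_eq_zero] at h
    rw [← h]; module)
  refine ⟨sub_eq_zero.1 (h1 0), sub_eq_zero.1 (h1 1), sub_eq_zero.1 (h1 2)⟩

theorem pt_ne_zero (hdet : (Matrix.of ![a, b, O]).det ≠ 0) (x y : ℂ) : a + x • b + y • O ≠ 0 := by
  intro h
  have := coord_unique hdet (x := x) (y := y) (z := 1) (x' := 0) (y' := 0) (z' := 0) (by simpa using h)
  exact one_ne_zero this.1

theorem PF.coords (h : PF G O a b) {q : Fin 3 → ℂ} (hq : Z G q) :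
    ∃ s x y : ℂ, s ≠ 0 ∧ q = s • (a + x • b + y • O) ∧ (chow G O a b).eval x = 0 := by
  obtain ⟨s, x, y, he⟩ := exists_coeffs h.det q
  have hs0 : s ≠ 0 := by
    rintro rfl
    rw [zero_smul, zero_add] at he
    by_cases hx : x = 0
    · rw [hx, zero_smul, zero_add] at he
      have h1 := hq.2.1
      rw [he, eval_hom h.hom] at h1
      have h2 := (mul_eq_zero.1 h1).resolve_right h.hO
      have h3 : y = 0 := by simpa using h2
      exact hq.1 (by rw [he, h3, zero_smul])
    · apply h.hb
      rw [Rs_eq_zero_iff h.hom O b h.hO]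
      have h2 := Z_smul h.hom hq (inv_ne_zero hx)
      have h3 : x⁻¹ • q = b + (x⁻¹ * y) • O := by
        rw [he, smul_add, smul_smul, smul_smul, inv_mul_cancel₀ hx, one_smul]
      rw [h3] at h2
      exact ⟨_, h2.2⟩
  have he2 : q = s • (a + (s⁻¹ * x) • b + (s⁻¹ * y) • O) := by
    rw [he, smul_add, smul_add, smul_smul, smul_smul, ← mul_assoc, ← mul_assoc, mul_inv_cancel₀ hs0,
      one_mul, one_mul]
  refine ⟨s, s⁻¹ * x, s⁻¹ * y, hs0, he2, ?_⟩
  rw [eval_chow, Rs_eq_zero_iff h.hom O _ h.hO]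
  have h2 := Z_smul h.hom hq (inv_ne_zero hs0)
  rw [he2, smul_smul, inv_mul_cancel₀ hs0, one_smul] at h2
  exact ⟨_, h2.2⟩

theorem PF.chow_ne (h : PF G O a b) : chow G O a b ≠ 0 := by
  intro h0
  have := (chow_degree h.hom O a b h.hO h.hb).2
  rw [h0, Polynomial.leadingCoeff_zero] at this
  exact h.hb this.symm

theorem PF.finite (h : PF G O a b) : {x : Projectivization ℂ (Fin 3 → ℂ) | Z G x.rep}.Finite := by
  classical
  have hsub : {x : Projectivization ℂ (Fin 3 → ℂ) | Z G x.rep} ⊆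
      ⋃ r ∈ (chow G O a b).roots.toFinset, ⋃ y ∈ (lineRestrict G (a + r • b) O).roots.toFinset,
        {x | ∃ s : ℂ, s ≠ 0 ∧ x.rep = s • (a + r • b + y • O)} := by
    intro x hx
    obtain ⟨s, r, y, hs0, he, hr⟩ := h.coords hx
    have hl := lineRestrict_lead h.hom (a + r • b) O h.hO
    have hl0 : lineRestrict G (a + r • b) O ≠ 0 := by
      intro h0
      rw [h0, Polynomial.leadingCoeff_zero] at hl
      exact h.hO hl.2.symm
    simp only [Set.mem_iUnion, Multiset.mem_toFinset, Polynomial.mem_roots h.chow_ne,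
      Polynomial.IsRoot.def]
    refine ⟨r, hr, y, ?_, s, hs0, he⟩
    rw [Polynomial.mem_roots hl0, Polynomial.IsRoot.def, eval_lineRestrict]
    have h2 := Z_smul h.hom hx (inv_ne_zero hs0)
    rw [he, smul_smul, inv_mul_cancel₀ hs0, one_smul] at h2
    exact h2.2.1
  refine Set.Finite.subset ?_ hsub
  refine Set.Finite.biUnion (Finset.finite_toSet _) fun r _ => ?_
  refine Set.Finite.biUnion (Finset.finite_toSet _) fun y _ => ?_
  apply Set.Subsingleton.finite
  rintro x ⟨s, hs0, hx⟩ x' ⟨s', hs0', hx'⟩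
  rw [← x.mk_rep, ← x'.mk_rep, Projectivization.mk_eq_mk_iff']
  refine ⟨s * s'⁻¹, ?_⟩
  rw [hx, hx', smul_smul, mul_assoc, inv_mul_cancel₀ hs0', mul_one]

open Classical in
def cnt {n : ℕ} (w : Fin n → Fin 3 → ℂ) (q : Fin 3 → ℂ) : ℕ :=
  (Finset.univ.filter fun i => ∃ s : ℂ, s ≠ 0 ∧ q = s • w i).card

theorem cnt_smul {n : ℕ} (w : Fin n → Fin 3 → ℂ) (q : Fin 3 → ℂ) (u : ℂ) (hu : u ≠ 0) :
    cnt w (u • q) = cnt w q := by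
  classical
  unfold cnt
  congr 1
  ext i
  simp only [Finset.mem_filter, Finset.mem_univ, true_and]
  constructor
  · rintro ⟨s, hs0, he⟩
    refine ⟨u⁻¹ * s, mul_ne_zero (inv_ne_zero hu) hs0, ?_⟩
    rw [← smul_smul, ← he, smul_smul, inv_mul_cancel₀ hu, one_smul]
  · rintro ⟨s, hs0, he⟩
    exact ⟨u * s, mul_ne_zero hu hs0, by rw [he, smul_smul]⟩

theorem cnt_not_Z {n : ℕ} (h : G.IsHomogeneous 4) (w : Fin n → Fin 3 → ℂ) (hw : ∀ i, Z G (w i))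
    {q : Fin 3 → ℂ} (hq : ¬ Z G q) : cnt w q = 0 := by
  classical
  unfold cnt
  rw [Finset.card_eq_zero, Finset.filter_eq_empty_iff]
  rintro i - ⟨s, hs0, rfl⟩
  exact hq (Z_smul h (hw i) hs0)

theorem PF.list (h : PF G O a b) : ∃ r y : Fin 24 → ℂ,
    chow G O a b = Polynomial.C (Rs G O b) * ∏ i, (Polynomial.X - Polynomial.C (r i)) ∧
    ∀ i, Z G (a + r i • b + y i • O) := by
  obtain ⟨h1, h2⟩ := chow_degree h.hom O a b h.hO h.hb
  obtain ⟨r, hr⟩ := exists_roots_form (chow G O a b) 24 h1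
  rw [h2] at hr
  have : ∀ i, ∃ y : ℂ, MvPolynomial.eval (a + r i • b + y • O) G = 0 ∧
      MvPolynomial.eval (a + r i • b + y • O) (hs G) = 0 := by
    intro i
    rw [← Rs_eq_zero_iff h.hom O _ h.hO, ← eval_chow, hr, Polynomial.eval_mul, Polynomial.eval_prod,
      Finset.prod_eq_zero (Finset.mem_univ i) (by simp), mul_zero]
  choose y hy using this
  exact ⟨r, y, hr, fun i => ⟨pt_ne_zero h.det _ _, hy i⟩⟩

theorem Fr.cnt_eq (h : Fr G O a b) {r y : Fin 24 → ℂ}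
    (hr : chow G O a b = Polynomial.C (Rs G O b) * ∏ i, (Polynomial.X - Polynomial.C (r i)))
    (hy : ∀ i, Z G (a + r i • b + y i • O)) {q : Fin 3 → ℂ} (hq : Z G q) {s x1 y1 : ℂ} (hs0 : s ≠ 0)
    (he : q = s • (a + x1 • b + y1 • O)) :
    cnt (fun i => a + r i • b + y i • O) q = (chow G O a b).rootMultiplicity x1 := by
  classical
  rw [hr, rootMult_form _ h.hb]
  unfold cnt
  congr 1
  ext i
  simp only [Finset.mem_filter, Finset.mem_univ, true_and]
  constructor
  · rintro ⟨s', hs', he'⟩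
    rw [he] at he'
    have := coord_unique h.det (z := s) (x := s * x1) (y := s * y1) (z' := s') (x' := s' * r i)
      (y' := s' * y i) (by
        rw [smul_add, smul_add, smul_add, smul_add] at he'
        simpa [smul_smul] using he')
    obtain ⟨rfl, h2, -⟩ := this
    exact (mul_left_cancel₀ hs0 h2).symm
  · intro hi
    refine h.inj _ _ (hy i) hq ?_
    rw [he, hi, Matrix.det_fin_three]
    simp
    ring

theorem Fr.hoth (h : Fr G O a b) {q : Fin 3 → ℂ} (hq : Z G q) : ∀ y : ℂ, y ≠ 0 →
    MvPolynomial.eval (q + y • O) G = 0 → MvPolynomial.eval (q + y • O) (hs G) ≠ 0 := by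
  intro y hy h1 h2
  have hli := li_of_eval h.hom hq.1 hq.2.1 h.hO
  rw [li_iff hq.1] at hli
  have hO : ∀ s : ℂ, q + y • O ≠ s • q := by
    intro s hs
    apply hli (y⁻¹ * (s - 1))
    have : y • O = (s - 1) • q := by rw [sub_smul, one_smul, ← hs]; abel
    rw [← smul_smul, ← this, smul_smul, inv_mul_cancel₀ hy, one_smul]
  have hne : q + y • O ≠ 0 := by simpa using hO 0
  obtain ⟨s, -, hs⟩ := h.inj q (q + y • O) hq ⟨hne, h1, h2⟩ (by
    rw [Matrix.det_fin_three]; simp; ring)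
  exact hO s hs

theorem Fr.of_generic (h : PF G O a b) (hg : ∀ x x' : Projectivization ℂ (Fin 3 → ℂ), Z G x.rep →
    Z G x'.rep → x ≠ x' → dl x.rep x'.rep O ≠ 0) : Fr G O a b := by
  refine ⟨h, fun q q' hq hq' hd => ?_⟩
  have hr : ∀ q (hq : Z G q), ∃ s : ℂ, s ≠ 0 ∧ (Projectivization.mk ℂ q hq.1).rep = s • q := by
    intro q hq
    obtain ⟨u, hu⟩ := Projectivization.exists_smul_eq_mk_rep ℂ q hq.1
    exact ⟨u, u.ne_zero, hu.symm⟩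
  obtain ⟨s, hs0, he⟩ := hr q hq
  obtain ⟨s', hs0', he'⟩ := hr q' hq'
  by_contra hcon
  refine hg (Projectivization.mk ℂ q hq.1) (Projectivization.mk ℂ q' hq'.1)
    (he ▸ Z_smul h.hom hq hs0) (he' ▸ Z_smul h.hom hq' hs0') ?_ ?_
  · intro heq
    rw [Projectivization.mk_eq_mk_iff] at heq
    obtain ⟨u, hu⟩ := heq
    refine hcon ⟨((u⁻¹ : ℂˣ) : ℂ), u⁻¹.ne_zero, ?_⟩
    rw [← hu]
    change q' = u⁻¹ • u • q'
    rw [inv_smul_smul]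
  · rw [dl_apply, he, he']
    have : (Matrix.of ![s • q, s' • q', O]).det = s * s' * (Matrix.of ![q, q', O]).det := by
      rw [Matrix.det_fin_three, Matrix.det_fin_three]; simp; ring
    rw [this, hd, mul_zero]

theorem dl_rep_ne {x x' : Projectivization ℂ (Fin 3 → ℂ)} (h : x ≠ x') : dl x.rep x'.rep ≠ 0 := by
  apply dl_ne_zero
  rw [← Projectivization.independent_pair_iff_ne, Projectivization.independent_iff] at h
  have e : ![x.rep, x'.rep] = Projectivization.rep ∘ ![x, x'] := by
    ext i j; fin_cases i <;> rfl
  rw [e]; exact h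

end

section

theorem sing_Z {F : MvPolynomial (Fin 3) ℂ} (hF : F.IsHomogeneous 4) {p : Fin 3 → ℂ} (hp : p ≠ 0)
    (hF0 : F ≠ 0) (hsing : SingAt F p) : Z F p := by
  refine ⟨hp, hsing.1, ?_⟩
  obtain ⟨O, hO⟩ := exists_eval_ne hF0
  obtain ⟨b, hb⟩ := exists_det (li_of_eval hF hp hsing.1 hO)
  obtain ⟨c, hc⟩ := exists_coords hF p O b
  obtain ⟨h00, h10, h01⟩ := sing_coords hsing hc
  have h := hs_coords hc 0 0 (by simp [quart, h00])
  rw [zero_smul, zero_smul, add_zero, add_zero, hB, qx, qy, h10, h01] at h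
  have h2 : (Matrix.of ![p, O, b]).det ^ 2 * MvPolynomial.eval p (hs F) = 0 := by rw [h]; ring
  exact (mul_eq_zero.1 h2).resolve_left (pow_ne_zero _ hb)

theorem finite_S {F : MvPolynomial (Fin 3) ℂ} (hF : F.IsHomogeneous 4) (hirr : Irreducible F)
    (hdvd : ¬ F ∣ hs F) : {x : Projectivization ℂ (Fin 3 → ℂ) | Z F x.rep}.Finite := by
  obtain ⟨O, hO⟩ := exists_eval_ne hirr.ne_zero
  obtain ⟨b, hb⟩ := coprime_line hF hirr O hO _ hdvd
  have h0 : MvPolynomial.eval 0 F = 0 ∧ MvPolynomial.eval 0 (hs F) = 0 := by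
    have h1 := eval_hom hF 0 0
    have h2 := eval_hom (hs_hom hF) 0 0
    simp only [zero_smul] at h1 h2
    rw [h1, h2]; simp
  have hO0 : O ≠ 0 := by rintro rfl; exact hO h0.1
  have hli : LinearIndependent ℂ ![O, b] := by
    rw [li_iff hO0]
    rintro s rfl
    apply hb (-s)
    rw [neg_smul, add_neg_cancel]
    exact h0
  obtain ⟨a, ha⟩ := exists_det hli
  have : PF F O a b := by
    refine ⟨hF, hO, ?_, ?_⟩
    · have hd : (Matrix.of ![a, b, O]).det = -(Matrix.of ![O, b, a]).det := by
        rw [Matrix.det_fin_three, Matrix.det_fin_three]; simp; ring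
      rw [hd]; exact neg_ne_zero.2 ha
    · rw [Ne, Rs_eq_zero_iff hF O b hO]
      rintro ⟨y, hy⟩
      exact hb y hy
  exact this.finite

theorem central_frame {F : MvPolynomial (Fin 3) ℂ} (hF : F.IsHomogeneous 4) (hirr : Irreducible F)
    {p : Fin 3 → ℂ} (hp : p ≠ 0) (hsing : SingAt F p) {k : ℕ} (hB : ∃ O, BF F p O O ≠ 0)
    (hloc : SingLocal F p k) :
    ∃ O b, Fr F O p b ∧ (chow F O p b).rootMultiplicity 0 = 2 * k := by
  have hfin := finite_S hF hirr (not_dvd_hs hF hp hsing.1 hirr.ne_zero hB hloc)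
  have hZp := sing_Z hF hp hirr.ne_zero hsing
  have hWo : IsOpen {O : Fin 3 → ℂ | MvPolynomial.eval O F ≠ 0 ∧ BF F p O O ≠ 0} := by
    apply IsOpen.inter
    · exact isOpen_ne_fun (continuous_eval F) continuous_const
    · refine isOpen_ne_fun ?_ continuous_const
      unfold BF dotProduct Matrix.mulVec dotProduct
      fun_prop
  obtain ⟨O, ⟨hO, hBO⟩, hgen⟩ := exists_generic _ hWo (exists_W hirr.ne_zero hB)
    {xx : Projectivization ℂ (Fin 3 → ℂ) × Projectivization ℂ (Fin 3 → ℂ) |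
      Z F xx.1.rep ∧ Z F xx.2.rep ∧ xx.1 ≠ xx.2}
    ((hfin.prod hfin).subset fun xx h => ⟨h.1, h.2.1⟩)
    (fun xx => dl xx.1.rep xx.2.rep) (fun xx h => dl_rep_ne h.2.2)
  obtain ⟨b, -, hb⟩ := exists_generic (Set.univ : Set (Fin 3 → ℂ)) isOpen_univ Set.univ_nonempty
    {x : Projectivization ℂ (Fin 3 → ℂ) | Z F x.rep} hfin (fun x => dl x.rep O)
    (fun x hx => dl_ne_zero (li_of_eval hF hx.1 hx.2.1 hO))
  have hb' : ∀ q, Z F q → (Matrix.of ![q, O, b]).det ≠ 0 := by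
    intro q hq
    obtain ⟨u, hu⟩ := Projectivization.exists_smul_eq_mk_rep ℂ q hq.1
    have h1 := hb (Projectivization.mk ℂ q hq.1) (by
      change Z F _
      rw [← hu]; exact Z_smul hF hq u.ne_zero)
    rw [dl_apply, ← hu] at h1
    intro h0
    apply h1
    have : (Matrix.of ![(u : ℂ) • q, O, b]).det = u * (Matrix.of ![q, O, b]).det := by
      rw [Matrix.det_fin_three, Matrix.det_fin_three]; simp; ring
    exact this.trans (by rw [h0, mul_zero])
  have hdet : (Matrix.of ![p, b, O]).det ≠ 0 := by
    rw [det_swap]; exact neg_ne_zero.2 (hb' p hZp)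
  have hRs : Rs F O b ≠ 0 := by
    rw [Ne, Rs_eq_zero_iff hF O b hO]
    rintro ⟨y, h1, h2⟩
    by_cases h0 : b + y • O = 0
    · apply hb' p hZp
      have : b = -y • O := by rw [neg_smul]; exact eq_neg_of_add_eq_zero_left h0
      rw [this, Matrix.det_fin_three]; simp; ring
    · apply hb' _ ⟨h0, h1, h2⟩
      rw [Matrix.det_fin_three]; simp; ring
  have hfr : Fr F O p b := Fr.of_generic ⟨hF, hO, hdet, hRs⟩ fun x x' hx hx' hne => hgen (x, x') ⟨hx, hx', hne⟩
  exact ⟨O, b, hfr, sing_mult hF hloc hO hBO hdet hRs (hfr.hoth hZp)⟩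

/-- frame of a smooth fiber, suitable for computing flexes -/
structure SFr (G : MvPolynomial (Fin 3) ℂ) (O a b : Fin 3 → ℂ) : Prop extends Fr G O a b where
  grad : ∀ q, Z G q → dotv (gradVec G q) O ≠ 0

theorem SFr.flex {G : MvPolynomial (Fin 3) ℂ} {O a b : Fin 3 → ℂ} (h : SFr G O a b)
    (hG : IsSmoothCurve G 4) {r y : Fin 24 → ℂ}
    (hr : chow G O a b = Polynomial.C (Rs G O b) * ∏ i, (Polynomial.X - Polynomial.C (r i)))
    (hy : ∀ i, Z G (a + r i • b + y i • O)) {q : Fin 3 → ℂ} (hq : q ≠ 0) :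
    flexWeightAt G q = cnt (fun i => a + r i • b + y i • O) q := by
  by_cases hZ : Z G q
  · obtain ⟨s, x1, y1, hs0, he, -⟩ := h.coords hZ
    rw [h.cnt_eq hr hy hZ hs0 he]
    exact flex_eq_mult hG h.hO h.hb h.det hZ.2.1 (h.grad q hZ) s x1 y1 hs0 he (h.hoth hZ)
  · rw [flex_not_Z hG hq hZ, cnt_not_Z h.hom _ hy hZ]

def dotL (w : Fin 3 → ℂ) : (Fin 3 → ℂ) →ₗ[ℂ] ℂ where
  toFun := dotv w
  map_add' := dotv_add w
  map_smul' s x := dotv_smul w x s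

theorem grad_smul {G : MvPolynomial (Fin 3) ℂ} (hG : G.IsHomogeneous 4) (s : ℂ) (q O : Fin 3 → ℂ) :
    dotv (gradVec G (s • q)) O = s ^ 3 * dotv (gradVec G q) O := by
  have : gradVec G (s • q) = s ^ 3 • gradVec G q := by
    ext i
    have := eval_hom (hG.pderiv (i := i)) s q
    simpa [gradVec] using this
  rw [this]
  simp only [dotv, Pi.smul_apply, smul_eq_mul, Finset.mul_sum, mul_assoc]

theorem continuous_Rs (G : MvPolynomial (Fin 3) ℂ) (b : Fin 3 → ℂ) : Continuous fun O => Rs G O b := by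
  unfold Rs
  apply continuous_resultant
  · exact continuous_lineRestrict G continuous_const continuous_id
  · exact continuous_lineRestrict (hs G) continuous_const continuous_id

theorem exists_SFr {G : MvPolynomial (Fin 3) ℂ} {O a b : Fin 3 → ℂ} (h : PF G O a b)
    (hG : IsSmoothCurve G 4) {δ : ℝ} (hδ : 0 < δ) : ∃ O', ‖O' - O‖ < δ ∧ SFr G O' a b := by
  have hfin := h.finite
  let W : Set (Fin 3 → ℂ) := {O' | ‖O' - O‖ < δ} ∩ {O' | MvPolynomial.eval O' G ≠ 0} ∩
    {O' | dl a b O' ≠ 0} ∩ {O' | Rs G O' b ≠ 0}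
  have hWo : IsOpen W := by
    refine ((IsOpen.inter ?_ ?_).inter ?_).inter ?_
    · exact isOpen_lt (by fun_prop) continuous_const
    · exact isOpen_ne_fun (continuous_eval G) continuous_const
    · exact isOpen_ne_fun (dl a b).continuous_of_finiteDimensional continuous_const
    · exact isOpen_ne_fun (continuous_Rs G b) continuous_const
  have hWn : W.Nonempty := ⟨O, ⟨⟨by simpa using hδ, h.hO⟩, h.det⟩, h.hb⟩
  let S : Set ((Projectivization ℂ (Fin 3 → ℂ) × Projectivization ℂ (Fin 3 → ℂ)) ⊕
      Projectivization ℂ (Fin 3 → ℂ)) :=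
    (Sum.inl '' {xx | Z G xx.1.rep ∧ Z G xx.2.rep ∧ xx.1 ≠ xx.2}) ∪ (Sum.inr '' {x | Z G x.rep})
  have hS : S.Finite :=
    (((hfin.prod hfin).subset fun xx h => ⟨h.1, h.2.1⟩).image _).union (hfin.image _)
  obtain ⟨O', hO', hgen⟩ := exists_generic W hWo hWn S hS
    (Sum.elim (fun xx => dl xx.1.rep xx.2.rep) (fun x => dotL (gradVec G x.rep))) (by
      rintro i (⟨xx, hxx, rfl⟩ | ⟨x, hx, rfl⟩)
      · exact dl_rep_ne hxx.2.2
      · intro h0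
        obtain ⟨i, hi⟩ := hG.2.2 _ hx.1 hx.2.1
        apply hi
        have := LinearMap.congr_fun h0 (Pi.single i 1)
        simpa [dotL, dotv, gradVec, Pi.single_apply] using this)
  obtain ⟨⟨⟨h1, h2⟩, h3⟩, h4⟩ := hO'
  refine ⟨O', h1, Fr.of_generic ⟨h.hom, h2, h3, h4⟩ ?_, ?_⟩
  · intro x x' hx hx' hne
    exact hgen (Sum.inl (x, x')) (Or.inl ⟨_, ⟨hx, hx', hne⟩, rfl⟩)
  · intro q hq
    obtain ⟨u, hu⟩ := Projectivization.exists_smul_eq_mk_rep ℂ q hq.1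
    have h5 := hgen (Sum.inr (Projectivization.mk ℂ q hq.1)) (Or.inr ⟨_, by
      change Z G _
      rw [← hu]; exact Z_smul h.hom hq u.ne_zero, rfl⟩)
    change dotv (gradVec G _) O' ≠ 0 at h5
    rw [← hu] at h5
    intro h0
    apply h5
    exact (grad_smul h.hom (u : ℂ) q O').trans (by rw [h0, mul_zero])

end

section

theorem projNear_smul {ε : ℝ} {w p : Fin 3 → ℂ} {s : ℂ} (hs0 : s ≠ 0) :
    projNear ε (s • w) p ↔ projNear ε w p := by
  constructor
  · rintro ⟨c, hc⟩
    exact ⟨c * s, by rwa [← smul_smul]⟩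
  · rintro ⟨c, hc⟩
    refine ⟨c * s⁻¹, ?_⟩
    rwa [smul_smul, mul_assoc, inv_mul_cancel₀ hs0, mul_one]

theorem rep_mk {w : Fin 3 → ℂ} (hw : w ≠ 0) :
    ∃ s : ℂ, s ≠ 0 ∧ (Projectivization.mk ℂ w hw).rep = s • w := by
  obtain ⟨u, hu⟩ := Projectivization.exists_smul_eq_mk_rep ℂ w hw
  exact ⟨u, u.ne_zero, hu.symm⟩

theorem mk_eq_iff {w : Fin 3 → ℂ} (hw : w ≠ 0) (x : Projectivization ℂ (Fin 3 → ℂ)) :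
    Projectivization.mk ℂ w hw = x ↔ ∃ s : ℂ, s ≠ 0 ∧ x.rep = s • w := by
  constructor
  · rintro rfl
    exact rep_mk hw
  · rintro ⟨s, hs0, he⟩
    rw [← x.mk_rep, Projectivization.mk_eq_mk_iff']
    refine ⟨s⁻¹, ?_⟩
    rw [he, smul_smul, inv_mul_cancel₀ hs0, one_smul]

open Classical in
theorem finsum_cnt {n : ℕ} (w : Fin n → Fin 3 → ℂ) (hw : ∀ i, w i ≠ 0) (N : (Fin 3 → ℂ) → Prop)
    (hN : ∀ (s : ℂ) v, s ≠ 0 → (N (s • v) ↔ N v)) :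
    (∑ᶠ x : Projectivization ℂ (Fin 3 → ℂ), if N x.rep then cnt w x.rep else 0) =
      (Finset.univ.filter fun i => N (w i)).card := by
  classical
  let f : Fin n → Projectivization ℂ (Fin 3 → ℂ) := fun i => Projectivization.mk ℂ (w i) (hw i)
  have hc : ∀ x : Projectivization ℂ (Fin 3 → ℂ), cnt w x.rep = (Finset.univ.filter fun i => f i = x).card := by
    intro x
    unfold cnt
    congr 1
    ext i
    simp only [Finset.mem_filter, Finset.mem_univ, true_and]
    exact (mk_eq_iff (hw i) x).symm
  rw [finsum_eq_sum_of_support_subset (s := Finset.univ.image f)]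
  · rw [Finset.card_eq_sum_card_fiberwise (f := f) (t := Finset.univ.image f)
      (fun i _ => by simp)]
    refine Finset.sum_congr rfl fun x _ => ?_
    rw [hc, Finset.filter_filter]
    split_ifs with hx
    · congr 1
      ext i
      simp only [Finset.mem_filter, Finset.mem_univ, true_and]
      refine ⟨fun h => ⟨?_, h⟩, fun h => h.2⟩
      obtain ⟨s, hs0, he⟩ := (mk_eq_iff (hw i) x).1 h
      rwa [he, hN _ _ hs0] at hx
    · symm
      rw [Finset.card_eq_zero, Finset.filter_eq_empty_iff]
      rintro i - ⟨h1, h⟩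
      obtain ⟨s, hs0, he⟩ := (mk_eq_iff (hw i) x).1 h
      rw [he, hN _ _ hs0] at hx
      exact hx h1
  · intro x hx
    rw [Function.mem_support] at hx
    have h2 : cnt w x.rep ≠ 0 := by
      intro h0
      apply hx
      rw [h0]; simp
    rw [hc, Finset.card_ne_zero] at h2
    obtain ⟨i, hi⟩ := h2
    simp only [Finset.mem_filter, Finset.mem_univ, true_and] at hi
    simp only [Finset.coe_image, Finset.coe_univ, Set.image_univ, Set.mem_range]
    exact ⟨i, hi⟩

theorem cycleDeg_cnt {n : ℕ} (w : Fin n → Fin 3 → ℂ) (hw : ∀ i, w i ≠ 0) : cycleDeg (cnt w) = n := by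
  classical
  have := finsum_cnt w hw (fun _ => True) (fun _ _ _ => Iff.rfl)
  simpa [cycleDeg] using this

open Classical in
theorem SFr.flexNear_eq {G : MvPolynomial (Fin 3) ℂ} {O a b : Fin 3 → ℂ} (h : SFr G O a b)
    (hG : IsSmoothCurve G 4) {r y : Fin 24 → ℂ}
    (hr : chow G O a b = Polynomial.C (Rs G O b) * ∏ i, (Polynomial.X - Polynomial.C (r i)))
    (hy : ∀ i, Z G (a + r i • b + y i • O)) (p0 : Fin 3 → ℂ) (ε : ℝ) :
    flexNear G p0 ε =
      (Finset.univ.filter fun i => projNear ε (a + r i • b + y i • O) p0).card := by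
  have := finsum_cnt (fun i => a + r i • b + y i • O) (fun i => (hy i).1) (fun q => projNear ε q p0)
    (fun s v hs0 => projNear_smul hs0)
  rw [← this]
  unfold flexNear
  refine finsum_congr fun x => ?_
  split_ifs
  · rw [h.flex hG hr hy x.rep_nonzero]
  · rfl

end

section

theorem aeval_fiber {R : Type*} [CommRing R] [Algebra ℂ R] (s : Fin 3 → R) (A : MvPolynomial (Fin 4) ℂ)
    (t : ℂ) : MvPolynomial.aeval s (fiberAt A t) = MvPolynomial.aeval
      (fun i : Fin 4 => if h : (i : ℕ) < 3 then s ⟨i, h⟩ else algebraMap ℂ R t) A := by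
  unfold fiberAt
  rw [← AlgHom.comp_apply, MvPolynomial.comp_aeval]
  congr 2
  funext i
  split_ifs with h
  · simp
  · rw [← MvPolynomial.algebraMap_eq, AlgHom.commutes]

theorem continuous_fiber {R : Type*} [CommRing R] [Algebra ℂ R] [TopologicalSpace R]
    [IsTopologicalRing R] (hR : Continuous (algebraMap ℂ R)) {T : Type*} [TopologicalSpace T]
    {s : T → Fin 3 → R} (hs : ∀ i, Continuous fun τ => s τ i) {t : T → ℂ} (ht : Continuous t)
    (A : MvPolynomial (Fin 4) ℂ) :
    Continuous fun τ => MvPolynomial.aeval (s τ) (fiberAt A (t τ)) := by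
  simp only [aeval_fiber]
  apply continuous_mvaeval
  intro i
  split_ifs with h
  · exact hs _
  · exact hR.comp ht

theorem pderiv_fiber (A : MvPolynomial (Fin 4) ℂ) (t : ℂ) (i : Fin 3) :
    MvPolynomial.pderiv i (fiberAt A t) = fiberAt (MvPolynomial.pderiv i.castSucc A) t := by
  induction A using MvPolynomial.induction_on with
  | C a => simp [fiberAt]
  | add p q hp hq =>
    have h1 : fiberAt (p + q) t = fiberAt p t + fiberAt q t := map_add _ _ _
    have h2 : ∀ a b, fiberAt (a + b) t = fiberAt a t + fiberAt b t := fun a b => map_add _ _ _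
    rw [h1, map_add, map_add, h2, hp, hq]
  | mul_X p j hp =>
    have h1 : ∀ a b, fiberAt (a * b) t = fiberAt a t * fiberAt b t := fun a b => map_mul _ _ _
    have h2 : ∀ a b, fiberAt (a + b) t = fiberAt a t + fiberAt b t := fun a b => map_add _ _ _
    rw [h1, Derivation.leibniz, Derivation.leibniz, smul_eq_mul, smul_eq_mul, smul_eq_mul, smul_eq_mul,
      h2, h1, h1, hp]
    congr 2
    have h3 : fiberAt (MvPolynomial.X j) t = if h : (j : ℕ) < 3 then X ⟨j, h⟩ else MvPolynomial.C t := by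
      simp [fiberAt]
    rw [h3]
    have h10 : fiberAt 1 t = 1 := map_one _
    have h00 : fiberAt 0 t = 0 := map_zero _
    rw [MvPolynomial.pderiv_X]
    split_ifs with h
    · rw [MvPolynomial.pderiv_X]
      by_cases hij : i = ⟨j, h⟩
      · subst hij
        have : j = Fin.castSucc (⟨j, h⟩ : Fin 3) := rfl
        rw [← this, Pi.single_eq_same, Pi.single_eq_same, h10]
      · have h4 : i.castSucc ≠ j := by
          rintro rfl
          exact hij rfl
        rw [Pi.single_eq_of_ne (Ne.symm hij), Pi.single_eq_of_ne (Ne.symm h4), h00]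
    · have h4 : j ≠ i.castSucc := by
        rintro rfl
        exact h i.2
      rw [MvPolynomial.pderiv_C, Pi.single_eq_of_ne h4, h00]

def hsQ (Q : MvPolynomial (Fin 4) ℂ) : MvPolynomial (Fin 4) ℂ :=
  Matrix.det (Matrix.of fun i j : Fin 3 =>
    MvPolynomial.pderiv i.castSucc (MvPolynomial.pderiv j.castSucc Q))

theorem hs_fiber (Q : MvPolynomial (Fin 4) ℂ) (t : ℂ) : hs (fiberAt Q t) = fiberAt (hsQ Q) t := by
  unfold hs hsQ
  simp only [pderiv_fiber]
  symm
  have : ∀ M : Matrix (Fin 3) (Fin 3) (MvPolynomial (Fin 4) ℂ), fiberAt M.det t =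
    (Matrix.of fun i j => fiberAt (M i j) t).det := fun M => AlgHom.map_det _ M
  exact this _

theorem continuous_algC1 : Continuous (algebraMap ℂ (Polynomial ℂ)) := continuous_polyC

theorem continuous_algC2 : Continuous (algebraMap ℂ (Polynomial (Polynomial ℂ))) :=
  continuous_polyC.comp continuous_polyC

section
variable {T : Type*} [TopologicalSpace T] {t : T → ℂ} (ht : Continuous t)
  {O a w : T → Fin 3 → ℂ} (hO : Continuous O) (ha : Continuous a) (hw : Continuous w)
  (Q : MvPolynomial (Fin 4) ℂ)

theorem cont_eval (ht : Continuous t) (hw : Continuous w) :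
    Continuous fun τ => MvPolynomial.eval (w τ) (fiberAt Q (t τ)) := by
  have := continuous_fiber (R := ℂ) continuous_id (s := w) (fun i => by fun_prop) ht Q
  simpa [MvPolynomial.coe_aeval_eq_eval] using this

theorem cont_lr (ht : Continuous t) (ha : Continuous a) (hO : Continuous O) :
    Continuous fun τ => lineRestrict (fiberAt Q (t τ)) (a τ) (O τ) := by
  unfold lineRestrict
  refine continuous_fiber continuous_algC1 (fun i => ?_) ht Q
  refine (continuous_polyC.comp ((continuous_apply i).comp ha)).add ?_
  exact (continuous_polyC.comp ((continuous_apply i).comp hO)).mul continuous_const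

theorem cont_Rs (ht : Continuous t) (ha : Continuous a) (hO : Continuous O) :
    Continuous fun τ => Rs (fiberAt Q (t τ)) (O τ) (a τ) := by
  have he : (fun τ => Rs (fiberAt Q (t τ)) (O τ) (a τ)) = fun τ => Polynomial.resultant
      (lineRestrict (fiberAt Q (t τ)) (a τ) (O τ)) (lineRestrict (fiberAt (hsQ Q) (t τ)) (a τ) (O τ)) 4 6 := by
    funext τ
    rw [Rs, hs_fiber]
  rw [he]
  exact continuous_resultant (cont_lr Q ht ha hO) (cont_lr (hsQ Q) ht ha hO) _ _

theorem cont_chow (ht : Continuous t) (hO : Continuous O) (a b : Fin 3 → ℂ) :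
    Continuous fun τ => chow (fiberAt Q (t τ)) (O τ) a b := by
  have he : (fun τ => chow (fiberAt Q (t τ)) (O τ) a b) = fun τ => Polynomial.resultant
      (MvPolynomial.aeval (bi (O τ) a b) (fiberAt Q (t τ)))
      (MvPolynomial.aeval (bi (O τ) a b) (fiberAt (hsQ Q) (t τ))) 4 6 := by
    funext τ
    rw [chow, hs_fiber]
  rw [he]
  have hb : ∀ i, Continuous fun τ => bi (O τ) a b i := by
    intro i
    unfold bi
    refine continuous_const.add (Continuous.mul ?_ continuous_const)
    exact continuous_polyC.comp (continuous_polyC.comp ((continuous_apply i).comp hO))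
  exact continuous_resultant (continuous_fiber continuous_algC2 hb ht _)
    (continuous_fiber continuous_algC2 hb ht _) _ _

end

theorem baseChange_one (Q : MvPolynomial (Fin 4) ℂ) : baseChange Q 1 = Q := by
  unfold baseChange
  simp

end

section

theorem projNear_mono {ε ε' : ℝ} (h : ε ≤ ε') {w p : Fin 3 → ℂ} (hn : projNear ε w p) :
    projNear ε' w p := by
  obtain ⟨c, hc⟩ := hn
  exact ⟨c, hc.trans_le h⟩

theorem near_of_tendsto {T : Type*} {l : Filter T} {w : T → Fin 3 → ℂ} {W p : Fin 3 → ℂ}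
    (hw : Tendsto w l (nhds W)) {s : ℂ} (hp : p = s • W) {ε : ℝ} (hε : 0 < ε) :
    ∀ᶠ τ in l, projNear ε (w τ) p := by
  have h1 : Tendsto (fun τ => ‖s • w τ - p‖) l (nhds ‖s • W - p‖) :=
    ((hw.const_smul s).sub_const p).norm
  rw [hp, sub_self, norm_zero] at h1
  filter_upwards [h1.eventually_lt_const hε] with τ h
  exact ⟨s, by rw [hp]; exact h⟩

theorem far_of_tendsto {T : Type*} {l : Filter T} {w : T → Fin 3 → ℂ} {W p : Fin 3 → ℂ}
    (hw : Tendsto w l (nhds W)) (hW : W ≠ 0) {ε ε' : ℝ} (hε : ε < ε')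
    (hn : ¬ projNear ε' W p) : ∀ᶠ τ in l, ¬ projNear ε (w τ) p := by
  have hpos : 0 < ‖W‖ := norm_pos_iff.2 hW
  have h1 : ∀ᶠ τ in l, ‖W‖ / 2 < ‖w τ‖ := hw.norm.eventually_const_lt (half_lt_self hpos)
  have h0 : Tendsto (fun τ => ε + (ε + ‖p‖) / (‖W‖ / 2) * ‖W - w τ‖) l (nhds ε) := by
    have := ((tendsto_const_nhds (x := W)).sub hw).norm
    rw [sub_self, norm_zero] at this
    simpa using (this.const_mul ((ε + ‖p‖) / (‖W‖ / 2))).const_add ε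
  filter_upwards [h1, h0.eventually_lt_const hε] with τ h2 h3
  rintro ⟨c, hc⟩
  apply hn
  refine ⟨c, ?_⟩
  have h4 : ‖c‖ * ‖w τ‖ ≤ ε + ‖p‖ := by
    rw [← norm_smul]
    have : c • w τ = (c • w τ - p) + p := by abel
    rw [this]
    exact (norm_add_le _ _).trans (by linarith)
  have h5 : ‖c‖ ≤ (ε + ‖p‖) / (‖W‖ / 2) := by
    rw [le_div_iff₀ (by linarith)]
    exact (mul_le_mul_of_nonneg_left h2.le (norm_nonneg c)).trans h4
  have h6 : c • W - p = (c • w τ - p) + c • (W - w τ) := by rw [smul_sub]; abel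
  calc ‖c • W - p‖ ≤ ‖c • w τ - p‖ + ‖c‖ * ‖W - w τ‖ := by
        rw [h6, ← norm_smul]; exact norm_add_le _ _
    _ ≤ ε + (ε + ‖p‖) / (‖W‖ / 2) * ‖W - w τ‖ :=
        add_le_add hc.le (mul_le_mul_of_nonneg_right h5 (norm_nonneg _))
    _ < ε' := h3

theorem exists_sep {W p : Fin 3 → ℂ} (hp : p ≠ 0) (h : ¬ ∃ s : ℂ, s ≠ 0 ∧ p = s • W) :
    ∃ ε : ℝ, 0 < ε ∧ ¬ projNear ε W p := by
  let S : Submodule ℂ (Fin 3 → ℂ) := Submodule.span ℂ {W}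
  have hS : IsClosed (S : Set (Fin 3 → ℂ)) := S.closed_of_finiteDimensional
  have hpS : p ∉ (S : Set (Fin 3 → ℂ)) := by
    intro hm
    obtain ⟨s, hs⟩ := Submodule.mem_span_singleton.1 hm
    refine h ⟨s, ?_, hs.symm⟩
    rintro rfl
    exact hp (by rw [← hs, zero_smul])
  have hpos := (hS.notMem_iff_infDist_pos ⟨0, S.zero_mem⟩).1 hpS
  refine ⟨_, hpos, ?_⟩
  rintro ⟨c, hc⟩
  have := Metric.infDist_le_dist_of_mem (x := p) (show c • W ∈ (S : Set (Fin 3 → ℂ)) from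
    S.smul_mem c (Submodule.mem_span_singleton_self W))
  rw [dist_comm, dist_eq_norm] at this
  linarith

theorem exists_lists {Q : MvPolynomial (Fin 4) ℂ} {F : MvPolynomial (Fin 3) ℂ}
    (hQ : IsQuarticSmoothing Q F) {O p b : Fin 3 → ℂ} (h : PF F O p b) :
    ∃ D : ℂ → (Fin 3 → ℂ) × (Fin 24 → ℂ) × (Fin 24 → ℂ), ∀ᶠ t in nhdsWithin (0 : ℂ) {0}ᶜ,
      ‖(D t).1 - O‖ < ‖t‖ ∧ SFr (fiberAt Q t) (D t).1 p b ∧ IsSmoothCurve (fiberAt Q t) 4 ∧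
      chow (fiberAt Q t) (D t).1 p b = Polynomial.C (Rs (fiberAt Q t) (D t).1 b) *
        ∏ i, (Polynomial.X - Polynomial.C ((D t).2.1 i)) ∧
      ∀ i, Z (fiberAt Q t) (p + (D t).2.1 i • b + (D t).2.2 i • (D t).1) := by
  obtain ⟨h0, hhom, hsm⟩ := hQ
  have e1 : ∀ᶠ t in nhdsWithin (0 : ℂ) {0}ᶜ, MvPolynomial.eval O (fiberAt Q t) ≠ 0 := by
    have := (cont_eval Q continuous_id (continuous_const (y := O))).tendsto (0 : ℂ)
    exact (this.mono_left nhdsWithin_le_nhds).eventually_ne (by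
      simp only [id]; rw [h0]; exact h.hO)
  have e2 : ∀ᶠ t in nhdsWithin (0 : ℂ) {0}ᶜ, Rs (fiberAt Q t) O b ≠ 0 := by
    have := (cont_Rs Q continuous_id (continuous_const (y := b)) (continuous_const (y := O))).tendsto (0 : ℂ)
    exact (this.mono_left nhdsWithin_le_nhds).eventually_ne (by
      simp only [id]; rw [h0]; exact h.hb)
  refine Filter.Eventually.choice (r := fun t (D : (Fin 3 → ℂ) × (Fin 24 → ℂ) × (Fin 24 → ℂ)) =>
    ‖D.1 - O‖ < ‖t‖ ∧ SFr (fiberAt Q t) D.1 p b ∧ IsSmoothCurve (fiberAt Q t) 4 ∧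
      chow (fiberAt Q t) D.1 p b = Polynomial.C (Rs (fiberAt Q t) D.1 b) *
        ∏ i, (Polynomial.X - Polynomial.C (D.2.1 i)) ∧
      ∀ i, Z (fiberAt Q t) (p + D.2.1 i • b + D.2.2 i • D.1)) ?_
  filter_upwards [e1, e2, hsm, self_mem_nhdsWithin] with t h1 h2 h3 h4
  have hpf : PF (fiberAt Q t) O p b := ⟨hhom t, h1, h.det, h2⟩
  obtain ⟨O', hO', hS⟩ := exists_SFr hpf h3 (norm_pos_iff.2 h4)
  obtain ⟨r, y, hr, hy⟩ := hS.toFr.toPF.list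
  exact ⟨(O', r, y), hO', hS, h3, hr, hy⟩

theorem Fr.cnt_two {G : MvPolynomial (Fin 3) ℂ} {O a b : Fin 3 → ℂ} (h : Fr G O a b) {r y r' y' : Fin 24 → ℂ}
    (hr : chow G O a b = Polynomial.C (Rs G O b) * ∏ i, (Polynomial.X - Polynomial.C (r i)))
    (hy : ∀ i, Z G (a + r i • b + y i • O))
    (hr' : chow G O a b = Polynomial.C (Rs G O b) * ∏ i, (Polynomial.X - Polynomial.C (r' i)))
    (hy' : ∀ i, Z G (a + r' i • b + y' i • O)) (q : Fin 3 → ℂ) :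
    cnt (fun i => a + r i • b + y i • O) q = cnt (fun i => a + r' i • b + y' i • O) q := by
  by_cases hZ : Z G q
  · obtain ⟨s, x1, y1, hs0, he, -⟩ := h.coords hZ
    rw [h.cnt_eq hr hy hZ hs0 he, h.cnt_eq hr' hy' hZ hs0 he]
  · rw [cnt_not_Z h.hom _ hy hZ, cnt_not_Z h.hom _ hy' hZ]

theorem Fr.covers {G : MvPolynomial (Fin 3) ℂ} {O a b : Fin 3 → ℂ} (h : Fr G O a b) {r y : Fin 24 → ℂ}
    (hr : chow G O a b = Polynomial.C (Rs G O b) * ∏ i, (Polynomial.X - Polynomial.C (r i)))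
    (hy : ∀ i, Z G (a + r i • b + y i • O)) {q : Fin 3 → ℂ} (hq : Z G q) :
    ∃ i, ∃ s : ℂ, s ≠ 0 ∧ q = s • (a + r i • b + y i • O) := by
  obtain ⟨s, x1, y1, hs0, he, h0⟩ := h.coords hq
  have h1 := h.cnt_eq hr hy hq hs0 he
  have h2 : (chow G O a b).rootMultiplicity x1 ≠ 0 :=
    ((Polynomial.rootMultiplicity_pos h.chow_ne).2 h0).ne'
  classical
  rw [← h1] at h2
  unfold cnt at h2
  rw [Finset.card_ne_zero] at h2
  obtain ⟨i, hi⟩ := h2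
  exact ⟨i, (Finset.mem_filter.1 hi).2⟩

theorem tendsto_pair {X : Type*} [TopologicalSpace X] {l : Filter ℂ} (f : ℂ → (Fin 3 → ℂ) → X)
    (hf : Continuous fun z : ℂ × (Fin 3 → ℂ) => f z.1 z.2) {g : ℂ → Fin 3 → ℂ} {O : Fin 3 → ℂ}
    (hid : Tendsto (fun t : ℂ => t) l (nhds 0)) (hg : Tendsto g l (nhds O)) :
    Tendsto (fun t => f t (g t)) l (nhds (f 0 O)) :=
  (hf.tendsto ((0 : ℂ), O)).comp (hid.prodMk_nhds hg)

theorem limit_points {Q : MvPolynomial (Fin 4) ℂ} {F : MvPolynomial (Fin 3) ℂ}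
    (hQ : IsQuarticSmoothing Q F) {O p b : Fin 3 → ℂ} (h : Fr F O p b)
    {Of : ℂ → Fin 3 → ℂ} {r y : ℂ → Fin 24 → ℂ} (U : Ultrafilter ℂ)
    (hU : (U : Filter ℂ) ≤ nhdsWithin (0 : ℂ) {0}ᶜ)
    (hD : ∀ᶠ t in (U : Filter ℂ),
      ‖Of t - O‖ < ‖t‖ ∧
      chow (fiberAt Q t) (Of t) p b = Polynomial.C (Rs (fiberAt Q t) (Of t) b) *
        ∏ i, (Polynomial.X - Polynomial.C (r t i)) ∧
      ∀ i, Z (fiberAt Q t) (p + r t i • b + y t i • Of t)) :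
    ∃ ρ η : Fin 24 → ℂ, (∀ i, Tendsto (fun t => p + r t i • b + y t i • Of t) U
        (nhds (p + ρ i • b + η i • O))) ∧
      chow F O p b = Polynomial.C (Rs F O b) * ∏ i, (Polynomial.X - Polynomial.C (ρ i)) ∧
      ∀ i, Z F (p + ρ i • b + η i • O) := by
  obtain ⟨hQ0, hhom, -⟩ := hQ
  have hid : Tendsto (fun t : ℂ => t) U (nhds 0) := hU.trans nhdsWithin_le_nhds
  have hOf : Tendsto Of U (nhds O) := by
    rw [tendsto_iff_norm_sub_tendsto_zero]
    have hn : Tendsto (fun t : ℂ => ‖t‖) U (nhds 0) := by simpa using hid.norm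
    refine squeeze_zero' (Eventually.of_forall fun _ => norm_nonneg _) ?_ hn
    filter_upwards [hD] with t ht using ht.1.le
  have hchow : Tendsto (fun t => chow (fiberAt Q t) (Of t) p b) U (nhds (chow F O p b)) := by
    rw [← hQ0]
    exact tendsto_pair (fun t O => chow (fiberAt Q t) O p b)
      (cont_chow Q (T := ℂ × (Fin 3 → ℂ)) continuous_fst continuous_snd p b) hid hOf
  have hRs : Tendsto (fun t => Rs (fiberAt Q t) (Of t) b) U (nhds (Rs F O b)) := by
    rw [← hQ0]
    exact tendsto_pair (fun t O => Rs (fiberAt Q t) O b)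
      (cont_Rs Q (T := ℂ × (Fin 3 → ℂ)) continuous_fst (continuous_const (y := b)) continuous_snd) hid hOf
  have hc24 : (chow F O p b).coeff 24 ≠ 0 := by
    obtain ⟨h1, h2⟩ := chow_degree h.hom O p b h.hO h.hb
    rw [Polynomial.leadingCoeff, h1] at h2
    rw [h2]; exact h.hb
  obtain ⟨ρ, hρ, hform⟩ := roots_converge U _ _ 24 hchow hc24 _ _ hRs r (hD.mono fun t ht => ht.2.1)
  have hη : ∀ i, ∃ η, Tendsto (fun t => y t i) U (nhds η) := by
    intro i
    have hA : Tendsto (fun t => p + r t i • b) U (nhds (p + ρ i • b)) :=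
      tendsto_const_nhds.add ((hρ i).smul_const b)
    have htrip : Tendsto (fun t => (t, Of t, p + r t i • b)) U (nhds ((0 : ℂ), O, p + ρ i • b)) :=
      hid.prodMk_nhds (hOf.prodMk_nhds hA)
    have hlr : Tendsto (fun t => lineRestrict (fiberAt Q t) (p + r t i • b) (Of t)) U
        (nhds (lineRestrict F (p + ρ i • b) O)) := by
      have := ((cont_lr Q (T := ℂ × (Fin 3 → ℂ) × (Fin 3 → ℂ)) continuous_fst
        (continuous_snd.comp continuous_snd)
        (continuous_fst.comp continuous_snd)).tendsto (0, O, p + ρ i • b)).comp htrip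
      simp only [Function.comp_apply] at this
      rw [hQ0] at this
      exact this
    refine root_converges U _ _ 4 hlr
      (Eventually.of_forall fun t => lineRestrict_natDegree_le (hhom t) _ _) ?_ _ ?_
    · obtain ⟨h1, h2⟩ := lineRestrict_lead h.hom (p + ρ i • b) O h.hO
      rw [Polynomial.leadingCoeff, h1] at h2
      rw [h2]; exact h.hO
    · filter_upwards [hD] with t ht
      rw [eval_lineRestrict]
      exact (ht.2.2 i).2.1
  choose η hη using hη
  have hW : ∀ i, Tendsto (fun t => p + r t i • b + y t i • Of t) U (nhds (p + ρ i • b + η i • O)) :=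
    fun i => (tendsto_const_nhds.add ((hρ i).smul_const b)).add ((hη i).smul hOf)
  refine ⟨ρ, η, hW, hform, fun i => ⟨pt_ne_zero h.det _ _, ?_, ?_⟩⟩
  · have := ((cont_eval Q (T := ℂ × (Fin 3 → ℂ)) continuous_fst continuous_snd).tendsto
      (0, p + ρ i • b + η i • O)).comp (hid.prodMk_nhds (hW i))
    rw [hQ0] at this
    refine tendsto_nhds_unique this (tendsto_const_nhds.congr' ?_)
    filter_upwards [hD] with t ht
    exact (ht.2.2 i).2.1.symm
  · have := ((cont_eval (hsQ Q) (T := ℂ × (Fin 3 → ℂ)) continuous_fst continuous_snd).tendsto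
      (0, p + ρ i • b + η i • O)).comp (hid.prodMk_nhds (hW i))
    rw [← hs_fiber, hQ0] at this
    refine tendsto_nhds_unique this (tendsto_const_nhds.congr' ?_)
    filter_upwards [hD] with t ht
    have h3 := (ht.2.2 i).2.2
    rw [hs_fiber] at h3
    exact h3.symm

theorem limit_cycle {Q : MvPolynomial (Fin 4) ℂ} {F : MvPolynomial (Fin 3) ℂ}
    (hQ : IsQuarticSmoothing Q F) {O p b : Fin 3 → ℂ} (h : Fr F O p b) {r y : Fin 24 → ℂ}
    (hr : chow F O p b = Polynomial.C (Rs F O b) * ∏ i, (Polynomial.X - Polynomial.C (r i)))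
    (hy : ∀ i, Z F (p + r i • b + y i • O)) {p0 : Fin 3 → ℂ} (hp0 : p0 ≠ 0) :
    ∀ᶠ ε in nhdsWithin (0 : ℝ) (Set.Ioi 0), ∀ᶠ t in nhdsWithin (0 : ℂ) {0}ᶜ,
      flexNear (fiberAt Q t) p0 ε = cnt (fun i => p + r i • b + y i • O) p0 := by
  classical
  obtain ⟨D, hD⟩ := exists_lists hQ h.toPF
  have hsep : ∀ i, ∀ᶠ ε in nhdsWithin (0 : ℝ) (Set.Ioi 0),
      (¬ ∃ s : ℂ, s ≠ 0 ∧ p0 = s • (p + r i • b + y i • O)) →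
        ¬ projNear (2 * ε) (p + r i • b + y i • O) p0 := by
    intro i
    by_cases hi : ∃ s : ℂ, s ≠ 0 ∧ p0 = s • (p + r i • b + y i • O)
    · exact Eventually.of_forall fun ε hn => absurd hi hn
    · obtain ⟨ε0, hε0, hn⟩ := exists_sep hp0 hi
      have : ∀ᶠ ε in nhdsWithin (0 : ℝ) (Set.Ioi 0), ε < ε0 / 2 :=
        nhdsWithin_le_nhds (Iio_mem_nhds (by linarith))
      filter_upwards [this] with ε hε _ hc
      exact hn (projNear_mono (by linarith) hc)
  filter_upwards [eventually_all.2 hsep, self_mem_nhdsWithin] with ε hε hpos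
  have hpos' : (0 : ℝ) < ε := hpos
  apply eventually_of_ultra
  intro U hU
  have hDU := hD.filter_mono hU
  obtain ⟨ρ, η, hW, hform, hZ⟩ := limit_points hQ h (Of := fun t => (D t).1) (r := fun t => (D t).2.1)
    (y := fun t => (D t).2.2) U hU (hDU.mono fun t ht => ⟨ht.1, ht.2.2.2⟩)
  rw [h.cnt_two hr hy hform hZ]
  have hi : ∀ i, ∀ᶠ t in (U : Filter ℂ),
      (projNear ε (p + (D t).2.1 i • b + (D t).2.2 i • (D t).1) p0 ↔
        ∃ s : ℂ, s ≠ 0 ∧ p0 = s • (p + ρ i • b + η i • O)) := by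
    intro i
    by_cases hs : ∃ s : ℂ, s ≠ 0 ∧ p0 = s • (p + ρ i • b + η i • O)
    · obtain ⟨s, hs0, he⟩ := id hs
      filter_upwards [near_of_tendsto (hW i) he hpos'] with t ht
      exact ⟨fun _ => hs, fun _ => ht⟩
    · have hfar : ¬ projNear (2 * ε) (p + ρ i • b + η i • O) p0 := by
        obtain ⟨j, u, hu, he⟩ := h.covers hr hy (hZ i)
        rw [he, projNear_smul hu]
        apply hε j
        rintro ⟨s, hs0, hs1⟩
        refine hs ⟨s * u⁻¹, mul_ne_zero hs0 (inv_ne_zero hu), ?_⟩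
        rw [he, smul_smul, mul_assoc, inv_mul_cancel₀ hu, mul_one]
        exact hs1
      filter_upwards [far_of_tendsto (hW i) (hZ i).1 (by linarith) hfar] with t ht
      exact ⟨fun h1 => absurd h1 ht, fun h1 => absurd h1 hs⟩
  filter_upwards [hDU, eventually_all.2 hi] with t ht hit
  rw [ht.2.1.flexNear_eq ht.2.2.1 ht.2.2.2.1 ht.2.2.2.2]
  unfold cnt
  congr 1
  ext i
  simp only [Finset.mem_filter, Finset.mem_univ, true_and]
  exact hit i

theorem main_aux {F : MvPolynomial (Fin 3) ℂ} (hF : F.IsHomogeneous 4) (hirr : Irreducible F)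
    {p : Fin 3 → ℂ} (hp : p ≠ 0) (hsing : SingAt F p) {k : ℕ} (hB : ∃ O, BF F p O O ≠ 0)
    (hloc : SingLocal F p k) {Q : MvPolynomial (Fin 4) ℂ} (hQ : IsQuarticSmoothing Q F) :
    ∃ (e : ℕ) (c : (Fin 3 → ℂ) → ℕ), 1 ≤ e ∧
      IsLimitWeierstrassCycle (baseChange Q e) c ∧
      c p = 2 * k ∧ cycleDeg c = 24 := by
  obtain ⟨O, b, hfr, hmult⟩ := central_frame hF hirr hp hsing hB hloc
  obtain ⟨r, y, hr, hy⟩ := hfr.toPF.list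
  refine ⟨1, cnt (fun i => p + r i • b + y i • O), le_rfl, ⟨?_, ?_⟩, ?_, ?_⟩
  · intro u hu q
    exact cnt_smul _ _ _ hu
  · intro p0 hp0
    rw [baseChange_one]
    exact limit_cycle hQ hfr hr hy hp0
  · rw [hfr.cnt_eq hr hy (sing_Z hF hp hirr.ne_zero hsing) (s := 1) (x1 := 0) (y1 := 0) one_ne_zero
      (by simp), hmult]
  · exact cycleDeg_cnt _ fun i => (hy i).1

theorem limit_final
    (F : MvPolynomial (Fin 3) ℂ) (hF : F.IsHomogeneous 4) (hirr : Irreducible F)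
    (p : Fin 3 → ℂ) (hp : p ≠ 0) (t : ℕ)
    (hsing : (IsCuspAt F p ∧ t = 8) ∨ (IsTacnodeAt F p ∧ t = 12))
    (Q : MvPolynomial (Fin 4) ℂ) (hQ : IsQuarticSmoothing Q F) :
    ∃ (e : ℕ) (c : (Fin 3 → ℂ) → ℕ), 1 ≤ e ∧
      IsLimitWeierstrassCycle (baseChange Q e) c ∧
      c p = t ∧ cycleDeg c = 24 := by
  rcases hsing with ⟨h, rfl⟩ | ⟨h, rfl⟩
  · exact main_aux hF hirr hp h.1 (cusp_BF h) (cusp_local hF h) hQ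
  · exact main_aux hF hirr hp h.1 (tac_BF hF h) (tac_local hF hirr h) hQ

end

theorem limit_weierstrass_cycle_at_cusp_or_tacnode
    (F : MvPolynomial (Fin 3) ℂ) (hF : F.IsHomogeneous 4) (hirr : Irreducible F)
    (p : Fin 3 → ℂ) (hp : p ≠ 0) (t : ℕ)
    -- `p` is a cusp of `C` and `t = 8`, or a tacnode of `C` and `t = 12`:
    (hsing : (IsCuspAt F p ∧ t = 8) ∨ (IsTacnodeAt F p ∧ t = 12))
    -- `f : 𝒞 → B` a smoothing of `C` to plane quartics, with `𝒞` smooth: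
    (Q : MvPolynomial (Fin 4) ℂ) (hQ : IsQuarticSmoothing Q F)
    (hQsm : TotalSpaceSmooth Q) :
    -- there is a totally ramified base change `s ↦ t = sᵉ` after which the limit
    -- Weierstrass cycle is `Σ_{i=1}^{24−t} qᵢ + t·p` with `p ∉ {q₁,…,q_{24−t}}`:
    ∃ (e : ℕ) (c : (Fin 3 → ℂ) → ℕ), 1 ≤ e ∧
      IsLimitWeierstrassCycle (baseChange Q e) c ∧
      c p = t ∧ cycleDeg c = 24 := by
  exact limit_final F hF hirr p hp t hsing Q hQ

end Infl
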